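/- arXiv:1807.03465 — 2 statements merged into one kernel-verified Lean document; each statement's English description precedes it below -/
import Mathlib

section
/- Let f be an integrable logconcave function on ℝⁿ whose support has diameter at most D, and let π_f be the probability measure with density proportional to f. Then for any partition of ℝⁿ into three measurable sets S₁, S₂, S₃, one has π_f(S₃) ≥ (2·d(S₁,S₂)/D) · min{π_f(S₁), π_f(S₂)}, where d(S₁,S₂) = inf{‖x−y‖₂ : x ∈ S₁, y ∈ S₂} is the Euclidean distance between S₁ and S₂. -/
open MeasureTheory Real Filter

noncomputable section

/-- A nonnegative function is logconcave if
`f (l • x + (1-l) • y) ≥ f x ^ l * f y ^ (1-l)` for all `x, y` and `l ∈ [0,1]`. -/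
def IsLogConcave {n : ℕ} (f : EuclideanSpace ℝ (Fin n) → ℝ) : Prop :=
  ∀ x y : EuclideanSpace ℝ (Fin n), ∀ l : ℝ, 0 ≤ l → l ≤ 1 →
    f x ^ l * f y ^ (1 - l) ≤ f (l • x + (1 - l) • y)

/-- Euclidean distance between two sets: `inf {dist x y : x ∈ S, y ∈ T}`. -/
def setDist {n : ℕ} (S T : Set (EuclideanSpace ℝ (Fin n))) : ℝ :=
  sInf {r : ℝ | ∃ x ∈ S, ∃ y ∈ T, r = dist x y}

namespace LogConcaveIsoperimetry

open scoped ENNReal Topology Pointwise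

section PrekopaLeindler

/-- The one-dimensional Brunn–Minkowski inequality for compact sets. -/
lemma volume_add_volume_le_of_isCompact {A B C : Set ℝ} (hA : IsCompact A) (hB : IsCompact B)
    (hA₀ : A.Nonempty) (hB₀ : B.Nonempty) (h : ∀ a ∈ A, ∀ b ∈ B, a + b ∈ C) :
    volume A + volume B ≤ volume C := by
  obtain ⟨a, haA, ha⟩ := hA.exists_isGreatest hA₀
  obtain ⟨b, hbB, hb⟩ := hB.exists_isLeast hB₀
  have hdisj : AEDisjoint volume ((· + b) '' A) ((a + ·) '' B) := by
    refine measure_mono_null (t := {a + b}) ?_ (by simp)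
    rintro x ⟨⟨y, hy, rfl⟩, ⟨z, hz, hzx⟩⟩
    have h₁ := ha hy
    have h₂ := hb hz
    simp only [Set.mem_singleton_iff] at hzx ⊢
    linarith
  have hBm : MeasurableSet ((a + ·) '' B) := (hB.image (by fun_prop)).measurableSet
  calc volume A + volume B = volume ((· + b) '' A) + volume ((a + ·) '' B) := by
        simp
    _ = volume ((· + b) '' A ∪ (a + ·) '' B) :=
        (measure_union₀ hBm.nullMeasurableSet hdisj).symm
    _ ≤ volume C := by
        refine measure_mono ?_
        rintro x (⟨y, hy, rfl⟩ | ⟨y, hy, rfl⟩)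
        · exact h _ hy _ hbB
        · exact h _ haA _ hy

/-- The one-dimensional Brunn–Minkowski inequality for measurable sets. -/
lemma volume_add_volume_le {A B C : Set ℝ} (hA : MeasurableSet A) (hB : MeasurableSet B)
    (hA₀ : A.Nonempty) (hB₀ : B.Nonempty) (h : ∀ a ∈ A, ∀ b ∈ B, a + b ∈ C) :
    volume A + volume B ≤ volume C := by
  obtain ⟨a, ha⟩ := hA₀
  obtain ⟨b, hb⟩ := hB₀
  rw [hA.measure_eq_iSup_isCompact, hB.measure_eq_iSup_isCompact]
  simp only [iSup_and']
  refine ENNReal.biSup_add_biSup_le' ⟨∅, by simp⟩ ⟨∅, by simp⟩ ?_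
  rintro K ⟨hKA, hK⟩ L ⟨hLB, hL⟩
  calc volume K + volume L ≤ volume (insert a K) + volume (insert b L) := by
        gcongr <;> exact Set.subset_insert _ _
    _ ≤ volume C := volume_add_volume_le_of_isCompact (hK.insert a) (hL.insert b)
        (Set.insert_nonempty _ _) (Set.insert_nonempty _ _) fun x hx y hy =>
          h x (Set.insert_subset ha hKA hx) y (Set.insert_subset hb hLB hy)

lemma geom_mean_le_arith_mean {l : ℝ} (hl₀ : 0 < l) (hl₁ : l < 1) (a b : ℝ≥0∞) :
    a ^ l * b ^ (1 - l) ≤ ENNReal.ofReal l * a + ENNReal.ofReal (1 - l) * b := by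
  have hl : 0 < 1 - l := by linarith
  have e₁ : ENNReal.ofReal l ≠ 0 := by simpa using hl₀
  have e₂ : ENNReal.ofReal (1 - l) ≠ 0 := by simpa using hl₁
  rcases eq_or_ne a ∞ with rfl | ha
  · simp [ENNReal.mul_top e₁]
  rcases eq_or_ne b ∞ with rfl | hb
  · simp [ENNReal.mul_top e₂]
  lift a to NNReal using ha
  lift b to NNReal using hb
  have := NNReal.geom_mean_le_arith_mean2_weighted ⟨l, hl₀.le⟩ ⟨1 - l, hl.le⟩ a b
    (NNReal.eq (by change l + (1 - l) = 1; ring))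
  rw [← ENNReal.coe_rpow_of_nonneg _ hl₀.le, ← ENNReal.coe_rpow_of_nonneg _ hl.le,
    ENNReal.ofReal_eq_coe_nnreal hl₀.le, ENNReal.ofReal_eq_coe_nnreal hl.le]
  exact_mod_cast this

/-- The layer-cake formula for functions bounded by one. -/
lemma lintegral_eq_lintegral_volume_lt {f : ℝ → ℝ≥0∞} (hf : Measurable f) (h1 : ∀ x, f x ≤ 1) :
    ∫⁻ x, f x = ∫⁻ t in Set.Ioo (0 : ℝ) 1, volume {x | ENNReal.ofReal t < f x} := by
  have hfin : ∀ x, f x ≠ ∞ := fun x => ((h1 x).trans_lt ENNReal.one_lt_top).ne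
  have h := lintegral_eq_lintegral_meas_lt volume (f := fun x => (f x).toReal)
    (Eventually.of_forall fun x => ENNReal.toReal_nonneg) hf.ennreal_toReal.aemeasurable
  simp only [ENNReal.ofReal_toReal (hfin _)] at h
  have hS : ∀ t ∈ Set.Ioi (0 : ℝ), {x | t < (f x).toReal} = {x | ENNReal.ofReal t < f x} := by
    intro t ht
    ext x
    exact (ENNReal.ofReal_lt_iff_lt_toReal (le_of_lt ht) (hfin x)).symm
  rw [h, setLIntegral_congr_fun measurableSet_Ioi fun t ht => by rw [hS t ht]]
  rw [← lintegral_indicator measurableSet_Ioi, ← lintegral_indicator measurableSet_Ioo]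
  congr with t
  rcases lt_or_ge t 1 with ht1 | ht1
  · by_cases ht0 : 0 < t <;> simp [Set.indicator, ht0, ht1]
  · have hempty : {x | ENNReal.ofReal t < f x} = ∅ := by
      ext x
      simpa using (h1 x).trans (by simpa using ht1)
    simp [Set.indicator, hempty]

/-- The Prékopa–Leindler inequality on the line, normalised to suprema equal to one. -/
lemma prekopa_leindler_of_iSup_eq_one {u v w : ℝ → ℝ≥0∞} (hu : Measurable u) (hv : Measurable v)
    (hw : Measurable w) {l : ℝ} (hl₀ : 0 < l) (hl₁ : l < 1)
    (hu1 : ⨆ x, u x = 1) (hv1 : ⨆ x, v x = 1)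
    (h : ∀ s t, u s ^ l * v t ^ (1 - l) ≤ w (l * s + (1 - l) * t)) :
    (∫⁻ x, u x) ^ l * (∫⁻ x, v x) ^ (1 - l) ≤ ∫⁻ x, w x := by
  have hl : 0 < 1 - l := by linarith
  have hscale : ∀ {r : ℝ}, 0 < r → ∀ S : Set ℝ, volume (r • S) = ENNReal.ofReal r * volume S := by
    intro r hr S
    simp [Measure.addHaar_smul, abs_of_pos hr]
  calc (∫⁻ x, u x) ^ l * (∫⁻ x, v x) ^ (1 - l)
      ≤ ENNReal.ofReal l * (∫⁻ x, u x) + ENNReal.ofReal (1 - l) * ∫⁻ x, v x :=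
        geom_mean_le_arith_mean hl₀ hl₁ _ _
    _ ≤ ∫⁻ x, min (w x) 1 := by
        rw [lintegral_eq_lintegral_volume_lt hu fun x => hu1 ▸ le_iSup u x,
          lintegral_eq_lintegral_volume_lt hv fun x => hv1 ▸ le_iSup v x,
          lintegral_eq_lintegral_volume_lt (hw.min measurable_const) fun x => min_le_right _ _,
          ← lintegral_const_mul' _ _ ENNReal.ofReal_ne_top,
          ← lintegral_const_mul' _ _ ENNReal.ofReal_ne_top, ← lintegral_add_left']
        · refine setLIntegral_mono' measurableSet_Ioo fun t ht => ?_
          have ht1 : ENNReal.ofReal t < 1 := by simpa using ht.2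
          rw [← hscale hl₀, ← hscale hl]
          refine volume_add_volume_le ?_ ?_ ?_ ?_ ?_
          · exact (measurableSet_lt measurable_const hu).const_smul₀ l
          · exact (measurableSet_lt measurable_const hv).const_smul₀ (1 - l)
          · obtain ⟨x, hx⟩ := lt_iSup_iff.1 (hu1 ▸ ht1)
            exact Set.Nonempty.smul_set ⟨x, hx⟩
          · obtain ⟨x, hx⟩ := lt_iSup_iff.1 (hv1 ▸ ht1)
            exact Set.Nonempty.smul_set ⟨x, hx⟩
          · rintro _ ⟨s, hs, rfl⟩ _ ⟨s', hs', rfl⟩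
            simp only [Set.mem_ofPred_eq, smul_eq_mul] at hs hs' ⊢
            refine lt_min (lt_of_lt_of_le ?_ (h s s')) ht1
            have ht0 : ENNReal.ofReal t ≠ 0 := by simpa using ht.1
            calc ENNReal.ofReal t = ENNReal.ofReal t ^ l * ENNReal.ofReal t ^ (1 - l) := by
                  rw [← ENNReal.rpow_add _ _ ht0 ENNReal.ofReal_ne_top]; simp
              _ < u s ^ l * v s' ^ (1 - l) :=
                  ENNReal.mul_lt_mul (ENNReal.rpow_lt_rpow hs hl₀) (ENNReal.rpow_lt_rpow hs' hl)
        · refine (Measurable.const_mul ?_ _).aemeasurable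
          exact Antitone.measurable fun a b hab => measure_mono fun x hx =>
            (ENNReal.ofReal_le_ofReal hab).trans_lt hx
    _ ≤ ∫⁻ x, w x := lintegral_mono fun x => min_le_left _ _

/-- The Prékopa–Leindler inequality on the line, for bounded functions. -/
lemma prekopa_leindler {u v w : ℝ → ℝ≥0∞} (hu : Measurable u) (hv : Measurable v)
    (hw : Measurable w) {l : ℝ} (hl₀ : 0 < l) (hl₁ : l < 1) {M : ℝ≥0∞} (hM : M ≠ ∞)
    (huM : ∀ x, u x ≤ M) (hvM : ∀ x, v x ≤ M)
    (h : ∀ s t, u s ^ l * v t ^ (1 - l) ≤ w (l * s + (1 - l) * t)) :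
    (∫⁻ x, u x) ^ l * (∫⁻ x, v x) ^ (1 - l) ≤ ∫⁻ x, w x := by
  have hl : 0 < 1 - l := by linarith
  set U := ⨆ x, u x
  set V := ⨆ x, v x
  have hUt : U ≠ ∞ := ((iSup_le huM).trans_lt hM.lt_top).ne
  have hVt : V ≠ ∞ := ((iSup_le hvM).trans_lt hM.lt_top).ne
  rcases eq_or_ne U 0 with hU0 | hU0
  · have : ∀ x, u x = 0 := fun x => le_antisymm (hU0 ▸ le_iSup u x) bot_le
    simp [this, hl₀]
  rcases eq_or_ne V 0 with hV0 | hV0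
  · have : ∀ x, v x = 0 := fun x => le_antisymm (hV0 ▸ le_iSup v x) bot_le
    simp [this, hl]
  set W := (U⁻¹) ^ l * (V⁻¹) ^ (1 - l) with hW
  have hW0 : W ≠ 0 := by
    refine mul_ne_zero ?_ ?_ <;> simp [ENNReal.rpow_eq_zero_iff, hUt, hVt, hl₀.le, hl₁.le]
  have hWt : W ≠ ∞ := by
    refine ENNReal.mul_ne_top ?_ ?_ <;> simp [ENNReal.rpow_eq_top_iff, hU0, hV0, hl₀.le, hl₁.le]
  have hmul : ∀ a b : ℝ≥0∞, (U⁻¹ * a) ^ l * (V⁻¹ * b) ^ (1 - l) = W * (a ^ l * b ^ (1 - l)) := by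
    intro a b
    rw [ENNReal.mul_rpow_of_nonneg _ _ hl₀.le, ENNReal.mul_rpow_of_nonneg _ _ hl.le, hW]
    ring
  have key := prekopa_leindler_of_iSup_eq_one (u := fun x => U⁻¹ * u x) (v := fun x => V⁻¹ * v x)
    (w := fun x => W * w x) (hu.const_mul _) (hv.const_mul _) (hw.const_mul _) hl₀ hl₁
    (by rw [← ENNReal.mul_iSup]; exact ENNReal.inv_mul_cancel hU0 hUt)
    (by rw [← ENNReal.mul_iSup]; exact ENNReal.inv_mul_cancel hV0 hVt)
    (fun s t => by rw [hmul]; gcongr; exact h s t)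
  rw [lintegral_const_mul _ hu, lintegral_const_mul _ hv, lintegral_const_mul _ hw, hmul] at key
  exact (ENNReal.mul_le_mul_iff_right hW0 hWt).1 key

end PrekopaLeindler

section LogConcave

variable {E F : Type*} [AddCommGroup E] [Module ℝ E] [AddCommGroup F] [Module ℝ F]

/-- Logconcavity of functions with values in `[0, ∞]`. -/
def LogConcave (f : E → ℝ≥0∞) : Prop :=
  ∀ x y : E, ∀ l : ℝ, 0 < l → l < 1 → f x ^ l * f y ^ (1 - l) ≤ f (l • x + (1 - l) • y)

lemma LogConcave.min_le {f : E → ℝ≥0∞} (hf : LogConcave f) (x y : E) {l : ℝ} (h₀ : 0 < l)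
    (h₁ : l < 1) : min (f x) (f y) ≤ f (l • x + (1 - l) • y) := by
  have hl : 0 < 1 - l := by linarith
  refine le_trans ?_ (hf x y l h₀ h₁)
  set m := min (f x) (f y)
  calc m = m ^ l * m ^ (1 - l) := by
        rw [← ENNReal.rpow_add_of_nonneg _ _ h₀.le hl.le]; simp
    _ ≤ _ := by
        gcongr
        · exact min_le_left _ _
        · exact min_le_right _ _

lemma LogConcave.convex_lt {f : E → ℝ≥0∞} (hf : LogConcave f) (c : ℝ≥0∞) :
    Convex ℝ {x | c < f x} := by
  refine convex_iff_forall_pos.2 fun x hx y hy a b ha hb hab => ?_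
  obtain rfl : b = 1 - a := by linarith
  exact (lt_min hx hy).trans_le (hf.min_le x y ha (by linarith))

lemma LogConcave.measurable {f : ℝ → ℝ≥0∞} (hf : LogConcave f) : Measurable f :=
  measurable_of_Ioi fun c => (hf.convex_lt c).ordConnected.measurableSet

lemma LogConcave.comp_affine {f : E → ℝ≥0∞} (hf : LogConcave f) (g : F →ᵃ[ℝ] E) :
    LogConcave (f ∘ g) := by
  intro x y l h₀ h₁
  have hg : g (l • x + (1 - l) • y) = l • g x + (1 - l) • g y :=
    Convex.combo_affine_apply (by ring)
  simpa [hg] using hf (g x) (g y) l h₀ h₁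

lemma LogConcave.indicator {f : E → ℝ≥0∞} (hf : LogConcave f) {K : Set E} (hK : Convex ℝ K) :
    LogConcave (K.indicator f) := by
  intro x y l h₀ h₁
  have hl : 0 < 1 - l := by linarith
  by_cases hx : x ∈ K
  · by_cases hy : y ∈ K
    · rw [Set.indicator_of_mem hx, Set.indicator_of_mem hy,
        Set.indicator_of_mem (hK hx hy h₀.le hl.le (by ring))]
      exact hf x y l h₀ h₁
    · simp [Set.indicator_of_notMem hy, hl]
  · simp [Set.indicator_of_notMem hx, h₀]

lemma LogConcave.min_const {f : E → ℝ≥0∞} (hf : LogConcave f) (c : ℝ≥0∞) :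
    LogConcave fun x => min (f x) c := by
  intro x y l h₀ h₁
  have hl : 0 < 1 - l := by linarith
  refine le_min (le_trans ?_ (hf x y l h₀ h₁)) ?_
  · gcongr <;> exact min_le_left _ _
  · calc min (f x) c ^ l * min (f y) c ^ (1 - l) ≤ c ^ l * c ^ (1 - l) := by
          gcongr <;> exact min_le_right _ _
      _ = c := by rw [← ENNReal.rpow_add_of_nonneg _ _ h₀.le hl.le]; simp

/-- Marginals of bounded logconcave functions are logconcave. -/
lemma LogConcave.lintegral {f : ℝ × E → ℝ≥0∞} (hf : LogConcave f) {M : ℝ≥0∞} (hM : M ≠ ∞)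
    (hfM : ∀ x, f x ≤ M) : LogConcave fun y => ∫⁻ t, f (t, y) := by
  intro x y l h₀ h₁
  have hmeas : ∀ z, Measurable fun t => f (t, z) := fun z =>
    (hf.comp_affine ((AffineMap.id ℝ ℝ).prod (AffineMap.const ℝ ℝ z))).measurable
  exact prekopa_leindler (hmeas x) (hmeas y) (hmeas _) h₀ h₁ hM (fun _ => hfM _) (fun _ => hfM _)
    fun s t => hf (s, x) (t, y) l h₀ h₁

end LogConcave

section Line

lemma one_sub_le_one_add_mul_exp {k : ℝ} (hk : 0 ≤ k) : 1 - k ≤ (1 + k) * exp (-(2 * k)) := by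
  have hd : ∀ x : ℝ, HasDerivAt (fun x => (1 + x) * exp (-(2 * x)) - (1 - x))
      (1 - (1 + 2 * x) * exp (-(2 * x))) x := by
    intro x
    have h₁ : HasDerivAt (fun x : ℝ => exp (-(2 * x))) (exp (-(2 * x)) * (-(2 * 1))) x :=
      (((hasDerivAt_id x).const_mul 2).neg).exp
    have h₂ := ((((hasDerivAt_id x).const_add 1).mul h₁).sub ((hasDerivAt_id x).const_sub 1))
    refine h₂.congr_deriv ?_
    simp only [id]
    ring
  have hmono : MonotoneOn (fun x : ℝ => (1 + x) * exp (-(2 * x)) - (1 - x)) (Set.Ici 0) := by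
    refine monotoneOn_of_deriv_nonneg (convex_Ici 0)
      (fun x _ => (hd x).continuousAt.continuousWithinAt)
      (fun x _ => (hd x).differentiableAt.differentiableWithinAt) fun x _ => ?_
    rw [(hd x).deriv]
    have h := mul_le_mul_of_nonneg_right (add_one_le_exp (2 * x)) (exp_pos (-(2 * x))).le
    rw [← exp_add, add_neg_cancel, exp_zero] at h
    linarith
  have := hmono (Set.self_mem_Ici) hk hk
  simp at this
  linarith

lemma min_div_le_of_pos {c α β : ℝ} (hc : 0 < c) (hα : 0 ≤ α) (hβ : 0 ≤ β) :
    min ((1 - exp (-(c * α))) / c) ((exp (c * β) - 1) / c) ≤ (α + β) / 2 := by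
  by_contra! h
  obtain ⟨h₁, h₂⟩ := lt_min_iff.1 h
  rw [lt_div_iff₀ hc] at h₁ h₂
  set k := (α + β) / 2 * c with hk
  have hexp : exp (-(c * α)) = exp (c * β) * exp (-(2 * k)) := by
    rw [← exp_add]; congr 1; rw [hk]; ring
  have := one_sub_le_one_add_mul_exp (k := k) (by positivity)
  nlinarith [exp_pos (-(2 * k))]

lemma intervalIntegral_exp_mul {c : ℝ} (hc : c ≠ 0) (a b : ℝ) :
    ∫ x in a..b, exp (c * x) = (exp (c * b) - exp (c * a)) / c := by
  rw [intervalIntegral.integral_comp_mul_left _ hc, integral_exp, smul_eq_mul]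
  field_simp

lemma min_integral_exp_le (c : ℝ) {α β : ℝ} (hα : 0 ≤ α) (hβ : 0 ≤ β) :
    min (∫ x in (-α)..0, exp (c * x)) (∫ x in (0 : ℝ)..β, exp (c * x)) ≤ (α + β) / 2 := by
  rcases lt_trichotomy c 0 with hc | rfl | hc
  · have h := min_div_le_of_pos (neg_pos.2 hc) hβ hα
    rw [intervalIntegral_exp_mul hc.ne, intervalIntegral_exp_mul hc.ne]
    have e₁ : (exp (c * 0) - exp (c * -α)) / c = (exp (-c * α) - 1) / -c := by
      rw [← neg_div_neg_eq]; simp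
    have e₂ : (exp (c * β) - exp (c * 0)) / c = (1 - exp (-(-c * β))) / -c := by
      rw [← neg_div_neg_eq]; simp
    rw [e₁, e₂, min_comm, add_comm α β]
    exact h
  · simp only [zero_mul, exp_zero, intervalIntegral.integral_const, smul_eq_mul]
    rcases le_total α β with h | h
    · exact (min_le_left _ _).trans (by linarith)
    · exact (min_le_right _ _).trans (by linarith)
  · have h := min_div_le_of_pos hc hα hβ
    rw [intervalIntegral_exp_mul hc.ne', intervalIntegral_exp_mul hc.ne']
    simpa using h

/-- A logconcave function on the line lies below an exponential touching it at a given interior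
point of its support. -/
lemma LogConcave.exists_le_mul_exp {f : ℝ → ℝ≥0∞} (hf : LogConcave f) {M : ℝ≥0∞} (hM : M ≠ ∞)
    (hfM : ∀ x, f x ≤ M) {a z b : ℝ} (haz : a < z) (hzb : z < b) (ha : f a ≠ 0) (hz : f z ≠ 0)
    (hb : f b ≠ 0) : ∃ c : ℝ, ∀ x, f x ≤ f z * ENNReal.ofReal (exp (c * (x - z))) := by
  have htop : ∀ x, f x ≠ ∞ := fun x => ((hfM x).trans_lt hM.lt_top).ne
  have hpos : ∀ {x}, f x ≠ 0 → 0 < (f x).toReal := fun h => ENNReal.toReal_pos h (htop _)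
  set g : ℝ → ℝ := fun x => log (f x).toReal with hg
  obtain ⟨c, hc₁, hc₂⟩ := exists_between_of_forall_le
    (s := (fun y => (g y - g z) / (y - z)) '' {y | z < y ∧ f y ≠ 0})
    (t := (fun x => (g z - g x) / (z - x)) '' {x | x < z ∧ f x ≠ 0})
    (Set.Nonempty.image _ ⟨b, hzb, hb⟩) (Set.Nonempty.image _ ⟨a, haz, ha⟩) (by
      rintro _ ⟨y, ⟨hzy, hy⟩, rfl⟩ _ ⟨x, ⟨hxz, hx⟩, rfl⟩
      have hxy : 0 < y - x := by linarith
      set l := (y - z) / (y - x) with hl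
      have hl₀ : 0 < l := div_pos (by linarith) hxy
      have hl₁ : l < 1 := (div_lt_one hxy).2 (by linarith)
      have hcomb : l * x + (1 - l) * y = z := by rw [hl]; field_simp; ring
      have h := hf x y l hl₀ hl₁
      rw [smul_eq_mul, smul_eq_mul, hcomb] at h
      have h' := ENNReal.toReal_mono (htop z) h
      rw [ENNReal.toReal_mul, ← ENNReal.toReal_rpow, ← ENNReal.toReal_rpow] at h'
      have h'' := log_le_log (mul_pos (rpow_pos_of_pos (hpos hx) _) (rpow_pos_of_pos (hpos hy) _)) h'
      rw [log_mul (rpow_pos_of_pos (hpos hx) _).ne' (rpow_pos_of_pos (hpos hy) _).ne',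
        log_rpow (hpos hx), log_rpow (hpos hy)] at h''
      change l * g x + (1 - l) * g y ≤ g z at h''
      have h3 : (y - z) * g x + (z - x) * g y ≤ (y - x) * g z := by
        have := mul_le_mul_of_nonneg_left h'' hxy.le
        have e : (y - x) * (l * g x + (1 - l) * g y) = (y - z) * g x + (z - x) * g y := by
          rw [hl]; field_simp; ring
        linarith
      rw [div_le_div_iff₀ (by linarith) (by linarith)]
      nlinarith)
  refine ⟨c, fun x => ?_⟩
  rcases eq_or_ne (f x) 0 with hx | hx
  · simp [hx]
  have hgx : g x ≤ g z + c * (x - z) := by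
    rcases lt_trichotomy x z with h | rfl | h
    · have := hc₂ ⟨x, ⟨h, hx⟩, rfl⟩
      rw [le_div_iff₀ (by linarith)] at this
      nlinarith
    · simp
    · have := hc₁ ⟨x, ⟨h, hx⟩, rfl⟩
      rw [div_le_iff₀ (by linarith)] at this
      linarith
  have h := exp_le_exp.2 hgx
  rw [exp_add, exp_log (hpos hx), exp_log (hpos hz)] at h
  rw [← ENNReal.ofReal_toReal (htop x), ← ENNReal.ofReal_toReal (htop z),
    ← ENNReal.ofReal_mul ENNReal.toReal_nonneg]
  exact ENNReal.ofReal_le_ofReal h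

lemma setLIntegral_exp_le {f : ℝ → ℝ≥0∞} {A : Set ℝ} (hA : MeasurableSet A) {C : ℝ≥0∞}
    (hC : C ≠ ∞) {c z p q : ℝ} (hpq : p ≤ q)
    (hf : ∀ x, f x ≤ C * ENNReal.ofReal (exp (c * (x - z))))
    (hsub : ∀ x ∈ A, f x ≠ 0 → x - z ∈ Set.Icc p q) :
    ∫⁻ x in A, f x ≤ C * ENNReal.ofReal (∫ x in p..q, exp (c * x)) := by
  have hInt : IntegrableOn (fun x => exp (c * x)) (Set.Icc p q) :=
    (by fun_prop : Continuous fun x => exp (c * x)).integrableOn_Icc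
  calc ∫⁻ x in A, f x
      ≤ ∫⁻ x, (Set.Icc p q).indicator (fun y => C * ENNReal.ofReal (exp (c * y))) (x - z) := by
        rw [← lintegral_indicator hA]
        refine lintegral_mono fun x => ?_
        by_cases hx : x ∈ A
        · by_cases h0 : f x = 0
          · simp [hx, h0]
          · simpa [hx, Set.indicator_of_mem (hsub x hx h0)] using hf x
        · simp [hx]
    _ = ∫⁻ x in Set.Icc p q, C * ENNReal.ofReal (exp (c * x)) := by
        rw [lintegral_sub_right_eq_self, lintegral_indicator measurableSet_Icc]
    _ = _ := by
        rw [lintegral_const_mul' _ _ hC, intervalIntegral.integral_of_le hpq,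
          ← integral_Icc_eq_integral_Ioc,
          ofReal_integral_eq_lintegral_ofReal hInt (Eventually.of_forall fun x => (exp_pos _).le)]

/-- The infinitesimal isoperimetric inequality for logconcave functions on the line. -/
lemma LogConcave.two_mul_min_le {f : ℝ → ℝ≥0∞} (hf : LogConcave f) {M : ℝ≥0∞} (hM : M ≠ ∞)
    (hfM : ∀ x, f x ≤ M) {D : ℝ} (hD : ∀ x y, f x ≠ 0 → f y ≠ 0 → dist x y ≤ D) (z : ℝ) :
    2 * min (∫⁻ x in Set.Iic z, f x) (∫⁻ x in Set.Ici z, f x) ≤ ENNReal.ofReal D * f z := by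
  by_cases hl : ∀ x < z, f x = 0
  · have : ∫⁻ x in Set.Iic z, f x = 0 := by
      rw [setLIntegral_congr Iio_ae_eq_Iic.symm, setLIntegral_congr_fun measurableSet_Iio hl]
      simp
    simp [this]
  by_cases hr : ∀ x > z, f x = 0
  · have : ∫⁻ x in Set.Ici z, f x = 0 := by
      rw [setLIntegral_congr Ioi_ae_eq_Ici.symm, setLIntegral_congr_fun measurableSet_Ioi hr]
      simp
    simp [this]
  push Not at hl hr
  obtain ⟨a, haz, ha⟩ := hl
  obtain ⟨b, hzb, hb⟩ := hr
  have hz : f z ≠ 0 := by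
    have := (hf.convex_lt 0).ordConnected.out (pos_iff_ne_zero.2 ha) (pos_iff_ne_zero.2 hb)
      ⟨le_of_lt haz, le_of_lt hzb⟩
    exact ne_of_gt this
  have hzt : f z ≠ ∞ := ((hfM z).trans_lt hM.lt_top).ne
  obtain ⟨c, hc⟩ := hf.exists_le_mul_exp hM hfM haz hzb ha hz hb
  obtain ⟨β, hβ₁, hβ₂⟩ := exists_between_of_forall_le
    (s := (fun y => y - z) '' {y | f y ≠ 0}) (t := (fun x => D - (z - x)) '' {x | f x ≠ 0})
    (Set.Nonempty.image _ ⟨b, hb⟩) (Set.Nonempty.image _ ⟨a, ha⟩) (by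
      rintro _ ⟨y, hy, rfl⟩ _ ⟨x, hx, rfl⟩
      have := (le_abs_self _).trans (hD y x hy hx)
      linarith)
  have hβ : ∀ x, f x ≠ 0 → x - z ≤ β := fun x hx => hβ₁ ⟨x, hx, rfl⟩
  have hα : ∀ x, f x ≠ 0 → -(D - β) ≤ x - z := fun x hx => by
    have : β ≤ D - (z - x) := hβ₂ ⟨x, hx, rfl⟩
    linarith
  have hβ0 : 0 ≤ β := by simpa using hβ z hz
  have hα0 : 0 ≤ D - β := by simpa using hα z hz
  have hL := setLIntegral_exp_le (A := Set.Iic z) measurableSet_Iic hzt (p := -(D - β)) (q := 0)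
    (by linarith) hc fun x hx h0 => ⟨hα x h0, by simpa using hx⟩
  have hR := setLIntegral_exp_le (A := Set.Ici z) measurableSet_Ici hzt (p := 0) (q := β)
    hβ0 hc fun x hx h0 => ⟨by simpa using hx, hβ x h0⟩
  have hmin := min_integral_exp_le c hα0 hβ0
  rw [sub_add_cancel] at hmin
  calc 2 * min (∫⁻ x in Set.Iic z, f x) (∫⁻ x in Set.Ici z, f x)
      ≤ 2 * (f z * ENNReal.ofReal (D / 2)) := by
        gcongr
        rcases min_le_iff.1 hmin with h | h
        · exact (min_le_left _ _).trans (hL.trans (by gcongr))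
        · exact (min_le_right _ _).trans (hR.trans (by gcongr))
    _ = ENNReal.ofReal D * f z := by
        rw [mul_left_comm, mul_comm (f z)]
        congr 1
        rw [← ENNReal.ofReal_ofNat 2, ← ENNReal.ofReal_mul (by norm_num)]
        congr 1; ring

/-- Between two points of `d`-separated sets on the line there is a gap of length `d`. -/
lemma le_volume_compl_inter_Icc {S T : Set ℝ} {d : ℝ}
    (hsep : ∀ x ∈ S, ∀ y ∈ T, d ≤ dist x y) {x y : ℝ} (hx : x ∈ S) (hy : y ∈ T) (hxy : x ≤ y) :
    ENNReal.ofReal d ≤ volume ((S ∪ T)ᶜ ∩ Set.Icc x y) := by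
  have hbS : BddAbove (S ∩ Set.Icc x y) := ⟨y, fun p hp => hp.2.2⟩
  have hneS : (S ∩ Set.Icc x y).Nonempty := ⟨x, hx, le_rfl, hxy⟩
  set s := sSup (S ∩ Set.Icc x y)
  have hxs : x ≤ s := le_csSup hbS ⟨hx, le_rfl, hxy⟩
  have hsy : s ≤ y := csSup_le hneS fun p hp => hp.2.2
  have hbT : BddBelow (T ∩ Set.Icc s y) := ⟨s, fun p hp => hp.2.1⟩
  have hneT : (T ∩ Set.Icc s y).Nonempty := ⟨y, hy, hsy, le_rfl⟩
  set t := sInf (T ∩ Set.Icc s y)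
  have hst : s ≤ t := le_csInf hneT fun p hp => hp.2.1
  have hty : t ≤ y := csInf_le hbT ⟨hy, hsy, le_rfl⟩
  have hd : d ≤ t - s := by
    by_contra! h
    obtain ⟨p, hp, hps⟩ := exists_lt_of_lt_csSup hneS (show s - (d - (t - s)) / 2 < s by linarith)
    obtain ⟨q, hq, hqt⟩ := exists_lt_of_csInf_lt hneT (show t < t + (d - (t - s)) / 2 by linarith)
    have hp' : p ≤ s := le_csSup hbS hp
    have := hsep p hp.1 q hq.1
    rw [dist_comm, dist_eq, abs_of_nonneg (by linarith [hq.2.1])] at this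
    linarith
  calc ENNReal.ofReal d ≤ ENNReal.ofReal (t - s) := ENNReal.ofReal_le_ofReal hd
    _ = volume (Set.Ioo s t) := by simp
    _ ≤ _ := by
        refine measure_mono fun p hp => ⟨?_, by linarith [hp.1], by linarith [hp.2]⟩
        rintro (hpS | hpT)
        · exact hp.1.not_ge (le_csSup hbS ⟨hpS, by linarith [hp.1], by linarith [hp.2]⟩)
        · exact hp.2.not_ge (csInf_le hbT ⟨hpT, hp.1.le, by linarith [hp.2]⟩)

lemma le_volume_compl_inter_uIcc {S T : Set ℝ} {d : ℝ}
    (hsep : ∀ x ∈ S, ∀ y ∈ T, d ≤ dist x y) {x y : ℝ} (hx : x ∈ S) (hy : y ∈ T) :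
    ENNReal.ofReal d ≤ volume ((S ∪ T)ᶜ ∩ Set.uIcc x y) := by
  rcases le_total x y with h | h
  · rw [Set.uIcc_of_le h]
    exact le_volume_compl_inter_Icc hsep hx hy h
  · rw [Set.uIcc_of_ge h, Set.union_comm]
    exact le_volume_compl_inter_Icc (fun a ha b hb => dist_comm b a ▸ hsep b hb a ha) hy hx h

lemma LogConcave.exists_median {f : ℝ → ℝ≥0∞} (hf : LogConcave f) {M : ℝ≥0∞} (hM : M ≠ ∞)
    (hfM : ∀ x, f x ≤ M) {D : ℝ} (hD : ∀ x y, f x ≠ 0 → f y ≠ 0 → dist x y ≤ D) :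
    ∃ m, (∀ z > m, 2 * ∫⁻ x in Set.Ici z, f x ≤ ENNReal.ofReal D * f z) ∧
      ∀ z < m, 2 * ∫⁻ x in Set.Iic z, f x ≤ ENNReal.ofReal D * f z := by
  rcases eq_or_ne (∫⁻ x, f x) 0 with h0 | h0
  · have : ∀ A : Set ℝ, ∫⁻ x in A, f x = 0 := fun A =>
      le_antisymm ((setLIntegral_le_lintegral _ _).trans h0.le) bot_le
    exact ⟨0, by simp [this]⟩
  obtain ⟨x₀, hx₀⟩ : ∃ x, f x ≠ 0 := by
    by_contra! h
    exact h0 (by simp [h])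
  have hzero : ∀ A : Set ℝ, MeasurableSet A → (∀ x ∈ A, D < dist x x₀) → ∫⁻ x in A, f x = 0 := by
    intro A hA h
    rw [setLIntegral_congr_fun hA fun x hx => ?_, lintegral_zero]
    by_contra hx0
    exact (h x hx).not_ge (hD x x₀ hx0 hx₀)
  set Z := {z | ∫⁻ x in Set.Iic z, f x ≤ ∫⁻ x in Set.Ici z, f x}
  have hne : Z.Nonempty := by
    refine ⟨x₀ - D - 1, ?_⟩
    change ∫⁻ x in Set.Iic _, f x ≤ _
    rw [hzero _ measurableSet_Iic fun x hx => ?_]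
    · exact bot_le
    · rw [dist_comm]
      refine lt_of_lt_of_le ?_ (le_abs_self _)
      linarith [Set.mem_Iic.1 hx]
  have hbd : BddAbove Z := by
    refine ⟨x₀ + D, fun z hz => ?_⟩
    by_contra! hlt
    have hR : ∫⁻ x in Set.Ici z, f x = 0 := hzero _ measurableSet_Ici fun x hx =>
      lt_of_lt_of_le (by linarith [Set.mem_Ici.1 hx]) (le_abs_self _)
    have hL : ∫⁻ x in Set.Iic z, f x = 0 := le_antisymm (hR ▸ hz) bot_le
    refine h0 (le_antisymm ?_ bot_le)
    calc ∫⁻ x, f x = ∫⁻ x in Set.Iic z ∪ Set.Ici z, f x := by simp [Set.Iic_union_Ici]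
      _ ≤ _ := lintegral_union_le _ _ _
      _ = 0 := by rw [hL, hR, add_zero]
  refine ⟨sSup Z, fun z hz => ?_, fun z hz => ?_⟩
  · have hzZ : z ∉ Z := fun h => hz.not_ge (le_csSup hbd h)
    have hlt : ∫⁻ x in Set.Ici z, f x < ∫⁻ x in Set.Iic z, f x := not_le.1 hzZ
    simpa [min_eq_right hlt.le] using hf.two_mul_min_le hM hfM hD z
  · obtain ⟨z', hz', hzz'⟩ := exists_lt_of_lt_csSup hne hz
    have hle : ∫⁻ x in Set.Iic z, f x ≤ ∫⁻ x in Set.Ici z, f x :=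
      (lintegral_mono_set (Set.Iic_subset_Iic.2 hzz'.le)).trans
        (le_trans hz' (lintegral_mono_set (Set.Ici_subset_Ici.2 hzz'.le)))
    simpa [min_eq_left hle] using hf.two_mul_min_le hM hfM hD z

end Line

/-- The isoperimetric inequality for bounded logconcave functions of bounded support on `E`. -/
def Isoperimetric (E : Type*) [NormedAddCommGroup E] [NormedSpace ℝ E] [MeasureSpace E] : Prop :=
  ∀ (f : E → ℝ≥0∞) (M : ℝ≥0∞), M ≠ ∞ → LogConcave f → (∀ x, f x ≤ M) → AEMeasurable f →
    ∀ D d : ℝ, 0 < d → (∀ x y, f x ≠ 0 → f y ≠ 0 → dist x y ≤ D) →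
      ∀ S T : Set E, MeasurableSet S → MeasurableSet T →
        (∀ x ∈ S, ∀ y ∈ T, f x ≠ 0 → f y ≠ 0 → d ≤ dist x y) →
          2 * ENNReal.ofReal d * min (∫⁻ x in S, f x) (∫⁻ x in T, f x) ≤
            ENNReal.ofReal D * ∫⁻ x in (S ∪ T)ᶜ, f x

lemma lintegral_volume_uIcc_mul_le {f : ℝ → ℝ≥0∞} (hf : Measurable f) {R : Set ℝ}
    (hR : MeasurableSet R) {m : ℝ} {g : ℝ → ℝ≥0∞}
    (hr : ∀ z > m, ∫⁻ x in Set.Ici z, f x ≤ g z) (hl : ∀ z < m, ∫⁻ x in Set.Iic z, f x ≤ g z) :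
    ∫⁻ x, volume (R ∩ Set.uIcc m x) * f x ≤ ∫⁻ z in R, g z := by
  have hmeas : Measurable (Function.uncurry fun x z : ℝ =>
      (R ∩ Set.uIcc m x).indicator (fun _ => f x) z) := by
    have hset : MeasurableSet {p : ℝ × ℝ | p.2 ∈ R ∧ min m p.1 ≤ p.2 ∧ p.2 ≤ max m p.1} :=
      (measurable_snd hR).inter ((measurableSet_le (by fun_prop) measurable_snd).inter
        (measurableSet_le measurable_snd (by fun_prop)))
    convert (hf.comp measurable_fst).indicator hset using 1
    ext p
    simp only [Function.uncurry, Set.indicator, Set.uIcc]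
    rfl
  calc ∫⁻ x, volume (R ∩ Set.uIcc m x) * f x
      = ∫⁻ x, ∫⁻ z, (R ∩ Set.uIcc m x).indicator (fun _ => f x) z := by
        refine lintegral_congr fun x => ?_
        rw [lintegral_indicator (hR.inter measurableSet_uIcc), setLIntegral_const, mul_comm]
    _ = ∫⁻ z, ∫⁻ x, (R ∩ Set.uIcc m x).indicator (fun _ => f x) z :=
        lintegral_lintegral_swap hmeas.aemeasurable
    _ ≤ ∫⁻ z, R.indicator g z := by
        refine lintegral_mono_ae ?_
        filter_upwards [Measure.ae_ne volume m] with z hz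
        by_cases hzR : z ∈ R
        · rw [Set.indicator_of_mem hzR]
          rcases lt_or_gt_of_ne hz with h | h
          · refine le_trans ?_ (hl z h)
            rw [← lintegral_indicator measurableSet_Iic]
            refine lintegral_mono fun x => ?_
            by_cases hx : z ∈ Set.uIcc m x
            · have hxz : x ≤ z := by
                rcases Set.mem_uIcc.1 hx with h' | h' <;> linarith
              simp [Set.indicator, hx, hzR, hxz]
            · simp [Set.indicator, hx]
          · refine le_trans ?_ (hr z h)
            rw [← lintegral_indicator measurableSet_Ici]
            refine lintegral_mono fun x => ?_
            by_cases hx : z ∈ Set.uIcc m x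
            · have hxz : z ≤ x := by
                rcases Set.mem_uIcc.1 hx with h' | h' <;> linarith
              simp [Set.indicator, hx, hzR, hxz]
            · simp [Set.indicator, hx]
        · simp [Set.indicator, hzR]
    _ = ∫⁻ z in R, g z := lintegral_indicator hR _

lemma le_biInf_add_biInf {α β : Type*} {S : Set α} {T : Set β} {u : α → ℝ≥0∞} {v : β → ℝ≥0∞}
    {c : ℝ≥0∞} (h : ∀ x ∈ S, ∀ y ∈ T, c ≤ u x + v y) : c ≤ (⨅ x ∈ S, u x) + ⨅ y ∈ T, v y := by
  simp only [ENNReal.iInf_add, ENNReal.add_iInf]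
  exact le_iInf₂ fun y hy => le_iInf₂ fun x hx => h x hx y hy

/-- The isoperimetric inequality on the line, for sets separated everywhere. -/
lemma LogConcave.isoperimetric_of_separated {f : ℝ → ℝ≥0∞} (hf : LogConcave f) {M : ℝ≥0∞}
    (hM : M ≠ ∞) (hfM : ∀ x, f x ≤ M) {D d : ℝ} (hd : 0 < d)
    (hD : ∀ x y, f x ≠ 0 → f y ≠ 0 → dist x y ≤ D) {S T : Set ℝ} (hS : MeasurableSet S)
    (hT : MeasurableSet T) (hsep : ∀ x ∈ S, ∀ y ∈ T, d ≤ dist x y) :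
    2 * ENNReal.ofReal d * min (∫⁻ x in S, f x) (∫⁻ x in T, f x) ≤
      ENNReal.ofReal D * ∫⁻ x in (S ∪ T)ᶜ, f x := by
  obtain ⟨m, hr, hl⟩ := hf.exists_median hM hfM hD
  have hR : MeasurableSet (S ∪ T)ᶜ := (hS.union hT).compl
  set R := (S ∪ T)ᶜ
  set N : ℝ → ℝ≥0∞ := fun x => volume (R ∩ Set.uIcc m x) with hN
  have hdisj : Disjoint S T := Set.disjoint_left.2 fun x hx hx' => by
    have := hsep x hx x hx'
    simp at this
    linarith
  have hNd : ENNReal.ofReal d ≤ (⨅ x ∈ S, N x) + ⨅ y ∈ T, N y := by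
    refine le_biInf_add_biInf fun x hx y hy => ?_
    refine (le_volume_compl_inter_uIcc hsep hx hy).trans ((measure_mono ?_).trans
      (measure_union_le _ _))
    rw [← Set.inter_union_distrib_left]
    refine Set.inter_subset_inter_right _ ?_
    rw [Set.uIcc_comm m x]
    exact Set.uIcc_subset_uIcc_union_uIcc
  have hbound : ∀ A : Set ℝ, MeasurableSet A →
      (⨅ x ∈ A, N x) * ∫⁻ x in A, f x ≤ ∫⁻ x in A, N x * f x := by
    intro A hA
    rw [← lintegral_const_mul _ hf.measurable]
    refine setLIntegral_mono' hA fun x hx => ?_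
    gcongr
    exact iInf₂_le x hx
  calc 2 * ENNReal.ofReal d * min (∫⁻ x in S, f x) (∫⁻ x in T, f x)
      ≤ 2 * ((⨅ x ∈ S, N x) + ⨅ y ∈ T, N y) * min (∫⁻ x in S, f x) (∫⁻ x in T, f x) := by gcongr
    _ = 2 * ((⨅ x ∈ S, N x) * min (∫⁻ x in S, f x) (∫⁻ x in T, f x) +
          (⨅ y ∈ T, N y) * min (∫⁻ x in S, f x) (∫⁻ x in T, f x)) := by ring
    _ ≤ 2 * ((⨅ x ∈ S, N x) * (∫⁻ x in S, f x) + (⨅ y ∈ T, N y) * ∫⁻ x in T, f x) := by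
        gcongr
        · exact min_le_left _ _
        · exact min_le_right _ _
    _ ≤ 2 * ((∫⁻ x in S, N x * f x) + ∫⁻ x in T, N x * f x) := by
        gcongr
        · exact hbound S hS
        · exact hbound T hT
    _ = 2 * ∫⁻ x in S ∪ T, N x * f x := by rw [lintegral_union hT hdisj]
    _ ≤ 2 * ∫⁻ x, N x * f x := by gcongr; exact Measure.restrict_le_self
    _ ≤ 2 * ∫⁻ z in R, 2⁻¹ * (ENNReal.ofReal D * f z) := by
        refine mul_le_mul' le_rfl ?_
        have hhalf : ∀ {a b : ℝ≥0∞}, 2 * a ≤ b → a ≤ 2⁻¹ * b := fun h => by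
          rw [mul_comm, ← div_eq_mul_inv, ENNReal.le_div_iff_mul_le (by simp) (by simp), mul_comm]
          exact h
        exact lintegral_volume_uIcc_mul_le hf.measurable hR (fun z hz => hhalf (hr z hz))
          fun z hz => hhalf (hl z hz)
    _ = ENNReal.ofReal D * ∫⁻ x in R, f x := by
        rw [lintegral_const_mul' _ _ (by simp), lintegral_const_mul' _ _ ENNReal.ofReal_ne_top,
          ← mul_assoc, ENNReal.mul_inv_cancel (by simp) (by simp), one_mul]

lemma setLIntegral_inter_support {α : Type*} [MeasurableSpace α] {μ : Measure α} {f : α → ℝ≥0∞}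
    {A B : Set α} (hA : MeasurableSet A) (hB : MeasurableSet B)
    (hAB : ∀ x, f x ≠ 0 → (x ∈ A ↔ x ∈ B)) : ∫⁻ x in A, f x ∂μ = ∫⁻ x in B, f x ∂μ := by
  rw [← lintegral_indicator hA, ← lintegral_indicator hB]
  congr with x
  by_cases hx : f x = 0
  · simp [Set.indicator, hx]
  · by_cases hxB : x ∈ B <;> simp [Set.indicator, hxB, hAB x hx]

lemma isoperimetric_real : Isoperimetric ℝ := by
  intro f M hM hf hfM _ D d hd hD S T hS hT hsep
  have hsupp : MeasurableSet {x | f x ≠ 0} := hf.measurable (measurableSet_singleton 0).compl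
  have hS' := hS.inter hsupp
  have hT' := hT.inter hsupp
  have h := hf.isoperimetric_of_separated hM hfM hd hD hS' hT'
    fun x hx y hy => hsep x hx.1 y hy.1 hx.2 hy.2
  rwa [setLIntegral_inter_support hS' hS, setLIntegral_inter_support hT' hT,
    setLIntegral_inter_support (hS'.union hT').compl (hS.union hT).compl] at h
  all_goals
    intro x hx
    simp [hx]

section Bisection

variable {E : Type*} [NormedAddCommGroup E] [InnerProductSpace ℝ E]

/-- The closed half-space through `p` with inner normal `u`. -/
def halfSpace (p u : E) : Set E := {x | 0 ≤ inner ℝ u (x - p)}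

lemma isClosed_halfSpace (p u : E) : IsClosed (halfSpace p u) :=
  isClosed_le continuous_const (by fun_prop)

lemma convex_halfSpace (p u : E) : Convex ℝ (halfSpace p u) := by
  intro x hx y hy a b ha hb hab
  change 0 ≤ inner ℝ u (a • x + b • y - p)
  have : a • x + b • y - p = a • (x - p) + b • (y - p) := by
    rw [smul_sub, smul_sub, sub_add_sub_comm, ← add_smul, hab, one_smul]
  rw [this, inner_add_right, inner_smul_right, inner_smul_right]
  exact add_nonneg (mul_nonneg ha hx) (mul_nonneg hb hy)

lemma halfSpace_union_neg (p u : E) : halfSpace p u ∪ halfSpace p (-u) = Set.univ := by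
  refine Set.eq_univ_of_forall fun x => ?_
  rcases le_total 0 (inner ℝ u (x - p)) with h | h
  · exact Or.inl h
  · refine Or.inr ?_
    change 0 ≤ inner ℝ (-u) (x - p)
    rw [inner_neg_left]
    linarith

lemma interior_inter_halfSpace {p u : E} (hu : u ≠ 0) {L : Set E} (hL : L ⊆ halfSpace p u) :
    p ∉ interior L := by
  intro hp
  have hlim : Tendsto (fun t : ℝ => p - t • u) (𝓝[>] 0) (𝓝 p) := by
    have : Continuous fun t : ℝ => p - t • u := by fun_prop
    have h := (this.tendsto 0).mono_left (nhdsWithin_le_nhds (s := Set.Ioi 0))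
    simpa using h
  obtain ⟨t, ht, ht0⟩ :=
    ((hlim.eventually (mem_interior_iff_mem_nhds.1 hp)).and self_mem_nhdsWithin).exists
  have h : 0 ≤ inner ℝ u (p - t • u - p) := hL ht
  rw [sub_sub_cancel_left, inner_neg_right, inner_smul_right, real_inner_self_eq_norm_sq] at h
  have : 0 < t * ‖u‖ ^ 2 := mul_pos ht0 (by positivity)
  linarith

lemma exists_hyperplane_of_interior_eq_empty [FiniteDimensional ℝ E] [Nontrivial E] {L : Set E}
    (hL : Convex ℝ L) (hInt : interior L = ∅) : ∃ (u : E) (c : ℝ), ‖u‖ = 1 ∧ ∀ x ∈ L, inner ℝ u x = c := by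
  rcases L.eq_empty_or_nonempty with rfl | ⟨p, hp⟩
  · obtain ⟨u, hu⟩ := exists_norm_eq E zero_le_one
    exact ⟨u, 0, hu, by simp⟩
  have hspan : vectorSpan ℝ L ≠ ⊤ := by
    rw [Ne, ← AffineSubspace.affineSpan_eq_top_iff_vectorSpan_eq_top_of_nonempty ℝ E E ⟨p, hp⟩,
      ← hL.interior_nonempty_iff_affineSpan_eq_top, hInt]
    exact Set.not_nonempty_empty
  obtain ⟨v, hv, hv0⟩ := Submodule.exists_mem_ne_zero_of_ne_bot
    (fun h => hspan ((Submodule.orthogonal_eq_bot_iff).1 h))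
  refine ⟨‖v‖⁻¹ • v, inner ℝ (‖v‖⁻¹ • v) p, norm_smul_inv_norm hv0, fun x hx => ?_⟩
  have h := (Submodule.mem_orthogonal' _ _).1 hv _ (vsub_mem_vectorSpan ℝ hx hp)
  rw [vsub_eq_sub, inner_sub_right, sub_eq_zero] at h
  simp only [inner_smul_left, h]

variable [FiniteDimensional ℝ E] [MeasurableSpace E] [BorelSpace E]

lemma volume_hyperplane {p u : E} (hu : u ≠ 0) :
    volume {x : E | inner ℝ u (x - p) = 0} = 0 := by
  have h : {x : E | inner ℝ u (x - p) = 0} = AffineSubspace.mk' p (ℝ ∙ u)ᗮ := by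
    ext x
    change _ ↔ x ∈ AffineSubspace.mk' p (ℝ ∙ u)ᗮ
    rw [AffineSubspace.mem_mk', vsub_eq_sub, Submodule.mem_orthogonal_singleton_iff_inner_right]
    rfl
  rw [h]
  refine Measure.addHaar_affineSubspace _ _ fun htop => ?_
  have hmem : u + p ∈ AffineSubspace.mk' p (ℝ ∙ u)ᗮ := by rw [htop]; trivial
  rw [AffineSubspace.mem_mk', vsub_eq_sub, Submodule.mem_orthogonal_singleton_iff_inner_right,
    add_sub_cancel_right, inner_self_eq_zero] at hmem
  exact hu hmem

lemma continuousAt_measureReal_halfSpace {μ : Measure E} [IsFiniteMeasure μ] (hμ : μ ≪ volume)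
    (p : E) {u : E} (hu : u ≠ 0) : ContinuousAt (fun v => μ.real (halfSpace p v)) u := by
  have h : Tendsto (fun v => μ (halfSpace p v)) (𝓝 u) (𝓝 (μ (halfSpace p u))) := by
    refine tendsto_measure_of_ae_tendsto_indicator_of_isFiniteMeasure (𝓝 u)
      (isClosed_halfSpace p u).measurableSet (fun v => (isClosed_halfSpace p v).measurableSet) ?_
    have hnull : ∀ᵐ x ∂μ, inner ℝ u (x - p) ≠ 0 := by
      rw [ae_iff]
      simpa using hμ (volume_hyperplane (p := p) hu)
    filter_upwards [hnull] with x hx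
    have hc : Continuous fun v : E => inner ℝ v (x - p) := by fun_prop
    rcases lt_or_gt_of_ne hx with h | h
    · filter_upwards [hc.continuousAt.eventually_lt_const h] with v hv
      exact iff_of_false hv.not_ge h.not_ge
    · filter_upwards [hc.continuousAt.eventually_const_lt h] with v hv
      exact iff_of_true hv.le h.le
  exact (ENNReal.tendsto_toReal (measure_ne_top _ _)).comp h

lemma measureReal_halfSpace_add_neg {μ : Measure E} [IsFiniteMeasure μ] (hμ : μ ≪ volume)
    (p : E) {u : E} (hu : u ≠ 0) :
    μ.real (halfSpace p u) + μ.real (halfSpace p (-u)) = μ.real Set.univ := by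
  have hnull : μ (halfSpace p u ∩ halfSpace p (-u)) = 0 := by
    refine measure_mono_null (fun x hx => ?_) (hμ (volume_hyperplane (p := p) hu))
    have h₁ : 0 ≤ inner ℝ u (x - p) := hx.1
    have h₂ : 0 ≤ inner ℝ (-u) (x - p) := hx.2
    rw [inner_neg_left] at h₂
    exact le_antisymm (by linarith) h₁
  have h := measureReal_union_add_inter (μ := μ) (s := halfSpace p u)
    (isClosed_halfSpace p (-u)).measurableSet
  rw [halfSpace_union_neg, measureReal_def μ (_ ∩ _), hnull] at h
  simpa using h.symm

lemma exists_halfSpace_eq_half (hE : 1 < Module.finrank ℝ E) {μ ν : Measure E}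
    [IsFiniteMeasure μ] [IsFiniteMeasure ν] (hμ : μ ≪ volume) (hν : ν ≪ volume) (a b : ℝ) (p : E) :
    ∃ u : E, ‖u‖ = 1 ∧ a * μ.real (halfSpace p u) - b * ν.real (halfSpace p u) =
      (a * μ.real Set.univ - b * ν.real Set.univ) / 2 := by
  have : Nontrivial E := Module.nontrivial_of_finrank_pos (R := ℝ) (by omega)
  set φ : E → ℝ := fun u => a * μ.real (halfSpace p u) - b * ν.real (halfSpace p u) with hφ
  have hcont : ContinuousOn φ (Metric.sphere 0 1) := fun u hu => by
    have hu0 : u ≠ 0 := ne_zero_of_mem_unit_sphere ⟨u, hu⟩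
    exact (((continuousAt_measureReal_halfSpace hμ p hu0).const_mul a).sub
      ((continuousAt_measureReal_halfSpace hν p hu0).const_mul b)).continuousWithinAt
  have hneg : ∀ u ≠ 0, φ u + φ (-u) = a * μ.real Set.univ - b * ν.real Set.univ := fun u hu => by
    rw [← measureReal_halfSpace_add_neg hμ p hu, ← measureReal_halfSpace_add_neg hν p hu]
    ring
  have hconn : IsPreconnected (Metric.sphere (0 : E) 1) :=
    isPreconnected_sphere (by rw [← Module.finrank_eq_rank]; exact_mod_cast hE) 0 1
  obtain ⟨v, hv⟩ : ∃ v : E, ‖v‖ = 1 := exists_norm_eq E zero_le_one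
  have hv0 : v ≠ 0 := fun h => by simp [h] at hv
  have hvs : v ∈ Metric.sphere (0 : E) 1 := by simpa using hv
  have hvs' : -v ∈ Metric.sphere (0 : E) 1 := by simpa using hv
  obtain ⟨u, hu, h⟩ : (a * μ.real Set.univ - b * ν.real Set.univ) / 2 ∈
      φ '' Metric.sphere 0 1 := by
    rw [← hneg v hv0]
    rcases le_total (φ v) (φ (-v)) with h | h
    · exact hconn.intermediate_value hvs hvs' hcont ⟨by linarith, by linarith⟩
    · exact hconn.intermediate_value hvs' hvs hcont ⟨by linarith, by linarith⟩
  exact ⟨u, by simpa using hu, h⟩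

/-- A strict pair of linear inequalities between three measures survives on one of the two halves
of a suitable bisection through any prescribed point. -/
lemma exists_halfSpace_lt (hE : 1 < Module.finrank ℝ E) {μ₁ μ₂ μ₃ : Measure E}
    [IsFiniteMeasure μ₁] [IsFiniteMeasure μ₂] [IsFiniteMeasure μ₃] (h₁ : μ₁ ≪ volume)
    (h₂ : μ₂ ≪ volume) (h₃ : μ₃ ≪ volume) {a b : ℝ} (p : E)
    (h₃₁ : b * μ₃.real Set.univ < a * μ₁.real Set.univ)
    (h₃₂ : b * μ₃.real Set.univ < a * μ₂.real Set.univ) :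
    ∃ u : E, ‖u‖ = 1 ∧ b * μ₃.real (halfSpace p u) < a * μ₁.real (halfSpace p u) ∧
      b * μ₃.real (halfSpace p u) < a * μ₂.real (halfSpace p u) := by
  obtain ⟨u, hu, hφ⟩ := exists_halfSpace_eq_half hE h₁ h₃ a b p
  have hu0 : u ≠ 0 := fun h => by simp [h] at hu
  have e₁ := measureReal_halfSpace_add_neg h₁ p hu0
  have e₂ := measureReal_halfSpace_add_neg h₂ p hu0
  have e₃ := measureReal_halfSpace_add_neg h₃ p hu0
  rw [← e₁, ← e₃] at h₃₁ hφ
  rw [← e₂, ← e₃] at h₃₂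
  by_cases h : b * μ₃.real (halfSpace p u) < a * μ₂.real (halfSpace p u)
  · exact ⟨u, hu, by linarith, h⟩
  · exact ⟨-u, by simpa using hu, by linarith, by linarith⟩

/-- Bisection lemma: a strict pair of linear inequalities between three measures localizes to
convex sets contained in arbitrarily thin slabs. -/
lemma exists_convex_subset_slab (hE : 1 < Module.finrank ℝ E) {μ₁ μ₂ μ₃ : Measure E}
    [IsFiniteMeasure μ₁] [IsFiniteMeasure μ₂] [IsFiniteMeasure μ₃] (h₁ : μ₁ ≪ volume)
    (h₂ : μ₂ ≪ volume) (h₃ : μ₃ ≪ volume) {a b : ℝ} {K₀ : Set E} (hK₀ : IsCompact K₀)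
    (hK₀c : Convex ℝ K₀) (h₃₁ : b * μ₃.real K₀ < a * μ₁.real K₀)
    (h₃₂ : b * μ₃.real K₀ < a * μ₂.real K₀) {δ : ℝ} (hδ : 0 < δ) :
    ∃ (K : Set E) (u : E) (c : ℝ), IsCompact K ∧ Convex ℝ K ∧ ‖u‖ = 1 ∧
      (∀ x ∈ K, |inner ℝ u x - c| < δ) ∧ b * μ₃.real K < a * μ₁.real K ∧
      b * μ₃.real K < a * μ₂.real K := by
  have : Nontrivial E := Module.nontrivial_of_finrank_pos (R := ℝ) (by omega)
  let P : Set E → Prop := fun K => IsCompact K ∧ Convex ℝ K ∧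
    b * μ₃.real K < a * μ₁.real K ∧ b * μ₃.real K < a * μ₂.real K
  have hstep : ∀ (K : {K // P K}) (p : E), ∃ K' : {K // P K}, K'.1 ⊆ K.1 ∧
      ∃ u : E, u ≠ 0 ∧ K'.1 ⊆ halfSpace p u := by
    rintro ⟨K, hK, hKc, hK₁, hK₂⟩ p
    have hac : ∀ μ : Measure E, μ ≪ volume → μ.restrict K ≪ volume := fun μ hμ =>
      Measure.restrict_le_self.absolutelyContinuous.trans hμ
    have hr : ∀ (μ : Measure E) (u : E),
        (μ.restrict K).real (halfSpace p u) = μ.real (K ∩ halfSpace p u) := fun μ u => by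
      rw [measureReal_restrict_apply (isClosed_halfSpace p u).measurableSet, Set.inter_comm]
    obtain ⟨u, hu, hu₁, hu₂⟩ := exists_halfSpace_lt hE (hac _ h₁) (hac _ h₂) (hac _ h₃)
      (a := a) (b := b) p (by simpa using hK₁) (by simpa using hK₂)
    rw [hr, hr] at hu₁ hu₂
    exact ⟨⟨K ∩ halfSpace p u, hK.inter_right (isClosed_halfSpace p u),
      hKc.inter (convex_halfSpace p u), hu₁, hu₂⟩, Set.inter_subset_left, u,
      fun h => by simp [h] at hu, Set.inter_subset_right⟩
  choose next hnext_sub hnext using hstep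
  let K : ℕ → {K // P K} := fun n => Nat.rec ⟨K₀, hK₀, hK₀c, h₃₁, h₃₂⟩
    (fun n K => next K (TopologicalSpace.denseSeq E n)) n
  have hanti : Antitone fun n => (K n).1 := antitone_nat_of_succ_le fun n => hnext_sub _ _
  have hInt : interior (⋂ n, (K n).1) = ∅ := by
    rw [← Set.not_nonempty_iff_eq_empty]
    intro hne
    obtain ⟨_, hx, n, rfl⟩ :=
      (TopologicalSpace.denseRange_denseSeq E).inter_open_nonempty _ isOpen_interior hne
    obtain ⟨u, hu, hsub⟩ := hnext (K n) (TopologicalSpace.denseSeq E n)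
    exact interior_inter_halfSpace hu ((Set.iInter_subset _ (n + 1)).trans hsub) hx
  obtain ⟨u, c, hu, hc⟩ := exists_hyperplane_of_interior_eq_empty
    (convex_iInter fun n => (K n).2.2.1) hInt
  have hopen : IsOpen {x : E | |inner ℝ u x - c| < δ} :=
    isOpen_lt (by fun_prop) continuous_const
  obtain ⟨n, hn⟩ := exists_subset_nhds_of_isCompact (V := fun n => (K n).1)
    hanti.directed_ge (fun n => (K n).2.1)
    (U := {x : E | |inner ℝ u x - c| < δ})
    (fun x hx => hopen.mem_nhds (by change |_| < δ; simp [hc x hx, hδ]))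
  obtain ⟨hK, hKc, hK₁, hK₂⟩ := (K n).2
  exact ⟨(K n).1, u, c, hK, hKc, hu, fun x hx => hn hx, hK₁, hK₂⟩

end Bisection

lemma le_dist_of_mem_closure {X : Type*} [PseudoMetricSpace X] {A B : Set X} {d : ℝ}
    (h : ∀ x ∈ A, ∀ y ∈ B, d ≤ dist x y) :
    ∀ x ∈ closure A, ∀ y ∈ closure B, d ≤ dist x y := by
  intro x hx y hy
  have hcl : IsClosed {p : X × X | d ≤ dist p.1 p.2} := isClosed_le continuous_const continuous_dist
  have hsub : A ×ˢ B ⊆ {p : X × X | d ≤ dist p.1 p.2} := fun p hp => h p.1 hp.1 p.2 hp.2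
  have hmem : (x, y) ∈ closure (A ×ˢ B) := by
    rw [closure_prod_eq]
    exact ⟨hx, hy⟩
  exact closure_minimal hsub hcl hmem

section Induction

variable {E : Type*} [NormedAddCommGroup E] [InnerProductSpace ℝ E]

/-- Coordinates on `E` along the line spanned by `u` and its orthogonal complement. -/
def lineCoords (u : E) : ℝ × (ℝ ∙ u)ᗮ →ₗ[ℝ] E :=
  (LinearMap.toSpanSingleton ℝ E u).coprod (ℝ ∙ u)ᗮ.subtype

lemma lineCoords_apply (u : E) (t : ℝ) (y : (ℝ ∙ u)ᗮ) : lineCoords u (t, y) = t • u + y := rfl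

lemma inner_lineCoords {u : E} (hu : ‖u‖ = 1) (t : ℝ) (y : (ℝ ∙ u)ᗮ) :
    inner ℝ u (lineCoords u (t, y)) = t := by
  rw [lineCoords_apply, inner_add_right, inner_smul_right, real_inner_self_eq_norm_sq, hu,
    Submodule.mem_orthogonal_singleton_iff_inner_right.1 y.2]
  simp

lemma dist_lineCoords_sq {u : E} (hu : ‖u‖ = 1) (s t : ℝ) (x y : (ℝ ∙ u)ᗮ) :
    dist (lineCoords u (s, x)) (lineCoords u (t, y)) ^ 2 = (s - t) ^ 2 + dist x y ^ 2 := by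
  have h : inner ℝ ((s - t) • u) ((x - y : (ℝ ∙ u)ᗮ) : E) = 0 := by
    rw [inner_smul_left, Submodule.mem_orthogonal_singleton_iff_inner_right.1 (x - y).2, mul_zero]
  rw [dist_eq_norm, dist_eq_norm, ← map_sub, Prod.mk_sub_mk, lineCoords_apply, sq, sq ‖x - y‖,
    norm_add_sq_eq_norm_sq_add_norm_sq_real h, norm_smul, hu, mul_one, Real.norm_eq_abs,
    abs_mul_abs_self, sq, Submodule.coe_norm]

variable [FiniteDimensional ℝ E] [MeasurableSpace E] [BorelSpace E]

lemma measurableEmbedding_lineCoords {u : E} (hu : ‖u‖ = 1) :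
    MeasurableEmbedding (lineCoords u) ∧ MeasurePreserving (lineCoords u) := by
  let e := LinearIsometryEquiv.toSpanUnitSingleton (𝕜 := ℝ) u hu
  let ψ : ℝ × (ℝ ∙ u)ᗮ ≃ᵐ E :=
    ((e.toMeasurableEquiv.prodCongr (MeasurableEquiv.refl _)).trans
      (MeasurableEquiv.toLp 2 _)).trans (ℝ ∙ u).orthogonalDecomposition.symm.toMeasurableEquiv
  have hψ : ⇑(lineCoords u) = ψ := by
    rfl
  rw [hψ]
  refine ⟨ψ.measurableEmbedding, ?_⟩
  have h₁ : MeasurePreserving (Prod.map e (id : (ℝ ∙ u)ᗮ → (ℝ ∙ u)ᗮ)) :=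
    e.measurePreserving.prod (MeasurePreserving.id _)
  exact ((ℝ ∙ u).orthogonalDecomposition.symm.measurePreserving.comp
    (WithLp.volume_preserving_toLp _ _)).comp h₁

lemma Isoperimetric.of_linearIsometryEquiv {F : Type*} [NormedAddCommGroup F]
    [InnerProductSpace ℝ F] [FiniteDimensional ℝ F] [MeasurableSpace F] [BorelSpace F]
    (h : Isoperimetric E) (e : E ≃ₗᵢ[ℝ] F) : Isoperimetric F := by
  intro f M hM hf hfM hmeas D d hd hD S T hS hT hsep
  have hemb : MeasurableEmbedding e := e.toMeasurableEquiv.measurableEmbedding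
  have h' := h (f ∘ e) M hM (hf.comp_affine e.toLinearEquiv.toLinearMap.toAffineMap)
    (fun x => hfM _) (hmeas.comp_quasiMeasurePreserving e.measurePreserving.quasiMeasurePreserving)
    D d hd (fun x y hx hy => e.dist_map x y ▸ hD _ _ hx hy) (e ⁻¹' S) (e ⁻¹' T)
    (hemb.measurable hS) (hemb.measurable hT)
    (fun x hx y hy hfx hfy => e.dist_map x y ▸ hsep _ hx _ hy hfx hfy)
  rw [← Set.preimage_union, ← Set.preimage_compl] at h'
  simpa only [Function.comp_def,
    e.measurePreserving.setLIntegral_comp_preimage_emb hemb] using h'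

/-- If the support of `f` lies in a thin slab, the isoperimetric inequality for `f` follows from the
one for its marginal on the hyperplane. -/
lemma Isoperimetric.of_slab {u : E} (hu : ‖u‖ = 1) (ih : Isoperimetric (ℝ ∙ u)ᗮ)
    {f : E → ℝ≥0∞} {M : ℝ≥0∞} (hM : M ≠ ∞) (hf : LogConcave f) (hfM : ∀ x, f x ≤ M)
    (hmeas : AEMeasurable f) {D d d' δ c : ℝ} (hd : 0 < d) (hd' : 0 < d')
    (hδ : d' ^ 2 + (2 * δ) ^ 2 ≤ d ^ 2)
    (hslab : ∀ x, f x ≠ 0 → |inner ℝ u x - c| ≤ δ)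
    (hD : ∀ x y, f x ≠ 0 → f y ≠ 0 → dist x y ≤ D) {S T : Set E} (hS : MeasurableSet S)
    (hT : MeasurableSet T) (hsep : ∀ x ∈ S, ∀ y ∈ T, f x ≠ 0 → f y ≠ 0 → d ≤ dist x y) :
    2 * ENNReal.ofReal d' * min (∫⁻ x in S, f x) (∫⁻ x in T, f x) ≤
      ENNReal.ofReal D * ∫⁻ x in (S ∪ T)ᶜ, f x := by
  obtain ⟨hemb, hmp⟩ := measurableEmbedding_lineCoords hu
  set g : ℝ × (ℝ ∙ u)ᗮ → ℝ≥0∞ := f ∘ lineCoords u with hg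
  have hgmeas : AEMeasurable g := hmeas.comp_quasiMeasurePreserving hmp.quasiMeasurePreserving
  have hgt : ∀ t y, g (t, y) ≠ 0 → |t - c| ≤ δ := fun t y h => by
    simpa [inner_lineCoords hu] using hslab _ h
  set m : (ℝ ∙ u)ᗮ → ℝ≥0∞ := fun y => ∫⁻ t, g (t, y) with hm
  have hm0 : ∀ y, m y ≠ 0 → ∃ t, g (t, y) ≠ 0 := fun y hy => by
    by_contra! h
    exact hy (by simp [hm, h])
  let proj : Set E → Set (ℝ ∙ u)ᗮ := fun A =>
    closure {y | ∃ t, lineCoords u (t, y) ∈ A ∧ g (t, y) ≠ 0}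
  have hproj : ∀ {A t y}, lineCoords u (t, y) ∈ A → g (t, y) ≠ 0 → y ∈ proj A := fun h₁ h₂ =>
    subset_closure ⟨_, h₁, h₂⟩
  have hfib : ∀ A, MeasurableSet A →
      ∫⁻ x in A, f x = ∫⁻ y, ∫⁻ t, (lineCoords u ⁻¹' A).indicator g (t, y) := fun A hA => by
    have hA' := hemb.measurable hA
    rw [← hmp.setLIntegral_comp_preimage_emb hemb, ← lintegral_indicator hA']
    exact lintegral_prod_symm _ (hgmeas.indicator hA')
  have hle : ∀ A, MeasurableSet A → ∫⁻ x in A, f x ≤ ∫⁻ y in proj A, m y := fun A hA => by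
    rw [hfib A hA, ← lintegral_indicator isClosed_closure.measurableSet]
    refine lintegral_mono fun y => ?_
    by_cases hy : y ∈ proj A
    · rw [Set.indicator_of_mem hy]
      exact lintegral_mono fun t => Set.indicator_le_self _ _ _
    · rw [Set.indicator_of_notMem hy, nonpos_iff_eq_zero, ← lintegral_zero]
      congr with t
      by_contra h
      rw [Set.indicator_apply_eq_zero] at h
      push Not at h
      exact hy (hproj h.1 h.2)
  have hge : ∫⁻ y in (proj S ∪ proj T)ᶜ, m y ≤ ∫⁻ x in (S ∪ T)ᶜ, f x := by
    rw [hfib _ (hS.union hT).compl, ← lintegral_indicator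
      (isClosed_closure.union isClosed_closure).measurableSet.compl]
    refine lintegral_mono fun y => ?_
    by_cases hy : y ∈ (proj S ∪ proj T)ᶜ
    · rw [Set.indicator_of_mem hy]
      refine lintegral_mono fun t => ?_
      by_cases h : g (t, y) = 0
      · simp [h]
      · rw [Set.indicator_of_mem]
        rintro (hS' | hT')
        · exact hy (Or.inl (hproj hS' h))
        · exact hy (Or.inr (hproj hT' h))
    · rw [Set.indicator_of_notMem hy]
      exact bot_le
  have hmM : ∀ y, m y ≤ M * volume (Set.Icc (c - δ) (c + δ)) := fun y => by
    rw [← setLIntegral_const, ← lintegral_indicator measurableSet_Icc]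
    refine lintegral_mono fun t => ?_
    by_cases h : g (t, y) = 0
    · simp [h]
    · have := abs_le.1 (hgt t y h)
      rw [Set.indicator_of_mem (Set.mem_Icc.2 ⟨by linarith, by linarith⟩)]
      exact hfM _
  refine le_trans ?_ ((ih m _ (ENNReal.mul_ne_top hM measure_Icc_lt_top.ne)
    ((hf.comp_affine (lineCoords u).toAffineMap).lintegral hM fun _ => hfM _) hmM
    hgmeas.lintegral_prod_left' D d' hd' ?_ (proj S) (proj T) isClosed_closure.measurableSet
    isClosed_closure.measurableSet ?_).trans (by gcongr))
  · gcongr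
    · exact hle S hS
    · exact hle T hT
  · intro x y hx hy
    obtain ⟨s, hs⟩ := hm0 x hx
    obtain ⟨t, ht⟩ := hm0 y hy
    refine le_trans (abs_le_of_sq_le_sq' ?_ dist_nonneg).2 (hD _ _ hs ht)
    rw [dist_lineCoords_sq hu]
    nlinarith
  · intro x hx y hy _ _
    refine le_dist_of_mem_closure ?_ x hx y hy
    rintro x ⟨s, hs, hfs⟩ y ⟨t, ht, hft⟩
    have h := pow_le_pow_left₀ hd.le (hsep _ hs _ ht hfs hft) 2
    rw [dist_lineCoords_sq hu] at h
    have hst : |s - t| ≤ 2 * δ := by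
      have := abs_sub_le s c t
      rw [abs_sub_comm c t] at this
      linarith [hgt s x hfs, hgt t y hft]
    have := pow_le_pow_left₀ (abs_nonneg _) hst 2
    rw [sq_abs] at this
    exact (abs_le_of_sq_le_sq' (by linarith) dist_nonneg).2

/-- Reduction of the isoperimetric inequality to hyperplanes. -/
lemma isoperimetric_of_hyperplanes (hE : 1 < Module.finrank ℝ E)
    (ih : ∀ u : E, ‖u‖ = 1 → Isoperimetric (ℝ ∙ u)ᗮ) : Isoperimetric E := by
  intro f M hM hf hfM hmeas D d hd hD S T hS hT hsep
  by_contra! h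
  obtain ⟨x₀, hx₀⟩ : ∃ x, f x ≠ 0 := by
    by_contra! h0
    simp [h0] at h
  have hD0 : 0 ≤ D := by simpa using hD x₀ x₀ hx₀ hx₀
  have hsupp : ∀ x ∉ Metric.closedBall x₀ D, f x = 0 := fun x hx => by
    by_contra h0
    exact hx (hD x x₀ h0 hx₀)
  have hfin : ∫⁻ x, f x ≠ ∞ := by
    rw [← setLIntegral_eq_of_support_subset (s := Metric.closedBall x₀ D)
      fun x hx => by_contra fun hx' => hx (hsupp x hx')]
    refine ((lintegral_mono hfM).trans_lt ?_).ne
    rw [setLIntegral_const]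
    exact ENNReal.mul_lt_top hM.lt_top measure_closedBall_lt_top
  have hR : MeasurableSet (S ∪ T)ᶜ := (hS.union hT).compl
  set ν : Measure E := volume.withDensity f with hν
  have : IsFiniteMeasure ν := isFiniteMeasure_withDensity hfin
  have hac : ∀ A : Set E, ν.restrict A ≪ volume := fun A =>
    Measure.restrict_le_self.absolutelyContinuous.trans (withDensity_absolutelyContinuous _ _)
  have hνK : ∀ {A K : Set E}, MeasurableSet A → MeasurableSet K →
      (ν.restrict A) K = ∫⁻ x in A, K.indicator f x := fun {A K} hA hK => by
    rw [Measure.restrict_apply hK, withDensity_apply _ (hK.inter hA), lintegral_indicator hK,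
      Measure.restrict_restrict hK]
  have hν₀ : ∀ {A : Set E}, MeasurableSet A →
      (ν.restrict A) (Metric.closedBall x₀ D) = ∫⁻ x in A, f x := fun {A} hA => by
    rw [hνK hA Metric.isClosed_closedBall.measurableSet, Set.indicator_eq_self.2]
    exact fun x hx => by_contra fun hx' => hx (hsupp x hx')
  have hreal : ∀ {e : ℝ}, 0 ≤ e → ∀ {A B K : Set E},
      (D * (ν.restrict A).real K < 2 * e * (ν.restrict B).real K ↔
        ENNReal.ofReal D * (ν.restrict A) K < 2 * ENNReal.ofReal e * (ν.restrict B) K) := by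
    intro e he A B K
    rw [← ENNReal.toReal_lt_toReal (ENNReal.mul_ne_top ENNReal.ofReal_ne_top (measure_ne_top _ _))
      (ENNReal.mul_ne_top (by finiteness) (measure_ne_top _ _))]
    simp [measureReal_def, ENNReal.toReal_ofReal hD0, ENNReal.toReal_ofReal he]
  have hlt : ∀ A : Set E, MeasurableSet A → min (∫⁻ x in S, f x) (∫⁻ x in T, f x) ≤ ∫⁻ x in A, f x →
      ∀ᶠ e in 𝓝[<] d, D * (ν.restrict (S ∪ T)ᶜ).real (Metric.closedBall x₀ D) <
        2 * e * (ν.restrict A).real (Metric.closedBall x₀ D) := by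
    intro A hA hmin
    have hc : Continuous fun e => 2 * e * (ν.restrict A).real (Metric.closedBall x₀ D) := by
      fun_prop
    refine ((hc.tendsto d).mono_left nhdsWithin_le_nhds).eventually_const_lt ?_
    rw [hreal hd.le, hν₀ hR, hν₀ hA]
    exact h.trans_le (by gcongr)
  have hpos : ∀ᶠ e in 𝓝[<] d, 0 < e :=
    (tendsto_id.mono_left nhdsWithin_le_nhds).eventually_const_lt hd
  obtain ⟨d', hlt₁, hlt₂, hd'pos, hd'⟩ := ((hlt S hS (min_le_left _ _)).and
    ((hlt T hT (min_le_right _ _)).and (hpos.and self_mem_nhdsWithin))).exists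
  have hd'd : d' < d := hd'
  have hsq : 0 < d ^ 2 - d' ^ 2 := by nlinarith
  obtain ⟨K, u, c, hK, hKc, hu, hslab, h₁, h₂⟩ := exists_convex_subset_slab hE (hac S) (hac T)
    (hac (S ∪ T)ᶜ) (isCompact_closedBall x₀ D) (convex_closedBall x₀ D) hlt₁ hlt₂
    (δ := √(d ^ 2 - d' ^ 2) / 2) (by positivity)
  have hKm := hK.isClosed.measurableSet
  rw [hreal hd'pos.le, hνK hR hKm, hνK hS hKm] at h₁
  rw [hreal hd'pos.le, hνK hR hKm, hνK hT hKm] at h₂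
  have hKf : ∀ {x}, K.indicator f x ≠ 0 → x ∈ K ∧ f x ≠ 0 := fun {x} hx =>
    ⟨Set.mem_of_indicator_ne_zero hx, fun h0 => hx (by simp [Set.indicator, h0])⟩
  have hfinal := Isoperimetric.of_slab hu (ih u hu) hM (hf.indicator hKc)
    (fun x => (Set.indicator_le_self _ _ _).trans (hfM x)) (hmeas.indicator hKm) hd hd'pos
    (c := c) (δ := √(d ^ 2 - d' ^ 2) / 2) (D := D)
    (by rw [mul_div_cancel₀ _ two_ne_zero, sq_sqrt hsq.le]; linarith)
    (fun x hx => (hslab x (hKf hx).1).le) (fun x y hx hy => hD x y (hKf hx).2 (hKf hy).2) hS hT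
    (fun x hx y hy hfx hfy => hsep x hx y hy (hKf hfx).2 (hKf hfy).2)
  rcases min_choice (∫⁻ x in S, K.indicator f x) (∫⁻ x in T, K.indicator f x) with hm | hm
  · exact (hm ▸ hfinal).not_gt h₁
  · exact (hm ▸ hfinal).not_gt h₂

end Induction

lemma isoperimetric_of_finrank_eq (n : ℕ) : ∀ (E : Type*) [NormedAddCommGroup E]
    [InnerProductSpace ℝ E] [FiniteDimensional ℝ E] [MeasurableSpace E] [BorelSpace E],
    Module.finrank ℝ E = n → Isoperimetric E := by
  induction n with
  | zero =>
    intro E _ _ _ _ _ hE f M hM hf hfM hmeas D d hd hD S T hS hT hsep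
    have : Subsingleton E := Module.finrank_zero_iff.1 hE
    have h0 : (∫⁻ x in S, f x) = 0 ∨ (∫⁻ x in T, f x) = 0 := by
      by_contra! h
      have hex : ∀ A : Set E, MeasurableSet A → ∫⁻ x in A, f x ≠ 0 → ∃ x ∈ A, f x ≠ 0 := by
        intro A hA h
        by_contra! h'
        exact h (by rw [setLIntegral_congr_fun hA h', lintegral_zero])
      obtain ⟨x, hx, hfx⟩ := hex S hS h.1
      obtain ⟨y, hy, hfy⟩ := hex T hT h.2
      have := hsep x hx y hy hfx hfy
      rw [Subsingleton.elim x y, dist_self] at this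
      linarith
    rcases h0 with h0 | h0 <;> simp [h0]
  | succ n ih =>
    intro E _ _ _ _ _ hE
    rcases n.eq_zero_or_pos with rfl | hn
    · let e : ℝ ≃ₗᵢ[ℝ] E := (stdOrthonormalBasis ℝ ℝ).equiv (stdOrthonormalBasis ℝ E)
        (finCongr (by rw [hE, Module.finrank_self]))
      exact Isoperimetric.of_linearIsometryEquiv isoperimetric_real e
    · refine isoperimetric_of_hyperplanes (by omega) fun u hu => ih _ ?_
      have : Fact (Module.finrank ℝ E = n + 1) := ⟨hE⟩
      exact Submodule.finrank_orthogonal_span_singleton (fun h => by simp [h] at hu)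

lemma isoperimetric_of_finiteDimensional (E : Type*) [NormedAddCommGroup E] [InnerProductSpace ℝ E]
    [FiniteDimensional ℝ E] [MeasurableSpace E] [BorelSpace E] : Isoperimetric E :=
  isoperimetric_of_finrank_eq _ E rfl

lemma setDist_le_dist {n : ℕ} {S T : Set (EuclideanSpace ℝ (Fin n))}
    {x y : EuclideanSpace ℝ (Fin n)} (hx : x ∈ S) (hy : y ∈ T) : setDist S T ≤ dist x y :=
  csInf_le ⟨0, by rintro _ ⟨a, -, b, -, rfl⟩; exact dist_nonneg⟩ ⟨x, hx, y, hy, rfl⟩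

lemma logConcave_ofReal {n : ℕ} {f : EuclideanSpace ℝ (Fin n) → ℝ} (hf : IsLogConcave f)
    (hf0 : ∀ x, 0 ≤ f x) : LogConcave fun x => ENNReal.ofReal (f x) := by
  intro x y l h₀ h₁
  change ENNReal.ofReal (f x) ^ l * ENNReal.ofReal (f y) ^ (1 - l) ≤ ENNReal.ofReal _
  rw [ENNReal.ofReal_rpow_of_nonneg (hf0 x) h₀.le,
    ENNReal.ofReal_rpow_of_nonneg (hf0 y) (by linarith),
    ← ENNReal.ofReal_mul (rpow_nonneg (hf0 x) _)]
  exact ENNReal.ofReal_le_ofReal (hf x y l h₀.le h₁.le)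

/-- The isoperimetric inequality without the boundedness assumption. -/
lemma LogConcave.isoperimetric {E : Type*} [NormedAddCommGroup E] [InnerProductSpace ℝ E]
    [FiniteDimensional ℝ E] [MeasurableSpace E] [BorelSpace E] {f : E → ℝ≥0∞} (hf : LogConcave f)
    (hfm : AEMeasurable f) (hft : ∀ x, f x ≠ ∞) {D d : ℝ} (hd : 0 < d)
    (hD : ∀ x y, f x ≠ 0 → f y ≠ 0 → dist x y ≤ D) {S T : Set E} (hS : MeasurableSet S)
    (hT : MeasurableSet T) (hsep : ∀ x ∈ S, ∀ y ∈ T, f x ≠ 0 → f y ≠ 0 → d ≤ dist x y) :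
    2 * ENNReal.ofReal d * min (∫⁻ x in S, f x) (∫⁻ x in T, f x) ≤
      ENNReal.ofReal D * ∫⁻ x in (S ∪ T)ᶜ, f x := by
  have hlim : ∀ A : Set E, Tendsto (fun N : ℕ => ∫⁻ x in A, min (f x) N) atTop
      (𝓝 (∫⁻ x in A, f x)) := fun A => by
    refine lintegral_tendsto_of_tendsto_of_monotone
      (fun N => (hfm.min aemeasurable_const).restrict)
      (Eventually.of_forall fun x N N' h => min_le_min_left _ (by exact_mod_cast h))
      (Eventually.of_forall fun x => tendsto_const_nhds.congr' ?_)
    obtain ⟨N, hN⟩ := ENNReal.exists_nat_gt (hft x)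
    filter_upwards [eventually_ge_atTop N] with N' hN'
    exact (min_eq_left (hN.le.trans (by exact_mod_cast hN'))).symm
  have hne : ∀ {N : ℕ} {x}, min (f x) N ≠ 0 → f x ≠ 0 := fun h h0 => h (by simp [h0])
  refine le_of_tendsto_of_tendsto' (ENNReal.Tendsto.const_mul ((hlim S).min (hlim T))
      (Or.inr (by finiteness)))
    (ENNReal.Tendsto.const_mul (hlim _) (Or.inr ENNReal.ofReal_ne_top)) fun N => ?_
  exact isoperimetric_of_finiteDimensional E _ N (ENNReal.natCast_ne_top N) (hf.min_const N)
    (fun x => min_le_right _ _) (hfm.min aemeasurable_const) D d hd (fun x y hx hy => hD x y (hne hx) (hne hy)) S T hS hT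
    fun x hx y hy hfx hfy => hsep x hx y hy (hne hfx) (hne hfy)

end LogConcaveIsoperimetry

/-- if `f` is an integrable logconcave function whose support has diameter at
most `D`, and `π_f` is the probability measure with density proportional to `f`, then for
every partition `ℝⁿ = S₁ ∪ S₂ ∪ S₃` into measurable sets,
`π_f(S₃) ≥ (2 d(S₁,S₂)/D) ⬝ min (π_f S₁) (π_f S₂)`. -/
theorem logconcave_isoperimetry_diameter
    (n : ℕ) (f : EuclideanSpace ℝ (Fin n) → ℝ) (D : ℝ)
    (hf0 : ∀ x, 0 ≤ f x) (hflc : IsLogConcave f) (hfint : Integrable f)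
    (hfpos : 0 < ∫ x, f x)
    (hdiam : ∀ x y, 0 < f x → 0 < f y → dist x y ≤ D)
    (S₁ S₂ S₃ : Set (EuclideanSpace ℝ (Fin n)))
    (hm₁ : MeasurableSet S₁) (hm₂ : MeasurableSet S₂) (hm₃ : MeasurableSet S₃)
    (hd₁₂ : Disjoint S₁ S₂) (hd₁₃ : Disjoint S₁ S₃) (hd₂₃ : Disjoint S₂ S₃)
    (hcover : S₁ ∪ S₂ ∪ S₃ = Set.univ) :
    (2 * setDist S₁ S₂ / D) *
        min ((∫ x in S₁, f x) / ∫ x, f x) ((∫ x in S₂, f x) / ∫ x, f x) ≤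
      (∫ x in S₃, f x) / ∫ x, f x := by
  have hI : ∀ A, 0 ≤ ∫ x in A, f x := fun A => integral_nonneg hf0
  obtain ⟨x₀, hx₀⟩ : ∃ x, 0 < f x := by
    by_contra! h
    have h0 : f = 0 := funext fun x => le_antisymm (h x) (hf0 x)
    simp [h0] at hfpos
  have hD : 0 ≤ D := by simpa using hdiam x₀ x₀ hx₀ hx₀
  have hd : 0 ≤ setDist S₁ S₂ := Real.sInf_nonneg (by rintro _ ⟨x, -, y, -, rfl⟩; exact dist_nonneg)
  rw [min_div_div_right hfpos.le, ← mul_div_assoc]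
  refine div_le_div_of_nonneg_right ?_ hfpos.le
  rcases hd.eq_or_lt with hd | hd
  · simpa [← hd] using hI S₃
  rcases hD.eq_or_lt with hD | hD
  · simpa [← hD] using hI S₃
  have hS₃ : (S₁ ∪ S₂)ᶜ = S₃ :=
    (IsCompl.of_eq (hd₁₃.sup_left hd₂₃).eq_bot hcover).compl_eq
  have hpos : ∀ {x}, ENNReal.ofReal (f x) ≠ 0 → 0 < f x := fun h =>
    ENNReal.ofReal_pos.1 (pos_iff_ne_zero.2 h)
  have key := (LogConcaveIsoperimetry.logConcave_ofReal hflc hf0).isoperimetric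
    hfint.aemeasurable.ennreal_ofReal (fun _ => ENNReal.ofReal_ne_top) hd (fun x y hx hy => hdiam x y (hpos hx) (hpos hy)) hm₁ hm₂
    fun x hx y hy _ _ => LogConcaveIsoperimetry.setDist_le_dist hx hy
  have hconv : ∀ A : Set (EuclideanSpace ℝ (Fin n)),
      ∫⁻ x in A, ENNReal.ofReal (f x) = ENNReal.ofReal (∫ x in A, f x) := fun A =>
    (ofReal_integral_eq_lintegral_ofReal hfint.integrableOn (Eventually.of_forall hf0)).symm
  have htwo : 2 * ENNReal.ofReal (setDist S₁ S₂) = ENNReal.ofReal (2 * setDist S₁ S₂) := by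
    rw [ENNReal.ofReal_mul zero_le_two, ENNReal.ofReal_ofNat]
  rw [hS₃, hconv, hconv, hconv, ← ENNReal.ofReal_min, ← ENNReal.ofReal_mul hD.le,
    htwo,
    ← ENNReal.ofReal_mul (by positivity), ENNReal.ofReal_le_ofReal_iff (mul_nonneg hD.le (hI _))]
    at key
  rw [div_mul_eq_mul_div, div_le_iff₀ hD, mul_comm _ D]
  exact key
end
end

section
/- (Localization Lemma) Let g, h : ℝⁿ → ℝ be lower semi-continuous integrable functions such that ∫_{ℝⁿ} g(x) dx > 0 and ∫_{ℝⁿ} h(x) dx > 0. Then there exist two points a, b ∈ ℝⁿ and an affine function ℓ : [0,1] → ℝ≥0 such that ∫₀¹ ℓ(t)^{n−1} g((1−t)a + tb) dt > 0 and ∫₀¹ ℓ(t)^{n−1} h((1−t)a + tb) dt > 0. -/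
open MeasureTheory Real Filter

noncomputable section

/-- A function that is concave and positive on the open interval `(c, d)`. -/
def PosConcave (c d : ℝ) (φ : ℝ → ℝ) : Prop :=
  ConcaveOn ℝ (Set.Ioo c d) φ ∧ ∀ x ∈ Set.Ioo c d, 0 < φ x

lemma ConcaveOn.pos_of_nonneg_of_pos {c d : ℝ} {φ : ℝ → ℝ} (hφ : ConcaveOn ℝ (Set.Ioo c d) φ)
    (h0 : ∀ x ∈ Set.Ioo c d, 0 ≤ φ x) {y : ℝ} (hy : y ∈ Set.Ioo c d) (hpos : 0 < φ y) :
    ∀ x ∈ Set.Ioo c d, 0 < φ x := by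
  intro x hx
  obtain ⟨ε, hε, hz⟩ : ∃ ε > 0, x + ε * (x - y) ∈ Set.Ioo c d := by
    have h1 : Tendsto (fun ε : ℝ => x + ε * (x - y)) (nhdsWithin 0 (Set.Ioi 0)) (nhds x) := by
      have : ContinuousAt (fun ε : ℝ => x + ε * (x - y)) 0 := by fun_prop
      have h2 := this.tendsto
      simp only [zero_mul, add_zero] at h2
      exact h2.mono_left nhdsWithin_le_nhds
    obtain ⟨ε, h2, h3⟩ := ((h1.eventually (isOpen_Ioo.mem_nhds hx)).and
      self_mem_nhdsWithin).exists
    exact ⟨ε, h3, h2⟩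
  have key := hφ.2 hz hy (show 0 ≤ 1 / (1 + ε) by positivity)
    (show 0 ≤ ε / (1 + ε) by positivity) (by field_simp)
  have hxe : (1 / (1 + ε)) • (x + ε * (x - y)) + (ε / (1 + ε)) • y = x := by
    simp only [smul_eq_mul]
    field_simp
    ring
  rw [hxe] at key
  simp only [smul_eq_mul] at key
  have h1 := h0 _ hz
  have : 0 < ε / (1 + ε) * φ y := by positivity
  have : 0 ≤ 1 / (1 + ε) * φ (x + ε * (x - y)) := by positivity
  linarith

namespace PosConcave

variable {c d : ℝ} {φ : ℝ → ℝ}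

lemma le_two_mul_mid (h : PosConcave c d φ) : ∀ x ∈ Set.Ioo c d, φ x ≤ 2 * φ ((c + d) / 2) := by
  intro x hx
  have hx' : c + d - x ∈ Set.Ioo c d := ⟨by linarith [hx.2], by linarith [hx.1]⟩
  have key := h.1.2 hx hx' (show (0 : ℝ) ≤ 1 / 2 by norm_num)
    (show (0 : ℝ) ≤ 1 / 2 by norm_num) (by norm_num)
  have he : (1 / 2 : ℝ) • x + (1 / 2 : ℝ) • (c + d - x) = (c + d) / 2 := by
    simp only [smul_eq_mul]; ring
  rw [he] at key
  simp only [smul_eq_mul] at key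
  linarith [h.2 _ hx']

lemma continuousOn (h : PosConcave c d φ) : ContinuousOn φ (Set.Ioo c d) :=
  h.1.continuousOn isOpen_Ioo

lemma mono (h : PosConcave c d φ) {c' d' : ℝ} (hc : c ≤ c') (hd : d' ≤ d) :
    PosConcave c' d' φ :=
  ⟨h.1.subset (Set.Ioo_subset_Ioo hc hd) (convex_Ioo _ _),
    fun x hx => h.2 x (Set.Ioo_subset_Ioo hc hd hx)⟩

lemma const_mul (h : PosConcave c d φ) {k : ℝ} (hk : 0 < k) :
    PosConcave c d (fun x => k * φ x) :=
  ⟨h.1.smul hk.le, fun x hx => mul_pos hk (h.2 x hx)⟩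

lemma comp_affine (h : PosConcave c d φ) (hcd : c < d) :
    PosConcave 0 1 (fun s => φ (c + s * (d - c))) := by
  have hm : ∀ s ∈ Set.Ioo (0 : ℝ) 1, c + s * (d - c) ∈ Set.Ioo c d := by
    intro s hs
    constructor <;> nlinarith [hs.1, hs.2]
  refine ⟨⟨convex_Ioo _ _, fun x hx y hy a b ha hb hab => ?_⟩, fun x hx => h.2 _ (hm x hx)⟩
  have := h.1.2 (hm x hx) (hm y hy) ha hb hab
  convert this using 2
  simp only [smul_eq_mul]
  linear_combination -c * hab

lemma intervalIntegrable (h : PosConcave c d φ) (hcd : c ≤ d) (p : ℕ) {g : ℝ → ℝ}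
    (hg : Continuous g) : IntervalIntegrable (fun t => φ t ^ p * g t) volume c d := by
  rw [intervalIntegrable_iff_integrableOn_Ioo_of_le hcd]
  obtain ⟨M, hM⟩ := (isCompact_Icc (a := c) (b := d)).exists_bound_of_continuousOn hg.continuousOn
  refine IntegrableOn.of_bound (C := (2 * φ ((c + d) / 2)) ^ p * M) (by simp) ?_ ?_
  · exact ((h.continuousOn.pow p).mul hg.continuousOn).aestronglyMeasurable measurableSet_Ioo
  · refine (ae_restrict_iff' measurableSet_Ioo).2 (Eventually.of_forall fun x hx => ?_)
    have h1 := h.le_two_mul_mid x hx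
    have h2 := h.2 x hx
    rw [norm_mul, norm_pow, Real.norm_of_nonneg h2.le]
    exact mul_le_mul (pow_le_pow_left₀ h2.le h1 p) (hM x (Set.Ioo_subset_Icc_self hx))
      (norm_nonneg _) (pow_nonneg (h2.le.trans h1) p)

end PosConcave

/-- Concave positive functions on `(0, 1)` normalised at the midpoint. -/
def NormalizedConcave (ψ : ℝ → ℝ) : Prop := PosConcave 0 1 ψ ∧ ψ (1 / 2) = 1

lemma PosConcave.normalize {c d : ℝ} {φ : ℝ → ℝ} (h : PosConcave c d φ) (hcd : c < d) :
    NormalizedConcave (fun s => (φ ((c + d) / 2))⁻¹ * φ (c + s * (d - c))) := by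
  have hm : 0 < φ ((c + d) / 2) := h.2 _ ⟨by linarith, by linarith⟩
  refine ⟨(h.comp_affine hcd).const_mul (inv_pos.2 hm), ?_⟩
  have : c + 1 / 2 * (d - c) = (c + d) / 2 := by ring
  simp only [this]
  exact inv_mul_cancel₀ hm.ne'

lemma NormalizedConcave.le_two {ψ : ℝ → ℝ} (h : NormalizedConcave ψ) :
    ∀ x ∈ Set.Ioo (0 : ℝ) 1, ψ x ≤ 2 := by
  intro x hx
  have := h.1.le_two_mul_mid x hx
  simpa only [zero_add, h.2, mul_one] using this

lemma NormalizedConcave.dist_le {ψ : ℝ → ℝ} (h : NormalizedConcave ψ) {x r : ℝ} (hr : 0 < r)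
    (h0 : 0 ≤ x - 2 * r) (h1 : x + 2 * r ≤ 1) {y : ℝ} (hy : dist y x < r) :
    dist (ψ y) (ψ x) ≤ 4 / r * dist y x := by
  have hsub : Metric.ball x (2 * r) ⊆ Set.Ioo (0 : ℝ) 1 := by
    rw [Real.ball_eq_Ioo]
    exact Set.Ioo_subset_Ioo h0 h1
  have hL := (h.1.1.subset hsub (convex_ball _ _)).lipschitzOnWith_of_abs_le (M := 2) hr
    (fun a ha => by
      have ha' := hsub (Metric.mem_ball.2 ha)
      rw [abs_of_pos (h.1.2 a ha')]
      exact h.le_two a ha')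
  have h3 := hL.dist_le_mul y (Metric.mem_ball.2 (by linarith)) x
    (Metric.mem_ball_self (by linarith))
  rw [Real.coe_toNNReal _ (by positivity)] at h3
  norm_num at h3 ⊢
  exact h3

lemma NormalizedConcave.exists_subseq {ψ : ℕ → ℝ → ℝ} (h : ∀ i, NormalizedConcave (ψ i)) :
    ∃ (σ : ℕ → ℕ) (ψ' : ℝ → ℝ), StrictMono σ ∧ NormalizedConcave ψ' ∧
      ∀ x ∈ Set.Ioo (0 : ℝ) 1, Tendsto (fun i => ψ (σ i) x) atTop (nhds (ψ' x)) := by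
  have hcpt : IsCompact (Set.univ.pi fun _ : ℚ => Set.Icc (0 : ℝ) 2) :=
    isCompact_univ_pi fun _ => isCompact_Icc
  let u : ℕ → ℚ → ℝ := fun i q => if (q : ℝ) ∈ Set.Ioo (0 : ℝ) 1 then ψ i q else 0
  obtain ⟨v, -, σ, hσ, hv⟩ := hcpt.isSeqCompact (x := u) (fun i => by
    intro q _
    simp only [u]
    split_ifs with hq
    · exact ⟨((h i).1.2 _ hq).le, (h i).le_two _ hq⟩
    · simp)
  have hq : ∀ q : ℚ, (q : ℝ) ∈ Set.Ioo (0 : ℝ) 1 →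
      CauchySeq (fun i => ψ (σ i) q) := by
    intro q hq
    have := (tendsto_pi_nhds.1 hv q).cauchySeq
    simpa only [u, if_pos hq, Function.comp_def] using this
  have hlim : ∀ x ∈ Set.Ioo (0 : ℝ) 1, ∃ y, Tendsto (fun i => ψ (σ i) x) atTop (nhds y) := by
    intro x hx
    refine cauchySeq_tendsto_of_complete (Metric.cauchySeq_iff'.2 fun ε hε => ?_)
    obtain ⟨r, hr, hr0, hr1⟩ : ∃ r : ℝ, 0 < r ∧ 0 ≤ x - 2 * r ∧ x + 2 * r ≤ 1 := by
      refine ⟨min x (1 - x) / 2, ?_, ?_, ?_⟩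
      · have := lt_min hx.1 (by linarith [hx.2] : 0 < 1 - x); linarith
      · linarith [min_le_left x (1 - x)]
      · linarith [min_le_right x (1 - x)]
    obtain ⟨q, hq1, hq2⟩ := exists_rat_btwn
      (show x < x + min r (ε * r / 16) by linarith [lt_min hr (by positivity : 0 < ε * r / 16)])
    have hqd : dist (q : ℝ) x < r := by
      rw [Real.dist_eq, abs_of_pos (by linarith)]; linarith [min_le_left r (ε * r / 16)]
    have hqe : dist (q : ℝ) x < ε * r / 16 := by
      rw [Real.dist_eq, abs_of_pos (by linarith)]; linarith [min_le_right r (ε * r / 16)]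
    have hqm : (q : ℝ) ∈ Set.Ioo (0 : ℝ) 1 := by
      rw [Real.dist_eq, abs_of_pos (by linarith)] at hqd
      exact ⟨by linarith, by linarith⟩
    obtain ⟨N, hN⟩ := Metric.cauchySeq_iff'.1 (hq q hqm) (ε / 2) (by positivity)
    refine ⟨N, fun n hn => ?_⟩
    have e : ∀ i, dist (ψ i q) (ψ i x) ≤ ε / 4 := fun i => by
      refine ((h i).dist_le hr hr0 hr1 hqd).trans ?_
      calc 4 / r * dist (q : ℝ) x ≤ 4 / r * (ε * r / 16) := by gcongr
        _ = ε / 4 := by field_simp; norm_num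
    calc dist (ψ (σ n) x) (ψ (σ N) x)
        ≤ dist (ψ (σ n) x) (ψ (σ n) q) + dist (ψ (σ n) q) (ψ (σ N) q)
          + dist (ψ (σ N) q) (ψ (σ N) x) := dist_triangle4 _ _ _ _
      _ < ε := by
          rw [dist_comm (ψ (σ n) x)]
          linarith [e (σ n), e (σ N), hN n hn]
  choose! ψ' hψ' using hlim
  have hmid : (1 / 2 : ℝ) ∈ Set.Ioo (0 : ℝ) 1 := by norm_num
  have hconc : ConcaveOn ℝ (Set.Ioo 0 1) ψ' := by
    refine ⟨convex_Ioo _ _, fun x hx y hy a b ha hb hab => ?_⟩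
    refine le_of_tendsto_of_tendsto' (((hψ' x hx).const_smul a).add ((hψ' y hy).const_smul b))
      (hψ' _ (convex_Ioo _ _ hx hy ha hb hab)) fun i => (h (σ i)).1.1.2 hx hy ha hb hab
  have hone : ψ' (1 / 2) = 1 :=
    tendsto_nhds_unique (hψ' _ hmid) (by simp only [(h _).2]; exact tendsto_const_nhds)
  exact ⟨σ, ψ', hσ, ⟨⟨hconc, hconc.pos_of_nonneg_of_pos
    (fun x hx => ge_of_tendsto' (hψ' x hx) fun i => ((h _).1.2 x hx).le) hmid
    (by rw [hone]; norm_num)⟩, hone⟩, hψ'⟩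

/-- Continuity of weighted integrals along pointwise convergent normalised concave weights. -/
lemma NormalizedConcave.tendsto_integral {ψ : ℕ → ℝ → ℝ} {ψ' : ℝ → ℝ} (p : ℕ)
    (h : ∀ i, NormalizedConcave (ψ i))
    (hlim : ∀ x ∈ Set.Ioo (0 : ℝ) 1, Tendsto (fun i => ψ i x) atTop (nhds (ψ' x)))
    {F : ℕ → ℝ → ℝ} {F' : ℝ → ℝ} (hF : ∀ i, Continuous (F i)) {M : ℝ}
    (hM : ∀ i, ∀ x ∈ Set.Icc (0 : ℝ) 1, |F i x| ≤ M)
    (hFlim : ∀ x ∈ Set.Icc (0 : ℝ) 1, Tendsto (fun i => F i x) atTop (nhds (F' x))) :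
    Tendsto (fun i => ∫ s in (0 : ℝ)..1, ψ i s ^ p * F i s) atTop
      (nhds (∫ s in (0 : ℝ)..1, ψ' s ^ p * F' s)) := by
  simp only [intervalIntegral.integral_of_le zero_le_one, integral_Ioc_eq_integral_Ioo]
  refine tendsto_integral_of_dominated_convergence (fun _ => 2 ^ p * M) (fun i => ?_)
    (integrable_const _) (fun i => ?_) ?_
  · exact (((h i).1.continuousOn.pow p).mul (hF i).continuousOn).aestronglyMeasurable
      measurableSet_Ioo
  · refine (ae_restrict_iff' measurableSet_Ioo).2 (Eventually.of_forall fun x hx => ?_)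
    have h2 := (h i).1.2 x hx
    rw [norm_mul, norm_pow, Real.norm_of_nonneg h2.le]
    exact mul_le_mul (pow_le_pow_left₀ h2.le ((h i).le_two x hx) p)
      (hM i x (Set.Ioo_subset_Icc_self hx)) (norm_nonneg _) (by positivity)
  · refine (ae_restrict_iff' measurableSet_Ioo).2 (Eventually.of_forall fun x hx => ?_)
    exact ((hlim x hx).pow p).mul (hFlim x (Set.Ioo_subset_Icc_self hx))

lemma ConcaveOn.rpow_sub_pow {s : Set ℝ} {ψ χ : ℝ → ℝ} {p : ℕ} (hp : 1 ≤ p)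
    (hψ : ConcaveOn ℝ s ψ) (hχ : ConvexOn ℝ s χ) (h0 : ∀ x ∈ s, 0 ≤ χ x)
    (hle : ∀ x ∈ s, χ x ≤ ψ x) :
    ConcaveOn ℝ s (fun x => (ψ x ^ p - χ x ^ p) ^ (1 / (p : ℝ))) := by
  have hp0 : p ≠ 0 := by omega
  have hpr : (1 : ℝ) ≤ p := by exact_mod_cast hp
  refine ⟨hψ.1, fun x hx y hy a b ha hb hab => ?_⟩
  have hz : a • x + b • y ∈ s := hψ.1 hx hy ha hb hab
  have hd : ∀ x ∈ s, 0 ≤ ψ x ^ p - χ x ^ p := fun x hx =>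
    sub_nonneg.2 (pow_le_pow_left₀ (h0 x hx) (hle x hx) p)
  set F : ℝ → ℝ := fun x => (ψ x ^ p - χ x ^ p) ^ (1 / (p : ℝ)) with hF
  have hF0 : ∀ x ∈ s, 0 ≤ F x := fun x hx => Real.rpow_nonneg (hd x hx) _
  have hFp : ∀ x ∈ s, F x ^ p = ψ x ^ p - χ x ^ p := fun x hx => by
    simp only [hF, one_div]
    exact Real.rpow_inv_natCast_pow (hd x hx) hp0
  have hψF : ∀ x ∈ s, (χ x ^ p + F x ^ p) ^ (1 / (p : ℝ)) = ψ x := fun x hx => by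
    rw [hFp x hx, add_sub_cancel, one_div]
    exact Real.pow_rpow_inv_natCast ((h0 x hx).trans (hle x hx)) hp0
  have scale : ∀ k : ℝ, 0 ≤ k → ∀ x ∈ s,
      ((k * χ x) ^ p + (k * F x) ^ p) ^ (1 / (p : ℝ)) = k * ψ x := fun k hk x hx => by
    rw [mul_pow, mul_pow, ← mul_add, Real.mul_rpow (by positivity)
      (add_nonneg (pow_nonneg (h0 x hx) p) (pow_nonneg (hF0 x hx) p)), hψF x hx, one_div,
      Real.pow_rpow_inv_natCast hk hp0]
  have mink := Real.Lp_add_le_of_nonneg (Finset.univ : Finset (Fin 2)) (p := (p : ℝ))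
    (f := ![a * χ x, a * F x]) (g := ![b * χ y, b * F y]) hpr
    (by
      intro i _
      fin_cases i
      · exact mul_nonneg ha (h0 x hx)
      · exact mul_nonneg ha (hF0 x hx))
    (by
      intro i _
      fin_cases i
      · exact mul_nonneg hb (h0 y hy)
      · exact mul_nonneg hb (hF0 y hy))
  simp only [Fin.sum_univ_two, Matrix.cons_val_zero, Matrix.cons_val_one, Real.rpow_natCast,
    scale a ha x hx, scale b hb y hy] at mink
  set u := a * χ x + b * χ y with hu
  set v := a * F x + b * F y with hv
  have hu0 : 0 ≤ u := add_nonneg (mul_nonneg ha (h0 x hx)) (mul_nonneg hb (h0 y hy))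
  have hv0 : 0 ≤ v := add_nonneg (mul_nonneg ha (hF0 x hx)) (mul_nonneg hb (hF0 y hy))
  have h1 : χ (a • x + b • y) ≤ u := hχ.2 hx hy ha hb hab
  have h2 : a * ψ x + b * ψ y ≤ ψ (a • x + b • y) := hψ.2 hx hy ha hb hab
  have h3 : u ^ p + v ^ p ≤ ψ (a • x + b • y) ^ p := by
    have h4 := pow_le_pow_left₀ (Real.rpow_nonneg (by positivity) _) (mink.trans h2) p
    rwa [one_div, Real.rpow_inv_natCast_pow (by positivity) hp0] at h4
  have h5 : v ^ p ≤ F (a • x + b • y) ^ p := by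
    rw [hFp _ hz]
    linarith [pow_le_pow_left₀ (h0 _ hz) h1 p]
  exact (pow_le_pow_iff_left₀ hv0 (hF0 _ hz) hp0).1 h5

lemma exists_eq_Ioo_of_convex {J : Set ℝ} (hconv : Convex ℝ J) (hopen : IsOpen J)
    (hne : J.Nonempty) (hsub : J ⊆ Set.Ioo 0 1) :
    ∃ c d : ℝ, 0 ≤ c ∧ c < d ∧ d ≤ 1 ∧ J = Set.Ioo c d := by
  have hb : BddBelow J := ⟨0, fun x hx => (hsub hx).1.le⟩
  have ha : BddAbove J := ⟨1, fun x hx => (hsub hx).2.le⟩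
  have heq : J = Set.Ioo (sInf J) (sSup J) := by
    refine subset_antisymm ?_ (IsConnected.Ioo_csInf_csSup_subset
      ⟨hne, hconv.isPreconnected⟩ hb ha)
    rw [← interior_Icc]
    exact interior_maximal (subset_Icc_csInf_csSup hb ha) hopen
  refine ⟨sInf J, sSup J, le_csInf hne fun x hx => (hsub hx).1.le, ?_,
    csSup_le hne fun x hx => (hsub hx).2.le, heq⟩
  have := hne
  rw [heq] at this
  exact Set.nonempty_Ioo.1 this

lemma intervalIntegral_eq_of_eq_zero {F G : ℝ → ℝ} {c d : ℝ} (hc : 0 ≤ c) (hcd : c ≤ d)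
    (hd : d ≤ 1) (hFG : ∀ x ∈ Set.Ioo c d, F x = G x)
    (h0 : ∀ x ∈ Set.Ioo (0 : ℝ) 1, x ∉ Set.Ioo c d → F x = 0) :
    ∫ x in (0 : ℝ)..1, F x = ∫ x in c..d, G x := by
  simp only [intervalIntegral.integral_of_le zero_le_one, intervalIntegral.integral_of_le hcd,
    integral_Ioc_eq_integral_Ioo]
  rw [← setIntegral_congr_fun measurableSet_Ioo hFG]
  exact setIntegral_eq_of_subset_of_forall_sdiff_eq_zero measurableSet_Ioo
    (Set.Ioo_subset_Ioo hc hd) fun x hx => h0 x hx.1 hx.2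

/-- No concave weight on a proper subinterval of `[0, 1]` makes both integrals nonnegative. -/
def Tight (p : ℕ) (g h : ℝ → ℝ) : Prop :=
  ∀ (c d : ℝ) (φ : ℝ → ℝ), 0 ≤ c → c < d → d ≤ 1 → PosConcave c d φ →
    0 ≤ ∫ t in c..d, φ t ^ p * g t → 0 ≤ ∫ t in c..d, φ t ^ p * h t → c = 0 ∧ d = 1

lemma Tight.symm {p : ℕ} {g h : ℝ → ℝ} (ht : Tight p g h) : Tight p h g :=
  fun c d φ h1 h2 h3 h4 h5 h6 => ht c d φ h1 h2 h3 h4 h6 h5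

lemma Tight.integral_nonpos {p : ℕ} {g h : ℝ → ℝ} (hg : Continuous g) (hh : Continuous h)
    (ht : Tight p g h) {c d : ℝ} {φ : ℝ → ℝ} (hc : 0 ≤ c) (hcd : c < d) (hd : d ≤ 1)
    (hφ : PosConcave c d φ) (hIg : 0 ≤ ∫ t in c..d, φ t ^ p * g t) :
    ∫ t in c..d, φ t ^ p * h t ≤ 0 := by
  by_contra! hIh
  have hig := hφ.intervalIntegrable hcd.le p hg
  have hih := hφ.intervalIntegrable hcd.le p hh
  have hcont : ContinuousOn (fun x => ∫ t in c..x, φ t ^ p * h t) (Set.Icc c d) :=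
    intervalIntegral.continuousOn_primitive_interval' hih Set.left_mem_uIcc |>.mono
      Set.Icc_subset_uIcc
  have hmem : (∫ t in c..d, φ t ^ p * h t) / 2 ∈
      Set.Ioo (∫ t in c..c, φ t ^ p * h t) (∫ t in c..d, φ t ^ p * h t) := by
    rw [intervalIntegral.integral_same]
    constructor <;> linarith
  obtain ⟨x, hx, hxe⟩ := intermediate_value_Ioo hcd.le hcont hmem
  have hxu : x ∈ Set.uIcc c d := Set.Icc_subset_uIcc (Set.Ioo_subset_Icc_self hx)
  have s1 : Set.uIcc c x ⊆ Set.uIcc c d := Set.uIcc_subset_uIcc Set.left_mem_uIcc hxu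
  have s2 : Set.uIcc x d ⊆ Set.uIcc c d := Set.uIcc_subset_uIcc hxu Set.right_mem_uIcc
  have ag := intervalIntegral.integral_add_adjacent_intervals (hig.mono_set s1) (hig.mono_set s2)
  have ah := intervalIntegral.integral_add_adjacent_intervals (hih.mono_set s1) (hih.mono_set s2)
  simp only at hxe
  rcases le_or_gt 0 (∫ t in c..x, φ t ^ p * g t) with hl | hl
  · have := ht c x φ hc hx.1 (hx.2.le.trans hd) (hφ.mono le_rfl hx.2.le) hl (by linarith)
    linarith [hx.2]
  · have := ht x d φ (hc.trans hx.1.le) hx.2 hd (hφ.mono hx.1.le le_rfl) (by linarith)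
      (by linarith)
    linarith [hx.1]

/-- The part of the weight `ψ ^ p` cut off by the line `ℓ` from above. -/
def upperPart (p : ℕ) (ψ ℓ : ℝ → ℝ) (t : ℝ) : ℝ := max (ψ t ^ p - max (ℓ t) 0 ^ p) 0

lemma upperPart_nonneg (p : ℕ) (ψ ℓ : ℝ → ℝ) (t : ℝ) : 0 ≤ upperPart p ψ ℓ t :=
  le_max_right _ _

lemma upperPart_le {p : ℕ} {ψ ℓ : ℝ → ℝ} {t : ℝ} (h : 0 < ψ t) :
    upperPart p ψ ℓ t ≤ ψ t ^ p :=
  max_le (sub_le_self _ (pow_nonneg (le_max_right _ _) p)) (pow_nonneg h.le p)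

lemma continuous_line (y₀ x₀ k : ℝ) : Continuous fun t : ℝ => y₀ + k * (t - x₀) := by fun_prop

lemma convexOn_line (y₀ x₀ k : ℝ) (s : Set ℝ) (hs : Convex ℝ s) :
    ConvexOn ℝ s fun t : ℝ => y₀ + k * (t - x₀) := by
  refine ⟨hs, fun x _ y _ a b _ _ hab => le_of_eq ?_⟩
  simp only [smul_eq_mul]
  linear_combination -(y₀ - k * x₀) * hab

lemma concaveOn_line (y₀ x₀ k : ℝ) (s : Set ℝ) (hs : Convex ℝ s) :
    ConcaveOn ℝ s fun t : ℝ => y₀ + k * (t - x₀) := by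
  refine ⟨hs, fun x _ y _ a b _ _ hab => le_of_eq ?_⟩
  simp only [smul_eq_mul]
  linear_combination (y₀ - k * x₀) * hab

lemma PosConcave.continuousOn_upperPart {ψ ℓ : ℝ → ℝ} (hψ : PosConcave 0 1 ψ) (p : ℕ)
    (hℓ : Continuous ℓ) : ContinuousOn (upperPart p ψ ℓ) (Set.Ioo 0 1) :=
  ContinuousOn.sup
    ((hψ.continuousOn.pow p).sub ((hℓ.max continuous_const).pow p).continuousOn)
    continuousOn_const

lemma PosConcave.integrableOn {ψ : ℝ → ℝ} (hψ : PosConcave 0 1 ψ) (p : ℕ) {g : ℝ → ℝ}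
    (hg : Continuous g) : IntegrableOn (fun t => ψ t ^ p * g t) (Set.Ioo 0 1) :=
  (intervalIntegrable_iff_integrableOn_Ioo_of_le zero_le_one).1
    (hψ.intervalIntegrable zero_le_one p hg)

lemma norm_upperPart_mul_le {p : ℕ} {ψ ℓ g : ℝ → ℝ} {t : ℝ} (h : 0 < ψ t) :
    ‖upperPart p ψ ℓ t * g t‖ ≤ ψ t ^ p * |g t| := by
  rw [norm_mul, Real.norm_of_nonneg (upperPart_nonneg _ _ _ _), Real.norm_eq_abs]
  exact mul_le_mul_of_nonneg_right (upperPart_le h) (abs_nonneg _)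

lemma PosConcave.integrableOn_upperPart {ψ ℓ : ℝ → ℝ} (hψ : PosConcave 0 1 ψ) (p : ℕ)
    (hℓ : Continuous ℓ) {g : ℝ → ℝ} (hg : Continuous g) :
    IntegrableOn (fun t => upperPart p ψ ℓ t * g t) (Set.Ioo 0 1) :=
  (hψ.integrableOn p hg.abs).mono'
    (((hψ.continuousOn_upperPart p hℓ).mul hg.continuousOn).aestronglyMeasurable
      measurableSet_Ioo)
    ((ae_restrict_iff' measurableSet_Ioo).2 (Eventually.of_forall fun t ht =>
      norm_upperPart_mul_le (hψ.2 t ht)))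

/-- A cut through a point under the graph of a concave weight cannot halve a tight pair, if the
part above the cut is always supported in a proper subinterval. -/
lemma Tight.integral_upperPart_ne_zero {p : ℕ} (hp : 1 ≤ p) {g h : ℝ → ℝ} (hg : Continuous g)
    (hh : Continuous h) (ht : Tight p g h) {ψ : ℝ → ℝ} (hψ : PosConcave 0 1 ψ)
    (hIg : ∫ t in (0 : ℝ)..1, ψ t ^ p * g t = 0) (hIh : ∫ t in (0 : ℝ)..1, ψ t ^ p * h t = 0)
    {x₀ y₀ k : ℝ} (hx₀ : x₀ ∈ Set.Ioo (0 : ℝ) 1) (hy₀ : 0 < y₀) (hy : y₀ < ψ x₀)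
    (hproper : ∃ t ∈ Set.Ioo (0 : ℝ) 1, ψ t ≤ y₀ + k * (t - x₀)) :
    ∫ t in (0 : ℝ)..1, upperPart p ψ (fun t => y₀ + k * (t - x₀)) t * g t ≠ 0 := by
  intro hU
  have hp0 : p ≠ 0 := by omega
  set ℓ : ℝ → ℝ := fun t => y₀ + k * (t - x₀) with hℓ
  have hℓc : Continuous ℓ := continuous_line _ _ _
  have hiF : ∀ f : ℝ → ℝ, Continuous f →
      IntervalIntegrable (fun t => upperPart p ψ ℓ t * f t) volume 0 1 := fun f hf =>
    (intervalIntegrable_iff_integrableOn_Ioo_of_le zero_le_one).2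
      (hψ.integrableOn_upperPart p hℓc hf)
  rcases le_or_gt 0 (∫ t in (0 : ℝ)..1, upperPart p ψ ℓ t * h t) with hUh | hUh
  · obtain ⟨c, d, hc, hcd, hd, hJ⟩ := exists_eq_Ioo_of_convex
      (J := {t ∈ Set.Ioo (0 : ℝ) 1 | 0 < ψ t - ℓ t})
      ((hψ.1.sub (convexOn_line _ _ _ _ (convex_Ioo _ _))).convex_gt 0)
      ((hψ.continuousOn.sub hℓc.continuousOn).isOpen_inter_preimage isOpen_Ioo isOpen_Ioi)
      ⟨x₀, hx₀, by simp [hℓ, hy]⟩ (fun t ht => ht.1)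
    have hmem : ∀ t ∈ Set.Ioo c d, t ∈ Set.Ioo (0 : ℝ) 1 ∧ ℓ t < ψ t := fun t ht => by
      rw [← hJ] at ht
      exact ⟨ht.1, sub_pos.1 ht.2⟩
    have hlt : ∀ t ∈ Set.Ioo c d, max (ℓ t) 0 < ψ t := fun t ht =>
      max_lt (hmem t ht).2 (hψ.2 t (hmem t ht).1)
    have hpos : ∀ t ∈ Set.Ioo c d, 0 < ψ t ^ p - max (ℓ t) 0 ^ p := fun t ht =>
      sub_pos.2 (pow_lt_pow_left₀ (hlt t ht) (le_max_right _ _) hp0)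
    have hφ : PosConcave c d fun t => (ψ t ^ p - max (ℓ t) 0 ^ p) ^ (1 / (p : ℝ)) :=
      ⟨(hψ.mono hc hd).1.rpow_sub_pow hp
        ((convexOn_line _ _ _ _ (convex_Ioo _ _)).sup (convexOn_const 0 (convex_Ioo _ _)))
        (fun t _ => le_max_right _ _) (fun t ht => (hlt t ht).le),
        fun t ht => Real.rpow_pos_of_pos (hpos t ht) _⟩
    have hI : ∀ f : ℝ → ℝ, ∫ t in (0 : ℝ)..1, upperPart p ψ ℓ t * f t =
        ∫ t in c..d, ((ψ t ^ p - max (ℓ t) 0 ^ p) ^ (1 / (p : ℝ))) ^ p * f t := fun f => by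
      refine intervalIntegral_eq_of_eq_zero hc hcd.le hd (fun t ht => ?_) fun t ht htJ => ?_
      · rw [one_div, Real.rpow_inv_natCast_pow (hpos t ht).le hp0, upperPart,
          max_eq_left (hpos t ht).le]
      · rw [← hJ] at htJ
        have h1 : ψ t ≤ ℓ t := by
          by_contra! hcon
          exact htJ ⟨ht, sub_pos.2 hcon⟩
        have h2 : ψ t ^ p ≤ max (ℓ t) 0 ^ p :=
          pow_le_pow_left₀ (hψ.2 t ht).le (h1.trans (le_max_left _ _)) p
        rw [upperPart, max_eq_right (by linarith), zero_mul]
    obtain ⟨rfl, rfl⟩ := ht c d _ hc hcd hd hφ (by rw [← hI, hU]) (by rw [← hI]; exact hUh)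
    obtain ⟨t, ht, hle⟩ := hproper
    exact absurd (hmem t ht).2 (not_lt.2 hle)
  · obtain ⟨c, d, hc, hcd, hd, hJ⟩ := exists_eq_Ioo_of_convex
      (J := {t ∈ Set.Ioo (0 : ℝ) 1 | 0 < ℓ t})
      ((concaveOn_line _ _ _ _ (convex_Ioo _ _)).convex_gt 0)
      (hℓc.continuousOn.isOpen_inter_preimage isOpen_Ioo isOpen_Ioi)
      ⟨x₀, hx₀, by simp [hℓ, hy₀]⟩ (fun t ht => ht.1)
    have hmem : ∀ t ∈ Set.Ioo c d, t ∈ Set.Ioo (0 : ℝ) 1 ∧ 0 < ℓ t := fun t ht => by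
      rw [← hJ] at ht
      exact ht
    have hφ : PosConcave c d fun t => min (ψ t) (ℓ t) :=
      ⟨(hψ.mono hc hd).1.inf (concaveOn_line _ _ _ _ (convex_Ioo _ _)),
        fun t ht => lt_min (hψ.2 t (hmem t ht).1) (hmem t ht).2⟩
    have hI : ∀ f : ℝ → ℝ, Continuous f → ∫ t in c..d, min (ψ t) (ℓ t) ^ p * f t =
        (∫ t in (0 : ℝ)..1, ψ t ^ p * f t) - ∫ t in (0 : ℝ)..1, upperPart p ψ ℓ t * f t := by
      intro f hf
      rw [← intervalIntegral.integral_sub (hψ.intervalIntegrable zero_le_one p hf) (hiF f hf)]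
      symm
      refine intervalIntegral_eq_of_eq_zero hc hcd.le hd (fun t ht => ?_) fun t ht htJ => ?_
      · rw [← sub_mul, upperPart, max_eq_left (hmem t ht).2.le]
        congr 1
        rcases le_total (ψ t) (ℓ t) with hle | hle
        · rw [min_eq_left hle, max_eq_right, sub_zero]
          linarith [pow_le_pow_left₀ (hψ.2 t (hmem t ht).1).le hle p]
        · rw [min_eq_right hle, max_eq_left, sub_sub_cancel]
          linarith [pow_le_pow_left₀ (hmem t ht).2.le hle p]
      · rw [← hJ] at htJ
        have h1 : ℓ t ≤ 0 := by
          by_contra! hcon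
          exact htJ ⟨ht, hcon⟩
        rw [upperPart, max_eq_right h1, zero_pow hp0, sub_zero,
          max_eq_left (pow_nonneg (hψ.2 t ht).le p), sub_self]
    have := ht.integral_nonpos hg hh hc hcd hd hφ (by rw [hI g hg, hIg, hU, sub_zero])
    rw [hI h hh, hIh] at this
    linarith

lemma PosConcave.continuous_integral_upperPart {ψ : ℝ → ℝ} (hψ : PosConcave 0 1 ψ) (p : ℕ)
    {g : ℝ → ℝ} (hg : Continuous g) (x₀ y₀ : ℝ) :
    Continuous fun k : ℝ =>
      ∫ t in Set.Ioo (0 : ℝ) 1, upperPart p ψ (fun t => y₀ + k * (t - x₀)) t * g t := by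
  refine continuous_of_dominated (bound := fun t => ψ t ^ p * |g t|)
    (fun k => (hψ.integrableOn_upperPart p (continuous_line _ _ _) hg).aestronglyMeasurable)
    (fun k => (ae_restrict_iff' measurableSet_Ioo).2 (Eventually.of_forall fun t ht =>
      norm_upperPart_mul_le (hψ.2 t ht))) (hψ.integrableOn p hg.abs)
    (Eventually.of_forall fun t => ?_)
  unfold upperPart
  fun_prop

lemma PosConcave.tendsto_integral_upperPart {ψ : ℝ → ℝ} (hψ : PosConcave 0 1 ψ) (p : ℕ)
    {g : ℝ → ℝ} (hg : Continuous g) (x₀ y₀ : ℝ) {l : Filter ℝ} [l.IsCountablyGenerated]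
    {S : Set ℝ} (hS : MeasurableSet S)
    (hlim : ∀ t ∈ Set.Ioo (0 : ℝ) 1, t ≠ x₀ → ∀ᶠ k in l,
      upperPart p ψ (fun t => y₀ + k * (t - x₀)) t = S.indicator (fun t => ψ t ^ p) t) :
    Tendsto (fun k : ℝ =>
      ∫ t in Set.Ioo (0 : ℝ) 1, upperPart p ψ (fun t => y₀ + k * (t - x₀)) t * g t) l
      (nhds (∫ t in Set.Ioo (0 : ℝ) 1 ∩ S, ψ t ^ p * g t)) := by
  rw [← setIntegral_indicator hS]
  refine tendsto_integral_filter_of_dominated_convergence (fun t => ψ t ^ p * |g t|)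
    (Eventually.of_forall fun k =>
      (hψ.integrableOn_upperPart p (continuous_line _ _ _) hg).aestronglyMeasurable)
    (Eventually.of_forall fun k => (ae_restrict_iff' measurableSet_Ioo).2
      (Eventually.of_forall fun t ht => norm_upperPart_mul_le (hψ.2 t ht)))
    (hψ.integrableOn p hg.abs) ?_
  have h0 : ∀ᵐ t ∂(volume.restrict (Set.Ioo (0 : ℝ) 1)), t ≠ x₀ := Measure.ae_ne _ x₀
  filter_upwards [h0, ae_restrict_mem measurableSet_Ioo] with t ht htm
  refine tendsto_const_nhds.congr' ?_
  filter_upwards [hlim t htm ht] with k hk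
  rw [hk]
  by_cases htS : t ∈ S <;> simp [htS]

lemma upperPart_of_nonpos {p : ℕ} (hp : p ≠ 0) {ψ ℓ : ℝ → ℝ} {t : ℝ} (hψ : 0 < ψ t)
    (h : ℓ t ≤ 0) : upperPart p ψ ℓ t = ψ t ^ p := by
  rw [upperPart, max_eq_right h, zero_pow hp, sub_zero, max_eq_left (pow_nonneg hψ.le p)]

lemma upperPart_of_le {p : ℕ} {ψ ℓ : ℝ → ℝ} {t : ℝ} (hψ : 0 < ψ t)
    (h : ψ t ≤ ℓ t) : upperPart p ψ ℓ t = 0 :=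
  max_eq_right (sub_nonpos.2 (pow_le_pow_left₀ hψ.le (h.trans (le_max_left _ _)) p))

/-- A weight for which a tight pair has nonnegative integrals is convex. -/
lemma Tight.le_chord {p : ℕ} (hp : 1 ≤ p) {g h : ℝ → ℝ} (hg : Continuous g)
    (hh : Continuous h) (ht : Tight p g h) {ψ : ℝ → ℝ} (hψ : PosConcave 0 1 ψ)
    (hIg : 0 ≤ ∫ t in (0 : ℝ)..1, ψ t ^ p * g t) (hIh : 0 ≤ ∫ t in (0 : ℝ)..1, ψ t ^ p * h t)
    {u x₀ v : ℝ} (hu : 0 < u) (hux : u < x₀) (hxv : x₀ < v) (hv : v < 1) :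
    (v - u) * ψ x₀ ≤ (v - x₀) * ψ u + (x₀ - u) * ψ v := by
  have hIh' := ht.integral_nonpos hg hh le_rfl zero_lt_one le_rfl hψ hIg
  have hIg' := ht.symm.integral_nonpos hh hg le_rfl zero_lt_one le_rfl hψ hIh
  replace hIg : ∫ t in (0 : ℝ)..1, ψ t ^ p * g t = 0 := le_antisymm hIg' hIg
  replace hIh : ∫ t in (0 : ℝ)..1, ψ t ^ p * h t = 0 := le_antisymm hIh' hIh
  by_contra! hlt
  have hp0 : p ≠ 0 := by omega
  have hx₀ : x₀ ∈ Set.Ioo (0 : ℝ) 1 := ⟨by linarith, by linarith⟩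
  have hum : u ∈ Set.Ioo (0 : ℝ) 1 := ⟨by linarith, by linarith⟩
  have hvm : v ∈ Set.Ioo (0 : ℝ) 1 := ⟨by linarith, by linarith⟩
  have hψu := hψ.2 u hum
  have hψv := hψ.2 v hvm
  have hvu : 0 < v - u := by linarith
  obtain ⟨y₀, hy₁, hy₂⟩ := exists_between
    (show ((v - x₀) * ψ u + (x₀ - u) * ψ v) / (v - u) < ψ x₀ by
      rw [div_lt_iff₀ hvu]; linarith)
  have hy₀ : 0 < y₀ := lt_trans (div_pos (add_pos (mul_pos (by linarith) hψu)
    (mul_pos (by linarith) hψv)) hvu) hy₁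
  rw [div_lt_iff₀ hvu] at hy₁
  have hproper : ∀ k : ℝ, ∃ t ∈ Set.Ioo (0 : ℝ) 1, ψ t ≤ y₀ + k * (t - x₀) := by
    intro k
    by_contra! hcon
    have h1 := mul_lt_mul_of_pos_left (hcon u hum) (show 0 < v - x₀ by linarith)
    have h2 := mul_lt_mul_of_pos_left (hcon v hvm) (show 0 < x₀ - u by linarith)
    nlinarith
  have hIoo : ∀ F : ℝ → ℝ, ∫ t in Set.Ioo (0 : ℝ) 1, F t = ∫ t in (0 : ℝ)..1, F t := fun F => by
    rw [intervalIntegral.integral_of_le zero_le_one, integral_Ioc_eq_integral_Ioo]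
  set U : ℝ → ℝ := fun k =>
    ∫ t in Set.Ioo (0 : ℝ) 1, upperPart p ψ (fun t => y₀ + k * (t - x₀)) t * g t with hUdef
  have hU0 : ∀ k, U k ≠ 0 := fun k => by
    rw [hUdef]
    simp only [hIoo]
    exact ht.integral_upperPart_ne_zero hp hg hh hψ hIg hIh hx₀ hy₀ hy₂ (hproper k)
  have hUc : Continuous U := hψ.continuous_integral_upperPart p hg x₀ y₀
  have hsplit : ∀ f : ℝ → ℝ, Continuous f → (∫ t in (0 : ℝ)..x₀, ψ t ^ p * f t) +
      ∫ t in x₀..1, ψ t ^ p * f t = ∫ t in (0 : ℝ)..1, ψ t ^ p * f t := fun f hf => by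
    have h1 := (hψ.mono le_rfl hx₀.2.le).intervalIntegrable hx₀.1.le p hf
    have h2 := (hψ.mono hx₀.1.le le_rfl).intervalIntegrable hx₀.2.le p hf
    exact intervalIntegral.integral_add_adjacent_intervals h1 h2
  have hsg := hsplit g hg
  have hsh := hsplit h hh
  rw [hIg] at hsg
  rw [hIh] at hsh
  have htop : Tendsto U atTop (nhds (∫ t in (0 : ℝ)..x₀, ψ t ^ p * g t)) := by
    have := hψ.tendsto_integral_upperPart p hg x₀ y₀ (l := atTop) (S := Set.Iio x₀)
      measurableSet_Iio fun t htm htx => by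
        rcases htx.lt_or_gt with hlt | hgt
        · filter_upwards [eventually_ge_atTop (y₀ / (x₀ - t))] with k hk
          rw [div_le_iff₀ (by linarith)] at hk
          rw [Set.indicator_of_mem (show t ∈ Set.Iio x₀ from hlt)]
          exact upperPart_of_nonpos hp0 (hψ.2 t htm) (by linarith)
        · filter_upwards [eventually_ge_atTop ((ψ t - y₀) / (t - x₀))] with k hk
          rw [div_le_iff₀ (by linarith)] at hk
          rw [Set.indicator_of_notMem (show t ∉ Set.Iio x₀ from not_lt.2 hgt.le)]
          exact upperPart_of_le (hψ.2 t htm) (by linarith)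
    rwa [Set.Ioo_inter_Iio, min_eq_right hx₀.2.le, ← integral_Ioc_eq_integral_Ioo,
      ← intervalIntegral.integral_of_le hx₀.1.le] at this
  have hbot : Tendsto U atBot (nhds (∫ t in x₀..1, ψ t ^ p * g t)) := by
    have := hψ.tendsto_integral_upperPart p hg x₀ y₀ (l := atBot) (S := Set.Ioi x₀)
      measurableSet_Ioi fun t htm htx => by
        rcases htx.lt_or_gt with hlt | hgt
        · filter_upwards [eventually_le_atBot (-((ψ t - y₀) / (x₀ - t)))] with k hk
          have hk' : (ψ t - y₀) / (x₀ - t) ≤ -k := by linarith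
          rw [div_le_iff₀ (by linarith)] at hk'
          rw [Set.indicator_of_notMem (show t ∉ Set.Ioi x₀ from not_lt.2 hlt.le)]
          exact upperPart_of_le (hψ.2 t htm) (by linarith)
        · filter_upwards [eventually_le_atBot (-(y₀ / (t - x₀)))] with k hk
          have hk' : y₀ / (t - x₀) ≤ -k := by linarith
          rw [div_le_iff₀ (by linarith)] at hk'
          rw [Set.indicator_of_mem (show t ∈ Set.Ioi x₀ from hgt)]
          exact upperPart_of_nonpos hp0 (hψ.2 t htm) (by linarith)
    rwa [Set.Ioo_inter_Ioi, max_eq_right hx₀.1.le, ← integral_Ioc_eq_integral_Ioo,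
      ← intervalIntegral.integral_of_le hx₀.2.le] at this
  have hivt : ∀ k₁ k₂ : ℝ, U k₁ ≤ 0 → 0 ≤ U k₂ → False := fun k₁ k₂ h1 h2 => by
    obtain ⟨k, hk⟩ := mem_range_of_exists_le_of_exists_ge hUc ⟨k₁, h1⟩ ⟨k₂, h2⟩
    exact hU0 k hk
  rcases lt_trichotomy (∫ t in (0 : ℝ)..x₀, ψ t ^ p * g t) 0 with hG | hG | hG
  · obtain ⟨k₁, h1⟩ := (htop.eventually (gt_mem_nhds hG)).exists
    obtain ⟨k₂, h2⟩ := (hbot.eventually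
      (lt_mem_nhds (show 0 < ∫ t in x₀..1, ψ t ^ p * g t by linarith))).exists
    exact hivt k₁ k₂ h1.le h2.le
  · rcases le_total 0 (∫ t in (0 : ℝ)..x₀, ψ t ^ p * h t) with hH | hH
    · exact hx₀.2.ne (ht 0 x₀ ψ le_rfl hx₀.1 hx₀.2.le (hψ.mono le_rfl hx₀.2.le) hG.ge hH).2
    · exact hx₀.1.ne' (ht x₀ 1 ψ hx₀.1.le hx₀.2 le_rfl (hψ.mono hx₀.1.le le_rfl)
        (by linarith) (by linarith)).1
  · obtain ⟨k₁, h1⟩ := (htop.eventually (lt_mem_nhds hG)).exists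
    obtain ⟨k₂, h2⟩ := (hbot.eventually
      (gt_mem_nhds (show ∫ t in x₀..1, ψ t ^ p * g t < 0 by linarith))).exists
    exact hivt k₂ k₁ h2.le h1.le

/-- A weight for which a tight pair has nonnegative integrals is affine. -/
lemma Tight.exists_affine {p : ℕ} (hp : 1 ≤ p) {g h : ℝ → ℝ} (hg : Continuous g)
    (hh : Continuous h) (ht : Tight p g h) {ψ : ℝ → ℝ} (hψ : PosConcave 0 1 ψ)
    (hIg : 0 ≤ ∫ t in (0 : ℝ)..1, ψ t ^ p * g t) (hIh : 0 ≤ ∫ t in (0 : ℝ)..1, ψ t ^ p * h t) :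
    ∃ α β : ℝ, ∀ t ∈ Set.Ioo (0 : ℝ) 1, ψ t = α * t + β := by
  have key : ∀ u x v : ℝ, 0 < u → u < x → x < v → v < 1 →
      (v - u) * ψ x = (v - x) * ψ u + (x - u) * ψ v := by
    intro u x v hu hux hxv hv
    refine le_antisymm (ht.le_chord hp hg hh hψ hIg hIh hu hux hxv hv) ?_
    have hvu : 0 < v - u := by linarith
    have := hψ.1.2 (x := u) ⟨hu, by linarith⟩ (y := v) ⟨by linarith, hv⟩
      (show (0 : ℝ) ≤ (v - x) / (v - u) from div_nonneg (by linarith) hvu.le)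
      (show (0 : ℝ) ≤ (x - u) / (v - u) from div_nonneg (by linarith) hvu.le)
      (by field_simp; ring)
    have hx : (v - x) / (v - u) * u + (x - u) / (v - u) * v = x := by field_simp; ring
    simp only [smul_eq_mul, hx] at this
    calc _ = (v - u) * ((v - x) / (v - u) * ψ u + (x - u) / (v - u) * ψ v) := by field_simp
      _ ≤ _ := mul_le_mul_of_nonneg_left this hvu.le
  refine ⟨3 * (ψ (2 / 3) - ψ (1 / 3)), 2 * ψ (1 / 3) - ψ (2 / 3), fun t htm => ?_⟩
  rcases lt_trichotomy t (1 / 3) with h1 | rfl | h1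
  · have := key t (1 / 3) (2 / 3) htm.1 h1 (by norm_num) (by norm_num)
    linarith
  · ring
  rcases lt_trichotomy t (2 / 3) with h2 | rfl | h2
  · have := key (1 / 3) t (2 / 3) (by norm_num) h1 h2 (by norm_num)
    linarith
  · ring
  · have := key (1 / 3) (2 / 3) t (by norm_num) (by norm_num) h2 htm.2
    linarith

lemma PosConcave.integral_normalize {c d : ℝ} {φ : ℝ → ℝ} (hcd : c < d) (p : ℕ)
    (g : ℝ → ℝ) :
    ∫ s in (0 : ℝ)..1, ((φ ((c + d) / 2))⁻¹ * φ (c + s * (d - c))) ^ p * g (c + s * (d - c)) =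
      ((φ ((c + d) / 2))⁻¹) ^ p * (d - c)⁻¹ * ∫ t in c..d, φ t ^ p * g t := by
  have h := intervalIntegral.integral_comp_add_mul (a := 0) (b := 1)
    (fun t => φ t ^ p * g t) (sub_pos.2 hcd).ne' c
  simp only [mul_zero, add_zero, mul_one, add_sub_cancel, smul_eq_mul] at h
  rw [mul_assoc, ← h, ← intervalIntegral.integral_const_mul]
  refine intervalIntegral.integral_congr fun s _ => ?_
  simp only [mul_comm s (d - c)]
  ring

/-- The parameters of the subintervals of `[0, 1]` on which some concave weight gives `g` and `h`
nonnegative integrals. -/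
def needleSet (p : ℕ) (g h : ℝ → ℝ) : Set (ℝ × ℝ) :=
  {x | 0 ≤ x.1 ∧ x.1 ≤ x.2 ∧ x.2 ≤ 1 ∧ ∃ ψ, NormalizedConcave ψ ∧
    0 ≤ ∫ s in (0 : ℝ)..1, ψ s ^ p * g (x.1 + s * (x.2 - x.1)) ∧
    0 ≤ ∫ s in (0 : ℝ)..1, ψ s ^ p * h (x.1 + s * (x.2 - x.1))}

lemma add_mul_sub_mem_Icc {a b s : ℝ} (ha : 0 ≤ a) (hab : a ≤ b) (hb : b ≤ 1)
    (hs : s ∈ Set.Icc (0 : ℝ) 1) : a + s * (b - a) ∈ Set.Icc (0 : ℝ) 1 :=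
  ⟨add_nonneg ha (mul_nonneg hs.1 (sub_nonneg.2 hab)), by nlinarith [hs.1, hs.2]⟩

lemma mem_needleSet {p : ℕ} {g h : ℝ → ℝ} {c d : ℝ} {φ : ℝ → ℝ} (hc : 0 ≤ c) (hcd : c < d)
    (hd : d ≤ 1) (hφ : PosConcave c d φ) (hIg : 0 ≤ ∫ t in c..d, φ t ^ p * g t)
    (hIh : 0 ≤ ∫ t in c..d, φ t ^ p * h t) : (c, d) ∈ needleSet p g h := by
  have hpos : 0 ≤ ((φ ((c + d) / 2))⁻¹) ^ p * (d - c)⁻¹ := by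
    have := hφ.2 ((c + d) / 2) ⟨by linarith, by linarith⟩
    have := sub_pos.2 hcd
    positivity
  refine ⟨hc, hcd.le, hd, _, hφ.normalize hcd, ?_, ?_⟩
  · rw [PosConcave.integral_normalize hcd]
    exact mul_nonneg hpos hIg
  · rw [PosConcave.integral_normalize hcd]
    exact mul_nonneg hpos hIh

lemma isCompact_needleSet (p : ℕ) {g h : ℝ → ℝ} (hg : Continuous g) (hh : Continuous h) :
    IsCompact (needleSet p g h) := by
  have hsub : needleSet p g h ⊆ Set.Icc (0 : ℝ) 1 ×ˢ Set.Icc (0 : ℝ) 1 := fun x hx =>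
    ⟨⟨hx.1, hx.2.1.trans hx.2.2.1⟩, ⟨hx.1.trans hx.2.1, hx.2.2.1⟩⟩
  refine (isCompact_Icc.prod isCompact_Icc).of_isClosed_subset ?_ hsub
  refine IsSeqClosed.isClosed fun x y hx hxy => ?_
  choose h0 h01 h1 ψ hψ hψg hψh using hx
  obtain ⟨σ, ψ', hσ, hψ', hlim⟩ := NormalizedConcave.exists_subseq hψ
  have hxy' := hxy.comp hσ.tendsto_atTop
  have hx1 : Tendsto (fun i => (x (σ i)).1) atTop (nhds y.1) :=
    (continuous_fst.tendsto y).comp hxy'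
  have hx2 : Tendsto (fun i => (x (σ i)).2) atTop (nhds y.2) :=
    (continuous_snd.tendsto y).comp hxy'
  have key : ∀ f : ℝ → ℝ, Continuous f →
      (∀ i, 0 ≤ ∫ s in (0 : ℝ)..1, ψ i s ^ p * f ((x i).1 + s * ((x i).2 - (x i).1))) →
      0 ≤ ∫ s in (0 : ℝ)..1, ψ' s ^ p * f (y.1 + s * (y.2 - y.1)) := by
    intro f hf hpos
    obtain ⟨M, hM⟩ := isCompact_Icc.exists_bound_of_continuousOn (s := Set.Icc (0 : ℝ) 1)
      hf.continuousOn
    refine ge_of_tendsto' (NormalizedConcave.tendsto_integral p (fun i => hψ (σ i)) hlim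
      (F := fun i s => f ((x (σ i)).1 + s * ((x (σ i)).2 - (x (σ i)).1)))
      (F' := fun s => f (y.1 + s * (y.2 - y.1))) (M := M) (fun i => by fun_prop)
      (fun i s hs => hM _ (add_mul_sub_mem_Icc (h0 _) (h01 _) (h1 _) hs)) fun s hs => ?_)
      fun i => hpos (σ i)
    exact (hf.tendsto _).comp (hx1.add (tendsto_const_nhds.mul (hx2.sub hx1)))
  exact ⟨ge_of_tendsto' hx1 fun i => h0 _, le_of_tendsto_of_tendsto' hx1 hx2 fun i => h01 _,
    le_of_tendsto' hx2 fun i => h1 _, ψ', hψ', key g hg hψg, key h hh hψh⟩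

lemma PosConcave.integral_pow_pos {ψ : ℝ → ℝ} (hψ : PosConcave 0 1 ψ) (p : ℕ) :
    0 < ∫ s in (0 : ℝ)..1, ψ s ^ p := by
  refine intervalIntegral.intervalIntegral_pos_of_pos_on ?_
    (fun x hx => pow_pos (hψ.2 x hx) p) zero_lt_one
  simpa using hψ.intervalIntegrable zero_le_one p (g := fun _ => 1) continuous_const

/-- One-dimensional localization: a concave weight can be replaced by an affine one on a
subinterval. -/
theorem PosConcave.exists_affine {p : ℕ} (hp : 1 ≤ p) {g h : ℝ → ℝ} (hg : Continuous g)
    (hh : Continuous h) {ψ : ℝ → ℝ} (hψ : PosConcave 0 1 ψ)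
    (hIg : 0 ≤ ∫ t in (0 : ℝ)..1, ψ t ^ p * g t) (hIh : 0 ≤ ∫ t in (0 : ℝ)..1, ψ t ^ p * h t) :
    ∃ a ∈ Set.Icc (0 : ℝ) 1, ∃ b ∈ Set.Icc (0 : ℝ) 1, ∃ α β : ℝ,
      (∀ t ∈ Set.Icc (0 : ℝ) 1, 0 ≤ α * t + β) ∧
      0 ≤ ∫ t in (0 : ℝ)..1, (α * t + β) ^ p * g (a + t * (b - a)) ∧
      0 ≤ ∫ t in (0 : ℝ)..1, (α * t + β) ^ p * h (a + t * (b - a)) ∧ 0 < α / 2 + β := by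
  obtain ⟨⟨a, b⟩, ⟨h0, h01, h1, χ, hχ, hχg, hχh⟩, hmin⟩ :=
    (isCompact_needleSet p hg hh).exists_isMinOn
      ⟨_, mem_needleSet le_rfl zero_lt_one le_rfl hψ hIg hIh⟩
      (f := fun x : ℝ × ℝ => x.2 - x.1) (by fun_prop)
  simp only at h0 h01 h1 hχg hχh
  refine ⟨a, ⟨h0, h01.trans h1⟩, b, ⟨h0.trans h01, h1⟩, ?_⟩
  rcases h01.eq_or_lt with rfl | hab
  · refine ⟨0, 1, fun t _ => by norm_num, ?_, ?_, by norm_num⟩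
    · simp only [sub_self, mul_zero, add_zero, intervalIntegral.integral_mul_const] at hχg
      simpa using nonneg_of_mul_nonneg_right hχg (hχ.1.integral_pow_pos p)
    · simp only [sub_self, mul_zero, add_zero, intervalIntegral.integral_mul_const] at hχh
      simpa using nonneg_of_mul_nonneg_right hχh (hχ.1.integral_pow_pos p)
  have hba : 0 < b - a := sub_pos.2 hab
  have ht : Tight p (fun s => g (a + s * (b - a))) (fun s => h (a + s * (b - a))) := by
    intro c d φ hc hcd hd hφ hφg hφh
    obtain ⟨-, -, -, ω, hω, hωg, hωh⟩ := mem_needleSet hc hcd hd hφ hφg hφh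
    have hmem : (a + c * (b - a), a + d * (b - a)) ∈ needleSet p g h := by
      refine ⟨(add_mul_sub_mem_Icc h0 h01 h1 ⟨hc, hcd.le.trans hd⟩).1, by simp; gcongr,
        (add_mul_sub_mem_Icc h0 h01 h1 ⟨hc.trans hcd.le, hd⟩).2, ω, hω, ?_, ?_⟩
      · convert hωg using 5; ring
      · convert hωh using 5; ring
    have : b - a ≤ a + d * (b - a) - (a + c * (b - a)) := hmin hmem
    have h2 : (1 - (d - c)) * (b - a) ≤ 0 := by linarith
    have h3 : 1 - (d - c) ≤ 0 := nonpos_of_mul_nonpos_left h2 hba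
    exact ⟨by linarith, by linarith⟩
  obtain ⟨α, β, haff⟩ := ht.exists_affine hp (by fun_prop) (by fun_prop) hχ.1 hχg hχh
  have hcl : Set.Icc (0 : ℝ) 1 ⊆ {t | 0 ≤ α * t + β} := by
    rw [← closure_Ioo zero_ne_one]
    refine closure_minimal (fun t ht => ?_) (isClosed_le continuous_const (by fun_prop))
    simpa [← haff t ht] using (hχ.1.2 t ht).le
  have hI : ∀ F : ℝ → ℝ, ∫ t in (0 : ℝ)..1, χ t ^ p * F t =
      ∫ t in (0 : ℝ)..1, (α * t + β) ^ p * F t := fun F => by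
    simp only [intervalIntegral.integral_of_le zero_le_one, integral_Ioc_eq_integral_Ioo]
    exact setIntegral_congr_fun measurableSet_Ioo fun t ht => by simp only [haff t ht]
  refine ⟨α, β, fun t ht => hcl ht, by rw [← hI]; exact hχg, by rw [← hI]; exact hχh, ?_⟩
  have := haff (1 / 2) ⟨by norm_num, by norm_num⟩
  rw [hχ.2] at this
  linarith

/-- The signed distance of `x` from the line through `q` with normal direction `θ`. -/
def lineDist (q : ℝ × ℝ) (θ : ℝ) (x : ℝ × ℝ) : ℝ :=
  cos θ * (x.1 - q.1) + sin θ * (x.2 - q.2)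

@[fun_prop]
lemma continuous_lineDist (q : ℝ × ℝ) (θ : ℝ) : Continuous (lineDist q θ) := by
  unfold lineDist; fun_prop

lemma volume_lineDist_eq_zero (q : ℝ × ℝ) (θ : ℝ) :
    volume {x : ℝ × ℝ | lineDist q θ x = 0} = 0 := by
  set L : ℝ × ℝ →ₗ[ℝ] ℝ := cos θ • LinearMap.fst ℝ ℝ ℝ + sin θ • LinearMap.snd ℝ ℝ ℝ with hL
  have hne : L.ker ≠ ⊤ := by
    intro h
    have : L (cos θ, sin θ) = 0 := LinearMap.mem_ker.1 (h ▸ Submodule.mem_top)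
    simp only [hL, LinearMap.add_apply, LinearMap.smul_apply, LinearMap.fst_apply,
      LinearMap.snd_apply, smul_eq_mul] at this
    nlinarith [sin_sq_add_cos_sq θ]
  have hset : {x : ℝ × ℝ | lineDist q θ x = 0} = (fun x => x + -q) ⁻¹' (L.ker : Set (ℝ × ℝ)) := by
    ext x
    simp [hL, lineDist, sub_eq_add_neg]
  rw [hset, measure_preimage_add_right, Measure.addHaar_submodule _ _ hne]

lemma ae_lineDist_ne_zero (q : ℝ × ℝ) (θ : ℝ) (Q : Set (ℝ × ℝ)) :
    ∀ᵐ x ∂(volume.restrict Q), lineDist q θ x ≠ 0 :=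
  ae_restrict_of_ae (measure_eq_zero_iff_ae_notMem.1 (volume_lineDist_eq_zero q θ))

lemma sign_mul_eq_indicator (G : ℝ × ℝ → ℝ) {q x : ℝ × ℝ} {θ : ℝ} (hx : lineDist q θ x ≠ 0) :
    Real.sign (lineDist q θ x) * G x = {x | 0 ≤ lineDist q θ x}.indicator G x -
      {x | lineDist q θ x ≤ 0}.indicator G x := by
  rcases hx.lt_or_gt with h | h
  · simp [Real.sign_of_neg h, h.le, not_le.2 h, Set.indicator]
  · simp [Real.sign_of_pos h, h.le, not_le.2 h, Set.indicator]

lemma eq_indicator_add_indicator (G : ℝ × ℝ → ℝ) {q x : ℝ × ℝ} {θ : ℝ}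
    (hx : lineDist q θ x ≠ 0) :
    G x = {x | 0 ≤ lineDist q θ x}.indicator G x + {x | lineDist q θ x ≤ 0}.indicator G x := by
  rcases hx.lt_or_gt with h | h
  · simp [h.le, not_le.2 h, Set.indicator]
  · simp [h.le, not_le.2 h, Set.indicator]

lemma integral_sign_lineDist {G : ℝ × ℝ → ℝ} {Q : Set (ℝ × ℝ)} (hG : IntegrableOn G Q)
    (q : ℝ × ℝ) (θ : ℝ) :
    ∫ x in Q, Real.sign (lineDist q θ x) * G x =
      (∫ x in Q ∩ {x | 0 ≤ lineDist q θ x}, G x) -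
        ∫ x in Q ∩ {x | lineDist q θ x ≤ 0}, G x := by
  have h1 : MeasurableSet {x | 0 ≤ lineDist q θ x} :=
    (isClosed_le continuous_const (continuous_lineDist q θ)).measurableSet
  have h2 : MeasurableSet {x | lineDist q θ x ≤ 0} :=
    (isClosed_le (continuous_lineDist q θ) continuous_const).measurableSet
  rw [← setIntegral_indicator h1, ← setIntegral_indicator h2,
    ← integral_sub (hG.indicator h1) (hG.indicator h2)]
  exact integral_congr_ae ((ae_lineDist_ne_zero q θ Q).mono fun x hx => sign_mul_eq_indicator G hx)

lemma integral_inter_lineDist_add {G : ℝ × ℝ → ℝ} {Q : Set (ℝ × ℝ)} (hG : IntegrableOn G Q)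
    (q : ℝ × ℝ) (θ : ℝ) :
    (∫ x in Q ∩ {x | 0 ≤ lineDist q θ x}, G x) + ∫ x in Q ∩ {x | lineDist q θ x ≤ 0}, G x =
      ∫ x in Q, G x := by
  have h1 : MeasurableSet {x | 0 ≤ lineDist q θ x} :=
    (isClosed_le continuous_const (continuous_lineDist q θ)).measurableSet
  have h2 : MeasurableSet {x | lineDist q θ x ≤ 0} :=
    (isClosed_le (continuous_lineDist q θ) continuous_const).measurableSet
  rw [← setIntegral_indicator h1, ← setIntegral_indicator h2,
    ← integral_add (hG.indicator h1) (hG.indicator h2)]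
  exact integral_congr_ae ((ae_lineDist_ne_zero q θ Q).mono fun x hx =>
    (eq_indicator_add_indicator G hx).symm)

lemma measurable_real_sign : Measurable Real.sign := by
  unfold Real.sign
  exact Measurable.ite measurableSet_Iio measurable_const
    (Measurable.ite measurableSet_Ioi measurable_const measurable_const)

lemma continuousAt_real_sign {x : ℝ} (hx : x ≠ 0) : ContinuousAt Real.sign x := by
  rcases hx.lt_or_gt with h | h
  · exact continuousAt_const.congr ((gt_mem_nhds h).mono fun y hy => (Real.sign_of_neg hy).symm)
  · exact continuousAt_const.congr ((lt_mem_nhds h).mono fun y hy => (Real.sign_of_pos hy).symm)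

lemma abs_real_sign_le (x : ℝ) : |Real.sign x| ≤ 1 := by
  rcases Real.sign_apply_eq x with h | h | h <;> simp [h]

lemma continuous_integral_sign_lineDist {G : ℝ × ℝ → ℝ} {Q : Set (ℝ × ℝ)}
    (hG : IntegrableOn G Q) (q : ℝ × ℝ) :
    Continuous fun θ => ∫ x in Q, Real.sign (lineDist q θ x) * G x := by
  refine continuous_iff_continuousAt.2 fun θ => continuousAt_of_dominated
    (bound := fun x => |G x|) (Eventually.of_forall fun θ => ?_)
    (Eventually.of_forall fun θ => Eventually.of_forall fun x => ?_) hG.abs ?_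
  · exact (measurable_real_sign.comp
      (continuous_lineDist q θ).measurable).aestronglyMeasurable.mul hG.aestronglyMeasurable
  · rw [norm_mul, Real.norm_eq_abs, Real.norm_eq_abs]
    exact mul_le_of_le_one_left (abs_nonneg _) (abs_real_sign_le _)
  · filter_upwards [ae_lineDist_ne_zero q θ Q] with x hx
    refine ContinuousAt.mul ?_ continuousAt_const
    exact ContinuousAt.comp (f := fun θ => lineDist q θ x) (continuousAt_real_sign hx)
      (by unfold lineDist; fun_prop)

lemma exists_halving (G : ℝ × ℝ → ℝ) {Q : Set (ℝ × ℝ)} (hG : IntegrableOn G Q) (q : ℝ × ℝ) :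
    ∃ θ, ∫ x in Q, Real.sign (lineDist q θ x) * G x = 0 := by
  set A : ℝ → ℝ := fun θ => ∫ x in Q, Real.sign (lineDist q θ x) * G x with hA
  have hodd : A π = -A 0 := by
    simp only [hA]
    rw [← integral_neg]
    refine integral_congr_ae (Eventually.of_forall fun x => ?_)
    have : lineDist q π x = -lineDist q 0 x := by simp [lineDist]
    simp only [this, Real.sign_neg, neg_mul]
  have hc := continuous_integral_sign_lineDist hG q
  rcases le_total (A 0) 0 with h | h
  · exact mem_range_of_exists_le_of_exists_ge hc ⟨0, h⟩ ⟨π, by change 0 ≤ A π; linarith⟩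
  · exact mem_range_of_exists_le_of_exists_ge hc ⟨π, by change A π ≤ 0; linarith⟩ ⟨0, h⟩

/-- Compact convex sets on which both `G` and `H` have positive integral. -/
def IsGoodBody (G H : ℝ × ℝ → ℝ) (Q : Set (ℝ × ℝ)) : Prop :=
  IsCompact Q ∧ Convex ℝ Q ∧ 0 < (∫ x in Q, G x) ∧ 0 < ∫ x in Q, H x

lemma notMem_interior_of_lineDist_nonneg {q : ℝ × ℝ} {θ : ℝ} {S : Set (ℝ × ℝ)}
    (hS : S ⊆ {x | 0 ≤ lineDist q θ x}) : q ∉ interior S := by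
  intro hq
  have hcont : Continuous fun r : ℝ => q - r • (cos θ, sin θ) := by fun_prop
  have hev : ∀ᶠ r in nhds (0 : ℝ), q - r • (cos θ, sin θ) ∈ S :=
    hcont.continuousAt (by simpa using mem_interior_iff_mem_nhds.1 hq)
  obtain ⟨r, hr, hr0⟩ := ((hev.filter_mono nhdsWithin_le_nhds).and
    (self_mem_nhdsWithin (a := (0 : ℝ)) (s := Set.Ioi 0))).exists
  have := hS hr
  have hr0' : 0 < r := hr0
  simp only [lineDist, Set.mem_ofPred_eq, Prod.fst_sub, Prod.snd_sub, Prod.smul_fst,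
    Prod.smul_snd, smul_eq_mul] at this
  nlinarith [sin_sq_add_cos_sq θ]

lemma lineDist_add_pi (q : ℝ × ℝ) (θ : ℝ) (x : ℝ × ℝ) :
    lineDist q (θ + π) x = -lineDist q θ x := by
  simp [lineDist]; ring

lemma convex_lineDist_nonneg (q : ℝ × ℝ) (θ : ℝ) : Convex ℝ {x | 0 ≤ lineDist q θ x} := by
  intro x hx y hy a b ha hb hab
  simp only [Set.mem_ofPred_eq] at hx hy ⊢
  have : lineDist q θ (a • x + b • y) = a * lineDist q θ x + b * lineDist q θ y := by
    simp only [lineDist, Prod.fst_add, Prod.snd_add, Prod.smul_fst, Prod.smul_snd, smul_eq_mul]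
    linear_combination (cos θ * q.1 + sin θ * q.2) * hab
  rw [this]
  positivity

/-- Bisection: a good body contains a good body avoiding a given point in its interior. -/
lemma IsGoodBody.exists_cut {G H : ℝ × ℝ → ℝ} (hG : Continuous G) (hH : Continuous H)
    {Q : Set (ℝ × ℝ)} (hQ : IsGoodBody G H Q) (q : ℝ × ℝ) :
    ∃ Q' ⊆ Q, IsGoodBody G H Q' ∧ q ∉ interior Q' := by
  obtain ⟨hc, hconv, hGpos, hHpos⟩ := hQ
  have hGi := hG.continuousOn.integrableOn_compact (μ := volume) hc
  have hHi := hH.continuousOn.integrableOn_compact (μ := volume) hc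
  obtain ⟨θ, hθ⟩ := exists_halving G hGi q
  rw [integral_sign_lineDist hGi] at hθ
  have hGadd := integral_inter_lineDist_add hGi q θ
  have hHadd := integral_inter_lineDist_add hHi q θ
  have hbody : ∀ θ, IsCompact (Q ∩ {x | 0 ≤ lineDist q θ x}) ∧
      Convex ℝ (Q ∩ {x | 0 ≤ lineDist q θ x}) := fun θ =>
    ⟨hc.inter_right (isClosed_le continuous_const (continuous_lineDist q θ)),
      hconv.inter (convex_lineDist_nonneg q θ)⟩
  rcases lt_or_ge 0 (∫ x in Q ∩ {x | 0 ≤ lineDist q θ x}, H x) with hpos | hneg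
  · exact ⟨_, Set.inter_subset_left, ⟨(hbody θ).1, (hbody θ).2, by linarith, hpos⟩,
      notMem_interior_of_lineDist_nonneg Set.inter_subset_right⟩
  · have hset : {x | lineDist q θ x ≤ 0} = {x | 0 ≤ lineDist q (θ + π) x} := by
      ext x
      simp [lineDist_add_pi]
    rw [hset] at hθ hGadd hHadd
    exact ⟨_, Set.inter_subset_left, ⟨(hbody (θ + π)).1, (hbody (θ + π)).2, by linarith,
      by linarith⟩, notMem_interior_of_lineDist_nonneg Set.inter_subset_right⟩

lemma IsGoodBody.nonempty {G H : ℝ × ℝ → ℝ} {Q : Set (ℝ × ℝ)} (hQ : IsGoodBody G H Q) :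
    Q.Nonempty := by
  by_contra h
  rw [Set.not_nonempty_iff_eq_empty] at h
  simpa [h] using hQ.2.2.1

lemma IsGoodBody.exists_seq {G H : ℝ × ℝ → ℝ} (hG : Continuous G) (hH : Continuous H)
    {Q₀ : Set (ℝ × ℝ)} (hQ₀ : IsGoodBody G H Q₀) :
    ∃ Q : ℕ → Set (ℝ × ℝ), Antitone Q ∧ (∀ i, IsGoodBody G H (Q i)) ∧ Q 0 = Q₀ ∧
      interior (⋂ i, Q i) = ∅ := by
  choose cut hsub hgood hnot using fun (Q : {Q // IsGoodBody G H Q}) (q : ℝ × ℝ) =>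
    Q.2.exists_cut hG hH q
  let Q : ℕ → {Q // IsGoodBody G H Q} := fun i => Nat.rec ⟨Q₀, hQ₀⟩
    (fun i R => ⟨cut R (TopologicalSpace.denseSeq (ℝ × ℝ) i), hgood _ _⟩) i
  refine ⟨fun i => (Q i).1, antitone_nat_of_succ_le fun i => hsub (Q i) _, fun i => (Q i).2, rfl,
    ?_⟩
  by_contra hne
  obtain ⟨i, hi⟩ := (TopologicalSpace.denseRange_denseSeq (ℝ × ℝ)).exists_mem_open
    isOpen_interior (Set.nonempty_iff_ne_empty.2 hne)
  exact hnot (Q i) _ (interior_mono (Set.iInter_subset _ (i + 1)) hi)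

lemma exists_line_of_interior_eq_empty {S : Set (ℝ × ℝ)} (hS : Convex ℝ S) (hne : S.Nonempty)
    (hintegr : interior S = ∅) :
    ∃ u v r : ℝ, (u ≠ 0 ∨ v ≠ 0) ∧ ∀ x ∈ S, u * x.1 + v * x.2 = r := by
  have hspan : affineSpan ℝ S ≠ ⊤ := fun h =>
    ((hS.interior_nonempty_iff_affineSpan_eq_top).2 h).ne_empty hintegr
  obtain ⟨x₀, hx₀⟩ := hne
  have hdir : (affineSpan ℝ S).direction < ⊤ := lt_top_iff_ne_top.2 fun h => hspan
    ((AffineSubspace.direction_eq_top_iff_of_nonempty ⟨x₀, subset_affineSpan ℝ S hx₀⟩).1 h)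
  obtain ⟨f, hf, hle⟩ := Submodule.exists_le_ker_of_lt_top _ hdir
  have hfx : ∀ x : ℝ × ℝ, f x = f (1, 0) * x.1 + f (0, 1) * x.2 := fun x => by
    have : x = x.1 • ((1, 0) : ℝ × ℝ) + x.2 • ((0, 1) : ℝ × ℝ) := by ext <;> simp
    conv_lhs => rw [this]
    rw [map_add, map_smul, map_smul, smul_eq_mul, smul_eq_mul]
    ring
  refine ⟨f (1, 0), f (0, 1), f x₀, ?_, fun x hx => ?_⟩
  · by_contra! h
    exact hf (LinearMap.ext fun x => by rw [hfx x, h.1, h.2]; simp)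
  · rw [← hfx, ← sub_eq_zero, ← map_sub]
    exact LinearMap.mem_ker.1 (hle (AffineSubspace.vsub_mem_direction
      (subset_affineSpan ℝ S hx) (subset_affineSpan ℝ S hx₀)))

/-- The marginal of a planar compact convex set is a concave density. -/
lemma exists_concave_marginal {Q : Set (ℝ × ℝ)} (hc : IsCompact Q) (hconv : Convex ℝ Q)
    (hne : Q.Nonempty) :
    ∃ (a b : ℝ) (φ : ℝ → ℝ), a ≤ b ∧ Prod.fst '' Q = Set.Icc a b ∧
      ConcaveOn ℝ (Set.Icc a b) φ ∧ (∀ t ∈ Set.Icc a b, 0 ≤ φ t) ∧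
      ∀ F : ℝ → ℝ, Continuous F → ∫ x in Q, F x.1 = ∫ t in a..b, φ t * F t := by
  have hTc : IsCompact (Prod.fst '' Q) := hc.image continuous_fst
  have hTconv : Convex ℝ (Prod.fst '' Q) := hconv.linear_image (LinearMap.fst ℝ ℝ ℝ)
  have hT := eq_Icc_csInf_csSup_of_connected_bdd_closed
    ⟨hne.image _, hTconv.isPreconnected⟩ hTc.bddBelow hTc.bddAbove hTc.isClosed
  set a := sInf (Prod.fst '' Q)
  set b := sSup (Prod.fst '' Q)
  have hab : a ≤ b := by
    rw [← Set.nonempty_Icc, ← hT]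
    exact hne.image _
  let fib : ℝ → Set ℝ := fun t => {y | (t, y) ∈ Q}
  have hfc : ∀ t, IsCompact (fib t) := fun t => by
    have : fib t = Prod.snd '' (Q ∩ {x | x.1 = t}) := by
      ext y
      simp [fib]
    rw [this]
    exact (hc.inter_right (isClosed_eq continuous_fst continuous_const)).image continuous_snd
  have hcomb : ∀ t y t' y' r s : ℝ, y ∈ fib t → y' ∈ fib t' → 0 ≤ r → 0 ≤ s → r + s = 1 →
      r * y + s * y' ∈ fib (r * t + s * t') := fun t y t' y' r s hy hy' hr hs hrs => by
    simpa [fib] using hconv hy hy' hr hs hrs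
  have hfconv : ∀ t, Convex ℝ (fib t) := fun t y hy y' hy' r s hr hs hrs => by
    have := hcomb t y t y' r s hy hy' hr hs hrs
    rwa [← add_mul, hrs, one_mul] at this
  have hfne : ∀ t ∈ Set.Icc a b, (fib t).Nonempty := fun t ht => by
    rw [← hT] at ht
    obtain ⟨x, hx, rfl⟩ := ht
    exact ⟨x.2, hx⟩
  have hlo : ∀ t ∈ Set.Icc a b, sInf (fib t) ∈ fib t := fun t ht => (hfc t).sInf_mem (hfne t ht)
  have hhi : ∀ t ∈ Set.Icc a b, sSup (fib t) ∈ fib t := fun t ht => (hfc t).sSup_mem (hfne t ht)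
  have hle : ∀ t ∈ Set.Icc a b, sInf (fib t) ≤ sSup (fib t) := fun t ht =>
    csInf_le (hfc t).bddBelow (hhi t ht)
  refine ⟨a, b, fun t => sSup (fib t) - sInf (fib t), hab, hT, ⟨convex_Icc _ _, ?_⟩,
    fun t ht => sub_nonneg.2 (hle t ht), fun F hF => ?_⟩
  · intro t ht t' ht' r s hr hs hrs
    have h1 := le_csSup (hfc _).bddAbove (hcomb t _ t' _ r s (hhi t ht) (hhi t' ht') hr hs hrs)
    have h2 := csInf_le (hfc _).bddBelow (hcomb t _ t' _ r s (hlo t ht) (hlo t' ht') hr hs hrs)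
    simp only [smul_eq_mul]
    linarith
  · have hi : Integrable (Q.indicator fun x : ℝ × ℝ => F x.1) (volume.prod volume) := by
      rw [← Measure.volume_eq_prod, integrable_indicator_iff hc.measurableSet]
      exact (by fun_prop : Continuous fun x : ℝ × ℝ => F x.1).continuousOn.integrableOn_compact hc
    rw [← integral_indicator hc.measurableSet, Measure.volume_eq_prod, integral_prod _ hi,
      intervalIntegral.integral_of_le hab, ← integral_Icc_eq_integral_Ioc,
      ← integral_indicator measurableSet_Icc]
    refine integral_congr_ae (Eventually.of_forall fun t => ?_)
    have hind : (fun y => Q.indicator (fun x : ℝ × ℝ => F x.1) (t, y)) =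
        (fib t).indicator fun _ => F t := by
      ext y
      simp [Set.indicator, fib]
    simp only
    rw [hind, integral_indicator (hfc t).measurableSet, setIntegral_const, smul_eq_mul]
    by_cases ht : t ∈ Set.Icc a b
    · rw [Set.indicator_of_mem ht]
      congr 1
      rw [eq_Icc_csInf_csSup_of_connected_bdd_closed
        ⟨hfne t ht, (hfconv t).isPreconnected⟩ (hfc t).bddBelow (hfc t).bddAbove (hfc t).isClosed,
        Real.volume_real_Icc_of_le (hle t ht), csSup_Icc (hle t ht), csInf_Icc (hle t ht)]
    · rw [Set.indicator_of_notMem ht]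
      have : fib t = ∅ := by
        by_contra hne'
        obtain ⟨y, hy⟩ := Set.nonempty_iff_ne_empty.2 hne'
        exact ht (hT ▸ ⟨(t, y), hy, rfl⟩)
      simp [this]

lemma exists_normalizedConcave_of_integral_fst_pos {Q : Set (ℝ × ℝ)} (hc : IsCompact Q)
    (hconv : Convex ℝ Q) {F K : ℝ → ℝ} (hF : Continuous F) (hK : Continuous K)
    (hFpos : 0 < ∫ x in Q, F x.1) (hKpos : 0 < ∫ x in Q, K x.1) :
    ∃ P ∈ Q, ∃ P' ∈ Q, ∃ ψ : ℝ → ℝ, NormalizedConcave ψ ∧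
      0 ≤ (∫ s in (0 : ℝ)..1, ψ s ^ 1 * F (P.1 + s * (P'.1 - P.1))) ∧
      0 ≤ ∫ s in (0 : ℝ)..1, ψ s ^ 1 * K (P.1 + s * (P'.1 - P.1)) := by
  have hne : Q.Nonempty := by
    by_contra h
    rw [Set.not_nonempty_iff_eq_empty] at h
    simp [h] at hFpos
  obtain ⟨a, b, φ, hab, hT, hφ, hφ0, hintegr⟩ := exists_concave_marginal hc hconv hne
  have ha : a ∈ Prod.fst '' Q := hT ▸ Set.left_mem_Icc.2 hab
  have hb : b ∈ Prod.fst '' Q := hT ▸ Set.right_mem_Icc.2 hab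
  obtain ⟨P, hP, rfl⟩ := ha
  obtain ⟨P', hP', rfl⟩ := hb
  rw [hintegr F hF] at hFpos
  rw [hintegr K hK] at hKpos
  have hlt : P.1 < P'.1 := by
    refine hab.lt_of_ne fun h => ?_
    simp [h] at hFpos
  have hφc : PosConcave P.1 P'.1 φ := by
    have hφ' := hφ.subset Set.Ioo_subset_Icc_self (convex_Ioo _ _)
    have h0' : ∀ t ∈ Set.Ioo P.1 P'.1, 0 ≤ φ t := fun t ht => hφ0 t (Set.Ioo_subset_Icc_self ht)
    obtain ⟨y, hy, hypos⟩ : ∃ y ∈ Set.Ioo P.1 P'.1, 0 < φ y := by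
      by_contra! hcon
      refine hFpos.ne' ?_
      rw [intervalIntegral.integral_of_le hab, integral_Ioc_eq_integral_Ioo]
      refine setIntegral_eq_zero_of_forall_eq_zero fun t ht => ?_
      rw [le_antisymm (hcon t ht) (h0' t ht), zero_mul]
    exact ⟨hφ', hφ'.pos_of_nonneg_of_pos h0' hy hypos⟩
  have hmid := hφc.2 ((P.1 + P'.1) / 2) ⟨by linarith, by linarith⟩
  have hd := sub_pos.2 hlt
  refine ⟨P, hP, P', hP', _, hφc.normalize hlt, ?_, ?_⟩
  · rw [PosConcave.integral_normalize hlt]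
    simp only [pow_one]
    positivity
  · rw [PosConcave.integral_normalize hlt]
    simp only [pow_one]
    positivity

/-- If good bodies shrink to a subset of the graph of an affine function, a concave needle
appears in the limit. -/
lemma exists_needle_of_graph {G H : ℝ × ℝ → ℝ} (hG : Continuous G) (hH : Continuous H)
    {Q : ℕ → Set (ℝ × ℝ)} (hanti : Antitone Q) (hQ : ∀ i, IsGoodBody G H (Q i)) {κ c : ℝ}
    (hline : ∀ x ∈ ⋂ i, Q i, x.2 = κ * x.1 + c) :
    ∃ P ∈ Q 0, ∃ P' ∈ Q 0, ∃ ψ : ℝ → ℝ, NormalizedConcave ψ ∧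
      0 ≤ (∫ s in (0 : ℝ)..1, ψ s ^ 1 * G (P + s • (P' - P))) ∧
      0 ≤ ∫ s in (0 : ℝ)..1, ψ s ^ 1 * H (P + s • (P' - P)) := by
  let ε : ℕ → ℝ := fun j => 1 / ((j : ℝ) + 1)
  have hε : ∀ j, 0 < ε j := fun j => Nat.one_div_pos_of_nat
  have hε1 : ∀ j, ε j ≤ 1 := fun j => by
    simp only [ε]
    rw [div_le_one (by positivity)]
    linarith [Nat.cast_nonneg (α := ℝ) j]
  have hεlim : Tendsto ε atTop (nhds 0) := tendsto_one_div_add_atTop_nhds_zero_nat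
  let L : ℝ → ℝ × ℝ := fun t => (t, κ * t + c)
  have hL : Continuous L := by fun_prop
  have hLx : ∀ x ∈ ⋂ i, Q i, L x.1 = x := fun x hx => Prod.ext rfl (hline x hx).symm
  have step : ∀ j, ∃ P ∈ Q j, ∃ P' ∈ Q j, ∃ ψ : ℝ → ℝ, NormalizedConcave ψ ∧
      0 ≤ (∫ s in (0 : ℝ)..1, ψ s ^ 1 * (G (L (P.1 + s * (P'.1 - P.1))) + ε j)) ∧
      0 ≤ ∫ s in (0 : ℝ)..1, ψ s ^ 1 * (H (L (P.1 + s * (P'.1 - P.1))) + ε j) := by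
    intro j
    let U : Set (ℝ × ℝ) := {x | G x < G (L x.1) + ε j} ∩ {x | H x < H (L x.1) + ε j}
    have hU : IsOpen U := (isOpen_lt hG (by fun_prop)).inter (isOpen_lt hH (by fun_prop))
    obtain ⟨i, hi⟩ := exists_subset_nhds_of_isCompact (V := Q) (U := U)
      hanti.directed_ge (fun i => (hQ i).1) fun x hx => hU.mem_nhds
        ⟨by simp [hLx x hx, hε j], by simp [hLx x hx, hε j]⟩
    have hmU : ∀ x ∈ Q (max i j), x ∈ U := fun x hx => hi (hanti (le_max_left i j) hx)
    obtain ⟨hc, hconv, hGpos, hHpos⟩ := hQ (max i j)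
    have hintegr : ∀ f : ℝ × ℝ → ℝ, Continuous f → IntegrableOn f (Q (max i j)) := fun f hf =>
      hf.continuousOn.integrableOn_compact hc
    obtain ⟨P, hP, P', hP', ψ, hψ⟩ := exists_normalizedConcave_of_integral_fst_pos hc hconv
      (F := fun t => G (L t) + ε j) (K := fun t => H (L t) + ε j) (by fun_prop) (by fun_prop)
      (hGpos.trans_le (setIntegral_mono_on (hintegr _ hG) (hintegr _ (by fun_prop)) hc.measurableSet
        fun x hx => (hmU x hx).1.le))
      (hHpos.trans_le (setIntegral_mono_on (hintegr _ hH) (hintegr _ (by fun_prop)) hc.measurableSet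
        fun x hx => (hmU x hx).2.le))
    exact ⟨P, hanti (le_max_right i j) hP, P', hanti (le_max_right i j) hP', ψ, hψ⟩
  choose P hP P' hP' ψ hψ hψG hψH using step
  have hPP : ∀ j, (P j, P' j) ∈ Q 0 ×ˢ Q 0 := fun j =>
    ⟨hanti (Nat.zero_le j) (hP j), hanti (Nat.zero_le j) (hP' j)⟩
  obtain ⟨⟨R, R'⟩, -, τ, hτ, hlimP⟩ := ((hQ 0).1.prod (hQ 0).1).tendsto_subseq hPP
  obtain ⟨σ, ψ', hσ, hψ', hlim⟩ := NormalizedConcave.exists_subseq fun i => hψ (τ i)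
  have hρ : StrictMono (τ ∘ σ) := hτ.comp hσ
  have hlimP' := hlimP.comp hσ.tendsto_atTop
  have hR : Tendsto (fun i => P (τ (σ i))) atTop (nhds R) :=
    (continuous_fst.tendsto _).comp hlimP'
  have hR' : Tendsto (fun i => P' (τ (σ i))) atTop (nhds R') :=
    (continuous_snd.tendsto _).comp hlimP'
  have hmem : ∀ {X : ℕ → ℝ × ℝ} {Y : ℝ × ℝ}, (∀ j, X j ∈ Q j) →
      Tendsto (fun i => X (τ (σ i))) atTop (nhds Y) → Y ∈ ⋂ i, Q i := fun hX hY =>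
    Set.mem_iInter.2 fun j => (hQ j).1.isClosed.mem_of_tendsto hY
      ((eventually_ge_atTop j).mono fun i hi => hanti (hi.trans (hρ.id_le i)) (hX _))
  have hRm := hmem hP hR
  have hRm' := hmem hP' hR'
  have hseg : ∀ s, L (R.1 + s * (R'.1 - R.1)) = R + s • (R' - R) := fun s => by
    ext
    · simp [L]
    · simp only [L, Prod.snd_add, Prod.smul_snd, Prod.snd_sub, smul_eq_mul, hline R hRm,
        hline R' hRm']
      ring
  have key : ∀ f : ℝ × ℝ → ℝ, Continuous f →
      (∀ j, 0 ≤ ∫ s in (0 : ℝ)..1, ψ j s ^ 1 * (f (L ((P j).1 + s * ((P' j).1 - (P j).1))) + ε j)) →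
      0 ≤ ∫ s in (0 : ℝ)..1, ψ' s ^ 1 * f (R + s • (R' - R)) := by
    intro f hf hpos
    obtain ⟨M, hM⟩ := ((hQ 0).1.image continuous_fst).exists_bound_of_continuousOn
      (hf.comp hL).continuousOn
    refine ge_of_tendsto' (NormalizedConcave.tendsto_integral 1 (fun i => hψ (τ (σ i))) hlim
      (F := fun i s => f (L ((P (τ (σ i))).1 + s * ((P' (τ (σ i))).1 - (P (τ (σ i))).1)))
        + ε (τ (σ i)))
      (F' := fun s => f (R + s • (R' - R))) (M := M + 1) (fun i => by fun_prop)
      (fun i s hs => ?_) fun s hs => ?_) fun i => hpos (τ (σ i))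
    · refine (abs_add_le _ _).trans (add_le_add (hM _ ?_) ?_)
      · refine ⟨P (τ (σ i)) + s • (P' (τ (σ i)) - P (τ (σ i))),
          (hQ 0).2.1.add_smul_sub_mem (hPP _).1 (hPP _).2 hs, by simp⟩
      · rw [abs_of_pos (hε _)]
        exact hε1 _
    · rw [← hseg, ← add_zero (f _)]
      refine Tendsto.add (((hf.comp hL).tendsto _).comp ?_) (hεlim.comp hρ.tendsto_atTop)
      have h1 : Tendsto (fun i => (P (τ (σ i))).1) atTop (nhds R.1) :=
        (continuous_fst.tendsto _).comp hR
      have h2 : Tendsto (fun i => (P' (τ (σ i))).1) atTop (nhds R'.1) :=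
        (continuous_fst.tendsto _).comp hR'
      exact h1.add (tendsto_const_nhds.mul (h2.sub h1))
  exact ⟨R, Set.mem_iInter.1 hRm 0, R', Set.mem_iInter.1 hRm' 0, ψ', hψ', key G hG hψG,
    key H hH hψH⟩

lemma IsGoodBody.preimage_swap {G H : ℝ × ℝ → ℝ} {Q : Set (ℝ × ℝ)} (hQ : IsGoodBody G H Q) :
    IsGoodBody (G ∘ Prod.swap) (H ∘ Prod.swap) (Prod.swap ⁻¹' Q) := by
  obtain ⟨hc, hconv, hG, hH⟩ := hQ
  have hI : ∀ f : ℝ × ℝ → ℝ, ∫ x in Prod.swap ⁻¹' Q, (f ∘ Prod.swap) x = ∫ x in Q, f x :=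
    fun f => (Measure.measurePreserving_swap (μ := volume) (ν := volume)).setIntegral_preimage_emb
      (MeasurableEquiv.prodComm (α := ℝ) (β := ℝ)).measurableEmbedding f Q
  refine ⟨?_, hconv.linear_preimage (LinearEquiv.prodComm ℝ ℝ ℝ).toLinearMap, by rwa [hI],
    by rwa [hI]⟩
  rw [← Set.image_swap_eq_preimage_swap]
  exact hc.image continuous_swap

/-- Planar localization: two continuous functions with positive integrals over a planar convex
body have nonnegative integrals over a segment with a common concave weight. -/
theorem IsGoodBody.exists_needle {G H : ℝ × ℝ → ℝ} (hG : Continuous G) (hH : Continuous H)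
    {Q₀ : Set (ℝ × ℝ)} (hQ₀ : IsGoodBody G H Q₀) :
    ∃ P ∈ Q₀, ∃ P' ∈ Q₀, ∃ ψ : ℝ → ℝ, NormalizedConcave ψ ∧
      0 ≤ (∫ s in (0 : ℝ)..1, ψ s ^ 1 * G (P + s • (P' - P))) ∧
      0 ≤ ∫ s in (0 : ℝ)..1, ψ s ^ 1 * H (P + s • (P' - P)) := by
  obtain ⟨Q, hanti, hQ, rfl, hintegr⟩ := hQ₀.exists_seq hG hH
  have hne : (⋂ i, Q i).Nonempty :=
    IsCompact.nonempty_iInter_of_sequence_nonempty_isCompact_isClosed Q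
      (fun i => hanti (Nat.le_succ i)) (fun i => (hQ i).nonempty) (hQ 0).1
      fun i => (hQ i).1.isClosed
  obtain ⟨u, v, r, huv, hline⟩ := exists_line_of_interior_eq_empty
    (convex_iInter fun i => (hQ i).2.1) hne hintegr
  by_cases hv : v = 0
  · have hu : u ≠ 0 := huv.resolve_right (not_not.2 hv)
    obtain ⟨P, hP, P', hP', ψ, hψ, h1, h2⟩ := exists_needle_of_graph (κ := 0) (c := r / u)
      (hG.comp continuous_swap) (hH.comp continuous_swap) (Q := fun i => Prod.swap ⁻¹' Q i)
      (fun i j hij => Set.preimage_mono (hanti hij)) (fun i => (hQ i).preimage_swap)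
      fun x hx => by
        have := hline x.swap (Set.mem_iInter.2 fun i => Set.mem_iInter.1 hx i)
        simp only [Prod.fst_swap, Prod.snd_swap, hv, zero_mul, add_zero] at this
        rw [← this]
        field_simp
        ring
    exact ⟨P.swap, hP, P'.swap, hP', ψ, hψ, h1, h2⟩
  · exact exists_needle_of_graph (κ := -u / v) (c := r / v) hG hH hanti hQ fun x hx => by
      rw [← hline x hx]
      field_simp
      ring

/-- Weighted geometric means of positive concave functions are concave. -/
lemma PosConcave.rpow_mul_rpow {c d : ℝ} {φ χ : ℝ → ℝ} (hφ : PosConcave c d φ)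
    (hχ : PosConcave c d χ) {v w : ℝ} (hv : 0 ≤ v) (hw : 0 ≤ w) (hvw : v + w = 1) :
    PosConcave c d fun x => φ x ^ v * χ x ^ w := by
  refine ⟨⟨convex_Ioo _ _, fun x hx y hy r s hr hs hrs => ?_⟩, fun x hx =>
    mul_pos (Real.rpow_pos_of_pos (hφ.2 x hx) _) (Real.rpow_pos_of_pos (hχ.2 x hx) _)⟩
  have hz := convex_Ioo c d hx hy hr hs hrs
  have hφx := hφ.2 x hx
  have hφy := hφ.2 y hy
  have hχx := hχ.2 x hx
  have hχy := hχ.2 y hy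
  have h1 := hφ.1.2 hx hy hr hs hrs
  have h2 := hχ.1.2 hx hy hr hs hrs
  have hφz := hφ.2 _ hz
  have hχz := hχ.2 _ hz
  simp only [smul_eq_mul] at h1 h2 hφz hχz ⊢
  set A := φ (r * x + s * y)
  set B := χ (r * x + s * y)
  have hAB : 0 < A ^ v * B ^ w :=
    mul_pos (Real.rpow_pos_of_pos hφz _) (Real.rpow_pos_of_pos hχz _)
  have amgm : ∀ p q : ℝ, 0 ≤ p → 0 ≤ q →
      p ^ v * q ^ w ≤ (A ^ v * B ^ w) * (v * (p / A) + w * (q / B)) := fun p q hp hq => by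
    have := Real.geom_mean_le_arith_mean2_weighted hv hw (div_nonneg hp hφz.le)
      (div_nonneg hq hχz.le) hvw
    rw [Real.div_rpow hp hφz.le, Real.div_rpow hq hχz.le, div_mul_div_comm,
      div_le_iff₀ hAB] at this
    linarith
  have hA : (r * φ x + s * φ y) / A ≤ 1 := (div_le_one hφz).2 h1
  have hB : (r * χ x + s * χ y) / B ≤ 1 := (div_le_one hχz).2 h2
  calc r * (φ x ^ v * χ x ^ w) + s * (φ y ^ v * χ y ^ w)
      ≤ r * ((A ^ v * B ^ w) * (v * (φ x / A) + w * (χ x / B))) +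
        s * ((A ^ v * B ^ w) * (v * (φ y / A) + w * (χ y / B))) := by
        exact add_le_add (mul_le_mul_of_nonneg_left (amgm _ _ hφx.le hχx.le) hr)
          (mul_le_mul_of_nonneg_left (amgm _ _ hφy.le hχy.le) hs)
    _ = (A ^ v * B ^ w) * (v * ((r * φ x + s * φ y) / A) + w * ((r * χ x + s * χ y) / B)) := by
        ring
    _ ≤ (A ^ v * B ^ w) * (v * 1 + w * 1) := by gcongr
    _ = A ^ v * B ^ w := by rw [mul_one, mul_one, hvw, mul_one]

lemma posConcave_affine {α β : ℝ} (h : ∀ t ∈ Set.Icc (0 : ℝ) 1, 0 ≤ α * t + β)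
    (hmid : 0 < α / 2 + β) : PosConcave 0 1 fun t => α * t + β := by
  have hconc : ConcaveOn ℝ (Set.Ioo (0 : ℝ) 1) fun t => α * t + β := by
    refine ⟨convex_Ioo _ _, fun x _ y _ a b _ _ hab => le_of_eq ?_⟩
    simp only [smul_eq_mul]
    linear_combination β * hab
  exact ⟨hconc, hconc.pos_of_nonneg_of_pos (fun t ht => h t (Set.Ioo_subset_Icc_self ht))
    (y := 1 / 2) ⟨by norm_num, by norm_num⟩ (by linarith)⟩

/-- Planar localization with powers of affine weights. -/
theorem exists_affine_needle_plane (m : ℕ) {G H : ℝ × ℝ → ℝ} (hG : Continuous G)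
    (hH : Continuous H) {α β : ℝ} {Q : Set (ℝ × ℝ)} (hc : IsCompact Q) (hconv : Convex ℝ Q)
    (hpos : ∀ x ∈ Q, 0 < α * x.1 + β) (hIG : 0 < ∫ x in Q, (α * x.1 + β) ^ m * G x)
    (hIH : 0 < ∫ x in Q, (α * x.1 + β) ^ m * H x) :
    ∃ A ∈ Q, ∃ B ∈ Q, ∃ α' β' : ℝ, (∀ t ∈ Set.Icc (0 : ℝ) 1, 0 < α' * t + β') ∧
      0 < (∫ t in (0 : ℝ)..1, (α' * t + β') ^ (m + 1) * G (A + t • (B - A))) ∧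
      0 < ∫ t in (0 : ℝ)..1, (α' * t + β') ^ (m + 1) * H (A + t • (B - A)) := by
  have hintegr : ∀ f : ℝ × ℝ → ℝ, Continuous f → IntegrableOn f Q := fun f hf =>
    hf.continuousOn.integrableOn_compact hc
  set W : ℝ := ∫ x in Q, (α * x.1 + β) ^ m with hW
  have hW0 : 0 ≤ W := setIntegral_nonneg hc.measurableSet fun x hx => pow_nonneg (hpos x hx).le m
  obtain ⟨ε, hε, hεlt⟩ : ∃ ε : ℝ, 0 < ε ∧ ε * W < min (∫ x in Q, (α * x.1 + β) ^ m * G x)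
      (∫ x in Q, (α * x.1 + β) ^ m * H x) := by
    have := lt_min hIG hIH
    refine ⟨_ / (W + 1), div_pos this (by linarith), ?_⟩
    rw [div_mul_eq_mul_div, div_lt_iff₀ (by linarith)]
    nlinarith
  have hsub : ∀ f : ℝ × ℝ → ℝ, Continuous f → ε * W < ∫ x in Q, (α * x.1 + β) ^ m * f x →
      0 < ∫ x in Q, (α * x.1 + β) ^ m * (f x - ε) := fun f hf hlt => by
    simp only [mul_sub]
    rw [integral_sub (hintegr _ (by fun_prop)) (hintegr _ (by fun_prop)), integral_mul_const]
    linarith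
  have hgood : IsGoodBody (fun x => (α * x.1 + β) ^ m * (G x - ε))
      (fun x => (α * x.1 + β) ^ m * (H x - ε)) Q :=
    ⟨hc, hconv, hsub G hG (hεlt.trans_le (min_le_left _ _)),
      hsub H hH (hεlt.trans_le (min_le_right _ _))⟩
  obtain ⟨P, hP, P', hP', ψ, hψ, hψG, hψH⟩ := hgood.exists_needle (by fun_prop) (by fun_prop)
  have hseg : ∀ s ∈ Set.Icc (0 : ℝ) 1, P + s • (P' - P) ∈ Q := fun s hs =>
    hconv.add_smul_sub_mem hP hP' hs
  have hlam : PosConcave 0 1 fun s => α * (P'.1 - P.1) * s + (α * P.1 + β) := by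
    have hp : ∀ s ∈ Set.Icc (0 : ℝ) 1, 0 < α * (P'.1 - P.1) * s + (α * P.1 + β) :=
      fun s hs => by
        have := hpos _ (hseg s hs)
        simp only [Prod.fst_add, Prod.smul_fst, Prod.fst_sub, smul_eq_mul] at this
        linarith
    refine posConcave_affine (fun s hs => (hp s hs).le) ?_
    have := hp (1 / 2) ⟨by norm_num, by norm_num⟩
    linarith
  have hm : (0 : ℝ) < (m : ℝ) + 1 := by positivity
  have hχ := hψ.1.rpow_mul_rpow hlam (v := 1 / ((m : ℝ) + 1)) (w := m / ((m : ℝ) + 1))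
    (by positivity) (by positivity) (by field_simp; ring)
  set χ : ℝ → ℝ := fun s => ψ s ^ (1 / ((m : ℝ) + 1)) *
    (α * (P'.1 - P.1) * s + (α * P.1 + β)) ^ (m / ((m : ℝ) + 1)) with hχdef
  have hχI : ∀ f : ℝ × ℝ → ℝ,
      ∫ s in (0 : ℝ)..1, χ s ^ (m + 1) * (f (P + s • (P' - P)) - ε) =
      ∫ s in (0 : ℝ)..1, ψ s ^ 1 *
        ((α * (P + s • (P' - P)).1 + β) ^ m * (f (P + s • (P' - P)) - ε)) := fun f => by
    simp only [intervalIntegral.integral_of_le zero_le_one, integral_Ioc_eq_integral_Ioo]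
    refine setIntegral_congr_fun measurableSet_Ioo fun s hs => ?_
    have h1 := (hψ.1.2 s hs).le
    have h2 := (hlam.2 s hs).le
    simp only [hχdef, mul_pow]
    rw [← Real.rpow_mul_natCast h1, ← Real.rpow_mul_natCast h2]
    push_cast
    rw [div_mul_cancel₀ _ hm.ne', div_mul_cancel₀ _ hm.ne', Real.rpow_one, Real.rpow_natCast]
    simp only [Prod.fst_add, Prod.smul_fst, Prod.fst_sub, smul_eq_mul]
    ring
  obtain ⟨a, ha, b, hb, α', β', hnn, hI1, hI2, hmid⟩ := hχ.exists_affine (p := m + 1)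
    (Nat.le_add_left 1 m) (g := fun s => G (P + s • (P' - P)) - ε)
    (h := fun s => H (P + s • (P' - P)) - ε) (by fun_prop) (by fun_prop)
    (by rw [hχI]; exact hψG) (by rw [hχI]; exact hψH)
  set A := P + a • (P' - P) with hA
  set B := P + b • (P' - P) with hB
  have hAB : ∀ t : ℝ, P + (a + t * (b - a)) • (P' - P) = A + t • (B - A) := fun t => by
    rw [hA, hB]
    module
  simp only [hAB] at hI1 hI2
  have hwpos := (posConcave_affine hnn hmid).integral_pow_pos (m + 1)
  have hstrict : ∀ f : ℝ × ℝ → ℝ, Continuous f →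
      0 ≤ ∫ t in (0 : ℝ)..1, (α' * t + β') ^ (m + 1) * (f (A + t • (B - A)) - ε) →
      ∀ᶠ η in nhds (0 : ℝ),
        0 < ∫ t in (0 : ℝ)..1, (α' * t + (β' + η)) ^ (m + 1) * f (A + t • (B - A)) := by
    intro f hf h0
    simp only [mul_sub] at h0
    rw [intervalIntegral.integral_sub (Continuous.intervalIntegrable (by fun_prop) _ _)
      (Continuous.intervalIntegrable (by fun_prop) _ _),
      intervalIntegral.integral_mul_const] at h0
    have hcont : Continuous fun η : ℝ =>
        ∫ t in (0 : ℝ)..1, (α' * t + (β' + η)) ^ (m + 1) * f (A + t • (B - A)) :=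
      intervalIntegral.continuous_parametric_intervalIntegral_of_continuous'
        (by unfold Function.uncurry; fun_prop) _ _
    refine hcont.continuousAt.eventually (lt_mem_nhds ?_)
    simp only [add_zero]
    have := mul_pos hwpos hε
    linarith
  obtain ⟨η, ⟨h1, h2⟩, hη⟩ := (((hstrict G hG hI1).and (hstrict H hH hI2)).filter_mono
    nhdsWithin_le_nhds |>.and (self_mem_nhdsWithin (a := (0 : ℝ)) (s := Set.Ioi 0))).exists
  have hη0 : 0 < η := hη
  exact ⟨A, hseg a ha, B, hseg b hb, α', β' + η, fun t ht => by linarith [hnn t ht], h1, h2⟩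

/-- The centred cube of half-width `R`. -/
def cube (n : ℕ) (R : ℝ) : Set (Fin n → ℝ) := Set.Icc (fun _ => -R) fun _ => R

lemma isCompact_cube (n : ℕ) (R : ℝ) : IsCompact (cube n R) := isCompact_Icc

lemma convex_cube (n : ℕ) (R : ℝ) : Convex ℝ (cube n R) := convex_Icc _ _

lemma cons_mem_cube {n : ℕ} {R y : ℝ} {x : Fin n → ℝ} :
    (Fin.cons y x : Fin (n + 1) → ℝ) ∈ cube (n + 1) R ↔ y ∈ Set.Icc (-R) R ∧ x ∈ cube n R := by
  simp only [cube, Set.mem_Icc, Pi.le_def, Fin.forall_fin_succ, Fin.cons_zero, Fin.cons_succ]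
  tauto

lemma integral_cube_succ {n : ℕ} {R : ℝ} (hR : 0 ≤ R) {g : (Fin (n + 1) → ℝ) → ℝ}
    (hg : Continuous g) :
    ∫ x in cube (n + 1) R, g x =
      ∫ x in cube n R, ∫ y in (-R)..R, g (Fin.cons y x : Fin (n + 1) → ℝ) := by
  have hmp := (volume_preserving_piFinSuccAbove (fun _ : Fin (n + 1) => ℝ) 0).symm
  have hsymm : ∀ x, (MeasurableEquiv.piFinSuccAbove (fun _ : Fin (n + 1) => ℝ) 0).symm x =
      Fin.cons x.1 x.2 := fun x => Fin.insertNth_zero (α := fun _ => ℝ) x.1 x.2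
  have hpre : (MeasurableEquiv.piFinSuccAbove (fun _ : Fin (n + 1) => ℝ) 0).symm ⁻¹'
      cube (n + 1) R = Set.Icc (-R) R ×ˢ cube n R := by
    ext x
    rw [Set.mem_preimage, hsymm, cons_mem_cube, Set.mem_prod]
  rw [← hmp.setIntegral_preimage_emb (MeasurableEquiv.measurableEmbedding _), hpre,
    Measure.volume_eq_prod, ← setIntegral_prod_swap, setIntegral_prod]
  · refine integral_congr_ae (Eventually.of_forall fun x => ?_)
    simp only [hsymm, intervalIntegral.integral_of_le (neg_le_self hR),
      ← integral_Icc_eq_integral_Ioc, Prod.swap_prod_mk]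
  · rw [← Measure.volume_eq_prod]
    refine ContinuousOn.integrableOn_compact ((isCompact_cube n R).prod isCompact_Icc)
      (Continuous.continuousOn ?_)
    simp only [hsymm, Prod.fst_swap, Prod.snd_swap]
    exact hg.comp (Continuous.finCons (A := fun _ => ℝ) continuous_snd continuous_fst)

lemma exists_affine_needle_line {R : ℝ} (hR : 0 ≤ R) {g h : (Fin 1 → ℝ) → ℝ}
    (hg : Continuous g) (hh : Continuous h)
    (hgpos : 0 < ∫ x in cube 1 R, g x) (hhpos : 0 < ∫ x in cube 1 R, h x) :
    ∃ a ∈ cube 1 R, ∃ b ∈ cube 1 R,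
      0 < (∫ t in (0 : ℝ)..1, g (a + t • (b - a))) ∧
      0 < ∫ t in (0 : ℝ)..1, h (a + t • (b - a)) := by
  have hintegr : ∀ f : (Fin 1 → ℝ) → ℝ, Continuous f → ∫ x in cube 1 R, f x =
      ∫ y in (-R)..R, f (fun _ => y) := fun f hf => by
    have hcube : cube 0 R = Set.univ :=
      Set.eq_univ_of_forall fun x => ⟨fun i => i.elim0, fun i => i.elim0⟩
    rw [integral_cube_succ hR hf, hcube, Measure.restrict_univ, Measure.volume_pi_eq_dirac 0,
      integral_dirac]
    refine intervalIntegral.integral_congr fun y _ => congrArg f (funext fun i => ?_)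
    refine Fin.cases ?_ (fun j => j.elim0) i
    rfl
  have hR0 : R ≠ 0 := by
    rintro rfl
    simp [hintegr g hg] at hgpos
  have hseg : ∀ f : (Fin 1 → ℝ) → ℝ, Continuous f → 0 < ∫ x in cube 1 R, f x →
      0 < ∫ t in (0 : ℝ)..1, f ((fun _ => -R) + t • ((fun _ => R) - fun _ => -R)) := by
    intro f hfc hf
    have h1 := intervalIntegral.integral_comp_add_mul (a := 0) (b := 1)
      (fun y => f (fun _ => y)) (show 2 * R ≠ 0 by positivity) (-R)
    have h2 : ∀ t : ℝ, ((fun _ => -R) + t • ((fun _ => R) - fun _ => -R) : Fin 1 → ℝ) =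
        fun _ => -R + 2 * R * t := fun t => by
      ext
      simp
      ring
    simp only [h2]
    rw [h1, mul_zero, mul_one, add_zero, show -R + 2 * R = R by ring, ← hintegr f hfc]
    exact smul_pos (by positivity) hf
  have hle : (fun _ : Fin 1 => -R) ≤ fun _ => R := fun _ => by linarith
  exact ⟨_, Set.left_mem_Icc.2 hle, _, Set.right_mem_Icc.2 hle, hseg g hg hgpos, hseg h hh hhpos⟩

/-- The localization lemma for continuous functions on a cube. -/
theorem exists_affine_needle_cube (n : ℕ) {R : ℝ} (hR : 0 ≤ R) {g h : (Fin (n + 1) → ℝ) → ℝ}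
    (hg : Continuous g) (hh : Continuous h)
    (hgpos : 0 < ∫ x in cube (n + 1) R, g x) (hhpos : 0 < ∫ x in cube (n + 1) R, h x) :
    ∃ a ∈ cube (n + 1) R, ∃ b ∈ cube (n + 1) R, ∃ α β : ℝ,
      (∀ t ∈ Set.Icc (0 : ℝ) 1, 0 < α * t + β) ∧
      0 < (∫ t in (0 : ℝ)..1, (α * t + β) ^ n * g (a + t • (b - a))) ∧
      0 < ∫ t in (0 : ℝ)..1, (α * t + β) ^ n * h (a + t • (b - a)) := by
  induction n with
  | zero =>
    obtain ⟨a, ha, b, hb, h1, h2⟩ := exists_affine_needle_line hR hg hh hgpos hhpos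
    exact ⟨a, ha, b, hb, 0, 1, fun t _ => by norm_num, by simpa using h1, by simpa using h2⟩
  | succ n ih =>
    have hmarg : ∀ f : (Fin (n + 2) → ℝ) → ℝ, Continuous f →
        Continuous fun x => ∫ y in (-R)..R, f (Fin.cons y x : Fin (n + 2) → ℝ) := fun f hf =>
      intervalIntegral.continuous_parametric_intervalIntegral_of_continuous'
        (f := fun x y => f (Fin.cons y x : Fin (n + 2) → ℝ))
        (hf.comp (Continuous.finCons (A := fun _ => ℝ) continuous_snd continuous_fst)) _ _
    rw [integral_cube_succ hR hg] at hgpos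
    rw [integral_cube_succ hR hh] at hhpos
    obtain ⟨a, ha, b, hb, α, β, hpos, h1, h2⟩ := ih (hmarg g hg) (hmarg h hh) hgpos hhpos
    have hcons : Continuous fun x : ℝ × ℝ =>
        (Fin.cons x.2 (a + x.1 • (b - a)) : Fin (n + 2) → ℝ) :=
      Continuous.finCons (A := fun _ => ℝ) continuous_snd
        (by fun_prop : Continuous fun x : ℝ × ℝ => a + x.1 • (b - a))
    have hQc : IsCompact (Set.Icc (0 : ℝ) 1 ×ˢ Set.Icc (-R) R) := isCompact_Icc.prod isCompact_Icc
    have hI : ∀ f : (Fin (n + 2) → ℝ) → ℝ, Continuous f →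
        ∫ x in Set.Icc (0 : ℝ) 1 ×ˢ Set.Icc (-R) R,
          (α * x.1 + β) ^ n * f (Fin.cons x.2 (a + x.1 • (b - a)) : Fin (n + 2) → ℝ) =
        ∫ t in (0 : ℝ)..1, (α * t + β) ^ n *
          ∫ y in (-R)..R, f (Fin.cons y (a + t • (b - a)) : Fin (n + 2) → ℝ) := fun f hf => by
      rw [Measure.volume_eq_prod, setIntegral_prod, intervalIntegral.integral_of_le zero_le_one,
        ← integral_Icc_eq_integral_Ioc]
      · refine integral_congr_ae (Eventually.of_forall fun t => ?_)
        simp only [intervalIntegral.integral_of_le (neg_le_self hR),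
          ← integral_Icc_eq_integral_Ioc]
        rw [integral_const_mul]
      · rw [← Measure.volume_eq_prod]
        refine ContinuousOn.integrableOn_compact hQc (Continuous.continuousOn ?_)
        exact (by fun_prop : Continuous fun x : ℝ × ℝ => (α * x.1 + β) ^ n).mul (hf.comp hcons)
    obtain ⟨A, hA, B, hB, α', β', hpos', h1', h2'⟩ := exists_affine_needle_plane n
      (hg.comp hcons) (hh.comp hcons) hQc ((convex_Icc _ _).prod (convex_Icc _ _))
      (fun x hx => hpos _ hx.1) (by rw [← hI g hg] at h1; exact h1)
      (by rw [← hI h hh] at h2; exact h2)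
    have hseg : ∀ t : ℝ,
        (Fin.cons A.2 (a + A.1 • (b - a)) + t • (Fin.cons B.2 (a + B.1 • (b - a)) -
          Fin.cons A.2 (a + A.1 • (b - a))) : Fin (n + 2) → ℝ) =
        Fin.cons (A + t • (B - A)).2 (a + (A + t • (B - A)).1 • (b - a)) := fun t => by
      ext i
      refine Fin.cases ?_ (fun i => ?_) i
      · simp
      · simp
        ring
    refine ⟨Fin.cons A.2 (a + A.1 • (b - a)),
      cons_mem_cube.2 ⟨hA.2, (convex_cube _ _).add_smul_sub_mem ha hb hA.1⟩,
      Fin.cons B.2 (a + B.1 • (b - a)),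
      cons_mem_cube.2 ⟨hB.2, (convex_cube _ _).add_smul_sub_mem ha hb hB.1⟩, α', β', hpos', ?_, ?_⟩
    · simp only [hseg]
      exact h1'
    · simp only [hseg]
      exact h2'

/-- The largest `k`-Lipschitz minorant of `u`, by inf-convolution with `k * dist`. -/
def lipschitzEnvelope {X : Type*} [PseudoMetricSpace X] (u : X → ℝ) (k : ℕ) (x : X) : ℝ :=
  ⨅ y, (u y + k * dist x y)

section LipschitzEnvelope

variable {X : Type*} [PseudoMetricSpace X] {u : X → ℝ}

lemma lipschitzEnvelope_nonneg (hu : ∀ x, 0 ≤ u x) (k : ℕ) (x : X) :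
    0 ≤ lipschitzEnvelope u k x :=
  Real.iInf_nonneg fun y => add_nonneg (hu y) (by positivity)

lemma lipschitzEnvelope_le_add (hu : ∀ x, 0 ≤ u x) (k : ℕ) (x y : X) :
    lipschitzEnvelope u k x ≤ u y + k * dist x y :=
  ciInf_le ⟨0, by rintro _ ⟨z, rfl⟩; exact add_nonneg (hu z) (by positivity)⟩ y

lemma lipschitzEnvelope_le (hu : ∀ x, 0 ≤ u x) (k : ℕ) (x : X) :
    lipschitzEnvelope u k x ≤ u x := by
  simpa using lipschitzEnvelope_le_add hu k x x

lemma continuous_lipschitzEnvelope (hu : ∀ x, 0 ≤ u x) (k : ℕ) :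
    Continuous (lipschitzEnvelope u k) := by
  refine (LipschitzWith.of_le_add_mul (k : NNReal) fun x y => ?_).continuous
  have : Nonempty X := ⟨x⟩
  rw [← sub_le_iff_le_add]
  refine le_ciInf fun z => ?_
  have h := lipschitzEnvelope_le_add hu k x z
  have h' := mul_le_mul_of_nonneg_left (dist_triangle x y z) k.cast_nonneg (α := ℝ)
  simp only [NNReal.coe_natCast]
  linarith

lemma tendsto_lipschitzEnvelope (hu : ∀ x, 0 ≤ u x) (hlsc : LowerSemicontinuous u) (x : X) :
    Tendsto (fun k => lipschitzEnvelope u k x) atTop (nhds (u x)) := by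
  refine tendsto_order.2 ⟨fun c hc => ?_, fun c hc =>
    Eventually.of_forall fun k => (lipschitzEnvelope_le hu k x).trans_lt hc⟩
  obtain ⟨d, hcd, hd⟩ := exists_between hc
  obtain ⟨δ, hδ, hball⟩ := Metric.eventually_nhds_iff.1 (hlsc x d hd)
  filter_upwards [eventually_ge_atTop ⌈d / δ⌉₊] with k hk
  have hk' : d ≤ k * δ := (div_le_iff₀ hδ).1 ((Nat.le_ceil _).trans (by exact_mod_cast hk))
  have : Nonempty X := ⟨x⟩
  refine hcd.trans_le (le_ciInf fun y => ?_)
  by_cases hy : dist y x < δ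
  · have h : 0 ≤ (k : ℝ) * dist x y := by positivity
    linarith [hball hy]
  · rw [dist_comm x y]
    have h := mul_le_mul_of_nonneg_left (not_lt.1 hy) k.cast_nonneg (α := ℝ)
    linarith [hu y]

end LipschitzEnvelope

lemma lowerSemicontinuous_indicator_isOpen {X : Type*} [TopologicalSpace X] {U : Set X}
    (hU : IsOpen U) {f : X → ℝ} (hf : LowerSemicontinuous f) (hpos : ∀ x ∈ U, 0 ≤ f x) :
    LowerSemicontinuous (U.indicator f) := by
  have hnonneg : ∀ y, 0 ≤ U.indicator f y := fun y => Set.indicator_nonneg hpos y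
  intro x c hc
  by_cases hx : x ∈ U
  · rw [Set.indicator_of_mem hx] at hc
    filter_upwards [hf x c hc, hU.mem_nhds hx] with y hy hyU
    rwa [Set.indicator_of_mem hyU]
  · rw [Set.indicator_of_notMem hx] at hc
    exact Eventually.of_forall fun y => hc.trans_le (hnonneg y)

lemma exists_continuous_le_of_integral_pos {n : ℕ} {s : Set (Fin n → ℝ)} (hs : IsCompact s)
    (hconv : Convex ℝ s) {g : (Fin n → ℝ) → ℝ} (hlsc : LowerSemicontinuous g)
    (hintegr : Integrable g) (hpos : 0 < ∫ x in s, g x) :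
    ∃ g' : (Fin n → ℝ) → ℝ, Continuous g' ∧ (∀ x ∈ interior s, g' x ≤ g x) ∧
      0 < ∫ x in s, g' x := by
  have hae : interior s =ᵐ[volume] s :=
    interior_ae_eq_of_null_frontier (hconv.addHaar_frontier volume)
  obtain ⟨c, hc⟩ := (hlsc.lowerSemicontinuousOn s).bddBelow_of_isCompact hs
  have hfpos : ∀ x ∈ interior s, 0 ≤ g x + -c := fun x hx => by
    linarith [hc (Set.mem_image_of_mem g (interior_subset hx))]
  set u := (interior s).indicator fun x => g x + -c with hu_def
  have hu : ∀ x, 0 ≤ u x := fun x => Set.indicator_nonneg hfpos x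
  have hulsc : LowerSemicontinuous u := lowerSemicontinuous_indicator_isOpen isOpen_interior
    (hlsc.add (lowerSemicontinuous_const (z := -c))) hfpos
  have hfin : volume s < ⊤ := hs.measure_lt_top
  have : IsFiniteMeasure (volume.restrict s) := ⟨by simpa using hfin⟩
  have hu_int : IntegrableOn u s :=
    ((hintegr.integrableOn.add (integrable_const _)).indicator isOpen_interior.measurableSet)
  have hlim : Tendsto (fun k => ∫ x in s, (lipschitzEnvelope u k x + c)) atTop
      (nhds (∫ x in s, (u x + c))) := by
    refine tendsto_integral_of_dominated_convergence (fun x => u x + |c|)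
      (fun k => ((continuous_lipschitzEnvelope hu k).add
        continuous_const).aestronglyMeasurable) (hu_int.add (integrable_const _))
      (fun k => Eventually.of_forall fun x => ?_)
      (Eventually.of_forall fun x => (tendsto_lipschitzEnvelope hu hulsc x).add_const c)
    refine (norm_add_le _ _).trans (add_le_add ?_ le_rfl)
    rw [Real.norm_of_nonneg (lipschitzEnvelope_nonneg hu k x)]
    exact lipschitzEnvelope_le hu k x
  have heq : ∫ x in s, (u x + c) = ∫ x in s, g x := by
    rw [← setIntegral_congr_set hae, ← setIntegral_congr_set hae]
    refine setIntegral_congr_fun isOpen_interior.measurableSet fun x hx => ?_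
    simp [hu_def, Set.indicator_of_mem hx]
  rw [heq] at hlim
  obtain ⟨k, hk⟩ := (hlim.eventually (lt_mem_nhds hpos)).exists
  refine ⟨_, (continuous_lipschitzEnvelope hu k).add continuous_const, fun x hx => ?_, hk⟩
  have h : lipschitzEnvelope u k x ≤ g x + -c :=
    (lipschitzEnvelope_le hu k x).trans_eq (Set.indicator_of_mem hx _)
  change lipschitzEnvelope u k x + c ≤ g x
  linarith

lemma iUnion_cube (n : ℕ) : ⋃ k : ℕ, cube n k = Set.univ := by
  refine Set.eq_univ_of_forall fun x => Set.mem_iUnion.2 ?_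
  obtain ⟨k, hk⟩ := exists_nat_ge ‖x‖
  refine ⟨k, fun i => ?_, fun i => ?_⟩
  · exact (abs_le.1 ((norm_le_pi_norm x i).trans hk)).1
  · exact (abs_le.1 ((norm_le_pi_norm x i).trans hk)).2

lemma eventually_integral_cube_pos {n : ℕ} {g : (Fin n → ℝ) → ℝ} (hintegr : Integrable g)
    (hpos : 0 < ∫ x, g x) : ∀ᶠ k : ℕ in atTop, 0 < ∫ x in cube n k, g x := by
  have hmono : Monotone fun k : ℕ => cube n k := fun i j hij =>
    Set.Icc_subset_Icc (fun _ => neg_le_neg (Nat.cast_le.2 hij)) (fun _ => Nat.cast_le.2 hij)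
  have h := tendsto_setIntegral_of_monotone (f := g) (μ := volume) (s := fun k : ℕ => cube n k)
    (fun k => (isCompact_cube n (k : ℝ)).measurableSet) hmono (by
      rw [iUnion_cube]; exact hintegr.integrableOn)
  rw [iUnion_cube, setIntegral_univ] at h
  exact h.eventually (lt_mem_nhds hpos)

section Segment

variable {E : Type*} [NormedAddCommGroup E] [NormedSpace ℝ E] [FiniteDimensional ℝ E]
  [MeasurableSpace E] [BorelSpace E] {μ : Measure E} [μ.IsAddHaarMeasure] {g : E → ℝ}

lemma lintegral_enorm_comp_segment (hg : Measurable g) (a : E) {t : ℝ} (ht : t ≠ 0) :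
    ∫⁻ b, ‖g (a + t • (b - a))‖ₑ ∂μ =
      ENNReal.ofReal |(t ^ Module.finrank ℝ E)⁻¹| * ∫⁻ x, ‖g x‖ₑ ∂μ := by
  have hsub : ∀ b, a + t • (b - a) = (a - t • a) + t • b := fun b => by
    rw [smul_sub]; abel
  have hmeas : Measurable fun y => ‖g ((a - t • a) + y)‖ₑ :=
    (hg.comp (measurable_const_add _)).enorm
  simp only [hsub]
  rw [← lintegral_map (f := fun y => ‖g ((a - t • a) + y)‖ₑ) hmeas (measurable_const_smul t),
    Measure.map_addHaar_smul μ ht, lintegral_smul_measure,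
    lintegral_add_left_eq_self fun y => ‖g y‖ₑ, smul_eq_mul]

lemma measurable_segment :
    Measurable fun p : (E × E) × ℝ => p.1.1 + p.2 • (p.1.2 - p.1.1) :=
  Continuous.measurable (by fun_prop)

lemma ae_integrableOn_segment_half (hg : Measurable g) (hintegr : Integrable g μ) :
    ∀ᵐ p : E × E ∂μ.prod μ,
      IntegrableOn (fun t : ℝ => g (p.1 + t • (p.2 - p.1))) (Set.Icc (1 / 2) 1) := by
  have hG : Measurable fun q : (E × E) × ℝ => ‖g (q.1.1 + q.2 • (q.1.2 - q.1.1))‖ₑ :=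
    (hg.comp measurable_segment).enorm
  have hmeas : Measurable fun p : E × E =>
      ∫⁻ t in Set.Icc (1 / 2 : ℝ) 1, ‖g (p.1 + t • (p.2 - p.1))‖ₑ := hG.lintegral_prod_right'
  have hfin : ∀ᵐ p : E × E ∂μ.prod μ,
      ∫⁻ t in Set.Icc (1 / 2 : ℝ) 1, ‖g (p.1 + t • (p.2 - p.1))‖ₑ < ⊤ := by
    refine (Measure.ae_prod_iff_ae_ae (measurableSet_lt hmeas measurable_const)).2
      (Eventually.of_forall fun a => ?_)
    refine ae_lt_top (hmeas.comp measurable_prodMk_left) (ne_of_lt ?_)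
    rw [lintegral_lintegral_swap (f := fun b (t : ℝ) => ‖g (a + t • (b - a))‖ₑ)
      (hG.comp ((measurable_const.prodMk measurable_fst).prodMk measurable_snd)).aemeasurable]
    have hle : ∀ t ∈ Set.Icc (1 / 2 : ℝ) 1, ∫⁻ b, ‖g (a + t • (b - a))‖ₑ ∂μ ≤
        ENNReal.ofReal (2 ^ Module.finrank ℝ E) * ∫⁻ x, ‖g x‖ₑ ∂μ := fun t ht => by
      have htpos : 0 < t := lt_of_lt_of_le (by norm_num) ht.1
      rw [lintegral_enorm_comp_segment hg a htpos.ne', abs_of_pos (by positivity), ← inv_pow]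
      gcongr
      rw [inv_le_comm₀ htpos two_pos]
      simpa using ht.1
    refine (setLIntegral_mono measurable_const hle).trans_lt ?_
    rw [setLIntegral_const]
    exact ENNReal.mul_lt_top (ENNReal.mul_lt_top ENNReal.ofReal_lt_top hintegr.2)
      measure_Icc_lt_top
  filter_upwards [hfin] with p hp
  exact ⟨(hg.comp (measurable_segment.comp
    (measurable_const.prodMk measurable_id))).aestronglyMeasurable, hp⟩

lemma ae_intervalIntegrable_segment (hg : Measurable g) (hintegr : Integrable g μ) :
    ∀ᵐ p : E × E ∂μ.prod μ,
      IntervalIntegrable (fun t : ℝ => g (p.1 + t • (p.2 - p.1))) volume 0 1 := by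
  have h := ae_integrableOn_segment_half hg hintegr
  filter_upwards [h, Measure.measurePreserving_swap.quasiMeasurePreserving.ae h] with p hp hq
  have hle : (1 / 2 : ℝ) ≤ 1 := by norm_num
  have hright := (intervalIntegrable_iff_integrableOn_Icc_of_le hle).2 hp
  have hleft := ((intervalIntegrable_iff_integrableOn_Icc_of_le hle).2 hq).comp_sub_left 1
  refine IntervalIntegrable.trans (b := 1 / 2) ?_ hright
  convert hleft.symm using 1
  · ext t
    simp only [Prod.fst_swap, Prod.snd_swap, sub_smul, smul_sub, one_smul]
    congr 1
    abel
  · norm_num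
  · norm_num

end Segment

lemma integral_affine_pow_mul_mono {m : ℕ} {α β : ℝ}
    (hpos : ∀ t ∈ Set.Icc (0 : ℝ) 1, 0 < α * t + β) {f f' : ℝ → ℝ}
    (hf : IntervalIntegrable f volume 0 1) (hf' : Continuous f')
    (hle : ∀ t ∈ Set.Icc (0 : ℝ) 1, f' t ≤ f t) :
    ∫ t in (0 : ℝ)..1, (α * t + β) ^ m * f' t ≤ ∫ t in (0 : ℝ)..1, (α * t + β) ^ m * f t := by
  have hcont : Continuous fun t : ℝ => (α * t + β) ^ m := by fun_prop
  exact intervalIntegral.integral_mono_on zero_le_one ((hcont.mul hf').intervalIntegrable 0 1)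
    (hf.continuousOn_mul hcont.continuousOn)
    fun t ht => mul_le_mul_of_nonneg_left (hle t ht) (pow_nonneg (hpos t ht).le m)

lemma continuous_integral_segment {E : Type*} [NormedAddCommGroup E] [NormedSpace ℝ E] {m : ℕ}
    {α β : ℝ} {f : E → ℝ} (hf : Continuous f) :
    Continuous fun p : E × E =>
      ∫ t in (0 : ℝ)..1, (α * t + β) ^ m * f (p.1 + t • (p.2 - p.1)) := by
  refine intervalIntegral.continuous_parametric_intervalIntegral_of_continuous' ?_ 0 1
  fun_prop

/-- The localization lemma in coordinates, with the line segment parametrized from `a` and with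
a positive affine weight. -/
theorem exists_affine_needle (m : ℕ) {g h : (Fin (m + 1) → ℝ) → ℝ}
    (hg : LowerSemicontinuous g) (hh : LowerSemicontinuous h)
    (hg_int : Integrable g) (hh_int : Integrable h)
    (hg_pos : 0 < ∫ x, g x) (hh_pos : 0 < ∫ x, h x) :
    ∃ (a b : Fin (m + 1) → ℝ) (α β : ℝ),
      (∀ t ∈ Set.Icc (0 : ℝ) 1, 0 < α * t + β) ∧
      0 < (∫ t in (0 : ℝ)..1, (α * t + β) ^ m * g (a + t • (b - a))) ∧
      0 < ∫ t in (0 : ℝ)..1, (α * t + β) ^ m * h (a + t • (b - a)) := by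
  obtain ⟨k, hk, hgk, hhk⟩ := ((eventually_gt_atTop 0).and
    ((eventually_integral_cube_pos hg_int hg_pos).and
      (eventually_integral_cube_pos hh_int hh_pos))).exists
  have hR : (0 : ℝ) < k := Nat.cast_pos.2 hk
  obtain ⟨g', hg'c, hg'le, hg'pos⟩ := exists_continuous_le_of_integral_pos
    (isCompact_cube _ (k : ℝ)) (convex_cube _ _) hg hg_int hgk
  obtain ⟨h', hh'c, hh'le, hh'pos⟩ := exists_continuous_le_of_integral_pos
    (isCompact_cube _ (k : ℝ)) (convex_cube _ _) hh hh_int hhk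
  obtain ⟨a, ha, b, hb, α, β, hpos, hga, hha⟩ :=
    exists_affine_needle_cube m hR.le hg'c hh'c hg'pos hh'pos
  have hconv := (convex_cube (m + 1) (k : ℝ)).interior
  have hne : (interior (cube (m + 1) (k : ℝ))).Nonempty := ⟨0, mem_interior_iff_mem_nhds.2
    (pi_Icc_mem_nhds (fun _ => neg_lt_zero.2 hR) fun _ => hR)⟩
  have hcl : closure (interior (cube (m + 1) (k : ℝ))) = cube (m + 1) k := by
    rw [(convex_cube _ _).closure_interior_eq_closure_of_nonempty_interior hne,
      (isCompact_cube _ _).isClosed.closure_eq]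
  have hgo := isOpen_lt continuous_const (continuous_integral_segment hg'c (m := m) (α := α)
    (β := β)) (f := fun _ => 0)
  have hho := isOpen_lt continuous_const (continuous_integral_segment hh'c (m := m) (α := α)
    (β := β)) (f := fun _ => 0)
  have hab : (a, b) ∈ closure
      (interior (cube (m + 1) (k : ℝ)) ×ˢ interior (cube (m + 1) (k : ℝ))) := by
    rw [closure_prod_eq, hcl]
    exact ⟨ha, hb⟩
  have hintegr := isOpen_interior (s := cube (m + 1) (k : ℝ))
  have hopen := (hgo.inter hho).inter (hintegr.prod hintegr)
  have hnonempty := mem_closure_iff.1 hab _ (hgo.inter hho) ⟨hga, hha⟩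
  obtain ⟨p, ⟨⟨hgp, hhp⟩, hp1, hp2⟩, hgi, hhi⟩ :=
    (frequently_ae_mem_iff.2 (hopen.measure_pos (volume.prod volume) hnonempty).ne').and_eventually
      ((ae_intervalIntegrable_segment hg.measurable hg_int).and
        (ae_intervalIntegrable_segment hh.measurable hh_int)) |>.exists
  have hmem : ∀ t ∈ Set.Icc (0 : ℝ) 1,
      p.1 + t • (p.2 - p.1) ∈ interior (cube (m + 1) (k : ℝ)) :=
    fun t ht => hconv.add_smul_sub_mem hp1 hp2 ht
  exact ⟨p.1, p.2, α, β, hpos,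
    lt_of_lt_of_le hgp (integral_affine_pow_mul_mono hpos hgi (by fun_prop)
      fun t ht => hg'le _ (hmem t ht)),
    lt_of_lt_of_le hhp (integral_affine_pow_mul_mono hpos hhi (by fun_prop)
      fun t ht => hh'le _ (hmem t ht))⟩

/-- Localization Lemma: if `g, h : ℝⁿ → ℝ` are lower semi-continuous
integrable functions with positive integrals, then there are points `a, b ∈ ℝⁿ` and an
affine function `ℓ(t) = α t + β` that is nonnegative on `[0,1]` such that
`∫₀¹ ℓ(t)^{n-1} g((1-t)a + tb) dt > 0` and `∫₀¹ ℓ(t)^{n-1} h((1-t)a + tb) dt > 0`. -/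
theorem localization_lemma
    (n : ℕ) (g h : EuclideanSpace ℝ (Fin n) → ℝ)
    (hg_lsc : LowerSemicontinuous g) (hh_lsc : LowerSemicontinuous h)
    (hg_int : Integrable g) (hh_int : Integrable h)
    (hg_pos : 0 < ∫ x, g x) (hh_pos : 0 < ∫ x, h x) :
    ∃ (a b : EuclideanSpace ℝ (Fin n)) (α β : ℝ),
      (∀ t ∈ Set.Icc (0:ℝ) 1, 0 ≤ α * t + β) ∧
      (0 < ∫ t in (0:ℝ)..1, (α * t + β) ^ (n - 1) * g ((1 - t) • a + t • b)) ∧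
      (0 < ∫ t in (0:ℝ)..1, (α * t + β) ^ (n - 1) * h ((1 - t) • a + t • b)) := by
  rcases n with _ | m
  · have hconst : ∀ f : EuclideanSpace ℝ (Fin 0) → ℝ, 0 < ∫ x, f x → 0 < f 0 := fun f hf => by
      rw [integral_unique, smul_eq_mul] at hf
      by_contra! hle
      exact (mul_nonpos_of_nonneg_of_nonpos measureReal_nonneg
        ((congrArg f (Subsingleton.elim _ _)).trans_le hle)).not_gt hf
    refine ⟨0, 0, 0, 1, fun t _ => by norm_num, ?_, ?_⟩
    · simpa using hconst g hg_pos
    · simpa using hconst h hh_pos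
  · have hpres := PiLp.volume_preserving_toLp (Fin (m + 1))
    have hemb := (MeasurableEquiv.toLp 2 (Fin (m + 1) → ℝ)).measurableEmbedding
    have hcont : Continuous (WithLp.toLp 2 : (Fin (m + 1) → ℝ) → EuclideanSpace ℝ _) :=
      PiLp.continuous_toLp 2 _
    obtain ⟨a, b, α, β, hpos, hga, hha⟩ := exists_affine_needle m
      (hg_lsc.comp hcont) (hh_lsc.comp hcont)
      ((hpres.integrable_comp_emb hemb).2 hg_int) ((hpres.integrable_comp_emb hemb).2 hh_int)
      (by simpa only [Function.comp_apply, hpres.integral_comp hemb] using hg_pos)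
      (by simpa only [Function.comp_apply, hpres.integral_comp hemb] using hh_pos)
    have hpt : ∀ t : ℝ, (1 - t) • WithLp.toLp 2 a + t • WithLp.toLp 2 b =
        WithLp.toLp 2 (a + t • (b - a)) := fun t => by
      rw [← WithLp.toLp_smul, ← WithLp.toLp_smul, ← WithLp.toLp_add]
      congr 1
      module
    refine ⟨WithLp.toLp 2 a, WithLp.toLp 2 b, α, β, fun t ht => (hpos t ht).le, ?_, ?_⟩
    · simpa only [hpt, Nat.add_sub_cancel, Function.comp_apply] using hga
    · simpa only [hpt, Nat.add_sub_cancel, Function.comp_apply] using hha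
end
end
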